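/- arXiv:1201.0936 — 3 statements merged into one kernel-verified Lean document; each statement's English description precedes it below -/
import Mathlib

section
/- Every ℂ-algebra automorphism φ of A = ℂ[x,y,z]/(x³y + y³ + z²) is diagonal: there exist α, β, γ ∈ ℂ* with α³β = β³ = γ² such that φ(x) = αx, φ(y) = βy, φ(z) = γz, where x, y, z denote the images of the variables in A. In particular, every automorphism of the Klein surface {x³y + y³ + z² = 0} ⊂ ℂ³ extends to a diagonal linear automorphism of ℂ³. -/
open MvPolynomial

noncomputable section

/-- The ideal (x³y + y³ + z²) in ℂ[x,y,z]. -/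
def Ie7 : Ideal (MvPolynomial (Fin 3) ℂ) :=
  Ideal.span {(X 0 ^ 3 * X 1 + X 1 ^ 3 + X 2 ^ 2 : MvPolynomial (Fin 3) ℂ)}

/-- The coordinate ring A = ℂ[x,y,z]/(x³y + y³ + z²) of the Klein surface. -/
abbrev Ae7 : Type := MvPolynomial (Fin 3) ℂ ⧸ Ie7

section exponential

variable {R A K : Type*} [CommRing R] [CommRing A] [Algebra R A] [Field K]
  [Algebra R K]

/-- The exponential series `∑ ψ(Dⁿ a) tⁿ / n!` of a derivation `D`. -/
def Derivation.expSeries (D : Derivation R A A) (ψ : A →ₐ[R] K) (a : A) : PowerSeries K :=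
  PowerSeries.mk fun n => ψ (D^[n] a) / n.factorial

namespace Derivation

variable (D : Derivation R A A) (ψ : A →ₐ[R] K)

lemma coeff_expSeries (a : A) (n : ℕ) :
    PowerSeries.coeff n (D.expSeries ψ a) = ψ (D^[n] a) / n.factorial :=
  PowerSeries.coeff_mk _ _

lemma expSeries_add (a b : A) : D.expSeries ψ (a + b) = D.expSeries ψ a + D.expSeries ψ b := by
  ext n
  simp only [coeff_expSeries, map_add, iterate_map_add, add_div]

lemma expSeries_algebraMap (r : R) :
    D.expSeries ψ (algebraMap R A r) = algebraMap R (PowerSeries K) r := by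
  ext n
  rw [coeff_expSeries, PowerSeries.algebraMap_apply, PowerSeries.coeff_C]
  cases n with
  | zero => simp
  | succ n =>
    rw [Function.iterate_succ_apply, D.map_algebraMap, iterate_map_zero]
    simp

variable [CharZero K]

lemma derivative_expSeries (a : A) :
    PowerSeries.derivative K (D.expSeries ψ a) = D.expSeries ψ (D a) := by
  ext n
  rw [PowerSeries.coeff_derivative, coeff_expSeries, coeff_expSeries, Function.iterate_succ_apply,
    Nat.factorial_succ]
  have : (n.factorial : K) ≠ 0 := by exact_mod_cast n.factorial_ne_zero
  have : (n : K) + 1 ≠ 0 := by exact_mod_cast n.succ_ne_zero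
  push_cast
  field_simp

lemma expSeries_mul (a b : A) : D.expSeries ψ (a * b) = D.expSeries ψ a * D.expSeries ψ b := by
  suffices h : ∀ n a b, PowerSeries.coeff n (D.expSeries ψ (a * b))
      = PowerSeries.coeff n (D.expSeries ψ a * D.expSeries ψ b) from
    PowerSeries.ext fun n => h n a b
  intro n
  induction n with
  | zero =>
    intro a b
    simp [PowerSeries.coeff_mul, coeff_expSeries]
  | succ n ih =>
    intro a b
    have hn : (n : K) + 1 ≠ 0 := by exact_mod_cast n.succ_ne_zero
    refine mul_right_cancel₀ hn ?_
    rw [← PowerSeries.coeff_derivative, ← PowerSeries.coeff_derivative, derivative_expSeries,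
      Derivation.leibniz, Derivation.leibniz, derivative_expSeries, derivative_expSeries,
      expSeries_add]
    simp only [smul_eq_mul, map_add, ih]

/-- The exponential of a derivation, as a homomorphism to power series. -/
def expHom : A →ₐ[R] PowerSeries K where
  toFun := D.expSeries ψ
  map_one' := by simpa using D.expSeries_algebraMap ψ 1
  map_mul' := D.expSeries_mul ψ
  map_zero' := by simpa using D.expSeries_algebraMap ψ 0
  map_add' := D.expSeries_add ψ
  commutes' := D.expSeries_algebraMap ψ

lemma coeff_expHom (a : A) (n : ℕ) :
    PowerSeries.coeff n (D.expHom ψ a) = ψ (D^[n] a) / n.factorial :=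
  D.coeff_expSeries ψ a n

lemma expHom_of_eq_zero {a : A} (h : D a = 0) : D.expHom ψ a = PowerSeries.C (ψ a) := by
  ext n
  rw [coeff_expHom, PowerSeries.coeff_C]
  cases n with
  | zero => simp
  | succ n => rw [Function.iterate_succ_apply, h, iterate_map_zero]; simp

lemma exists_coe_eq_expHom {a : A} (h : ∃ n, D^[n] a = 0) :
    ∃ p : Polynomial K, (p : PowerSeries K) = D.expHom ψ a := by
  obtain ⟨n, hn⟩ := h
  refine ⟨PowerSeries.trunc n (D.expHom ψ a), ?_⟩
  ext k
  rw [Polynomial.coeff_coe, PowerSeries.coeff_trunc]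
  split_ifs with hk
  · rfl
  · obtain ⟨l, rfl⟩ := Nat.exists_eq_add_of_le' (not_lt.mp hk)
    rw [coeff_expHom, Function.iterate_add_apply, hn, iterate_map_zero]
    simp

lemma eq_zero_of_natDegree_eq_zero (hψ : Function.Injective ψ) {a : A} {p : Polynomial K}
    (hp : (p : PowerSeries K) = D.expHom ψ a) (h : p.natDegree = 0) : D a = 0 := by
  have := D.coeff_expHom ψ a 1
  rw [← hp, Polynomial.coeff_coe, Polynomial.coeff_eq_zero_of_natDegree_lt (by omega)] at this
  exact (map_eq_zero_iff ψ hψ).mp (by simpa using this.symm)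

end Derivation

end exponential

namespace Polynomial

variable {K : Type*} [Field K]

/-- A nonconstant polynomial curve does not lie on the cuspidal fibre `u a² + v b³ = w`, `w ≠ 0`. -/
lemma natDegree_eq_zero_of_sq_add_cube [CharZero K] {u v w : K} (hu : u ≠ 0) (hv : v ≠ 0)
    (hw : w ≠ 0) {a b : K[X]} (h : C u * a ^ 2 + C v * b ^ 3 = C w) :
    a.natDegree = 0 ∧ b.natDegree = 0 := by
  have hpow : ∀ {c : K[X]} {t : K} {n : ℕ}, n ≠ 0 → t ≠ 0 → C t * c ^ n = C w →
      c.natDegree = 0 := by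
    intro c t n hn ht hc
    have := congrArg natDegree hc
    rw [natDegree_C_mul ht, natDegree_pow, natDegree_C] at this
    exact (Nat.mul_eq_zero.mp this).resolve_left hn
  by_cases ha : a = 0
  · subst ha
    exact ⟨natDegree_zero, hpow (n := 3) (by norm_num) hv (by simpa using h)⟩
  by_cases hb : b = 0
  · subst hb
    exact ⟨hpow (n := 2) (by norm_num) hu (by simpa using h), natDegree_zero⟩
  have hcop : IsCoprime a b := by
    refine ⟨C w⁻¹ * C u * a, C w⁻¹ * C v * b ^ 2, ?_⟩
    have : C w⁻¹ * C w = (1 : K[X]) := by rw [← C_mul, inv_mul_cancel₀ hw, C_1]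
    linear_combination C w⁻¹ * h + this
  have := Polynomial.flt_catalan (p := 2) (q := 3) (r := 6) (by norm_num) (by norm_num)
    (by norm_num) (by norm_num) (by norm_num) (by norm_num) (by norm_num) ha hb
    (one_ne_zero (α := K[X])) hcop hu hv (neg_ne_zero.mpr hw)
    (by rw [h, C_neg]; ring)
  exact ⟨this.1, this.2.1⟩

lemma natDegree_eq_zero_of_mul {p q : K[X]} (h : (p * q).natDegree = 0) (h0 : p * q ≠ 0) :
    p.natDegree = 0 ∧ q.natDegree = 0 := by
  rw [natDegree_mul (left_ne_zero_of_mul h0) (right_ne_zero_of_mul h0)] at h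
  omega

/-- The elliptic curve `z² + y³ + c y = 0`, `c ≠ 0`, contains no nonconstant polynomial curve. -/
lemma natDegree_eq_zero_of_elliptic [IsAlgClosed K] [CharZero K] {c : K} (hc : c ≠ 0) {y z : K[X]}
    (h : C c * y + y ^ 3 + z ^ 2 = 0) : y.natDegree = 0 := by
  obtain ⟨i, hi⟩ := IsAlgClosed.exists_pow_nat_eq (-1 : K) (n := 2) (by norm_num)
  have hi' : (C i : K[X]) ^ 2 = -1 := by rw [← C_pow, hi]; simp
  have hcc : C c⁻¹ * C c = (1 : K[X]) := by rw [← C_mul, inv_mul_cancel₀ hc, C_1]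
  have hcop : IsCoprime (y ^ 2 + C c) y := by
    refine ⟨C c⁻¹, -C c⁻¹ * y, ?_⟩
    linear_combination hcc
  obtain ⟨d, e, hde⟩ := exists_associated_pow_of_mul_eq_pow' hcop (k := 2) (c := C i * z)
    (by linear_combination h - z ^ 2 * hi')
  obtain ⟨r, hr, hre⟩ := Polynomial.isUnit_iff.mp e.isUnit
  obtain ⟨s, hs⟩ := IsAlgClosed.exists_pow_nat_eq r (n := 2) (by norm_num)
  have hfac : (C s * d - y) * (C s * d + y) = C c := by
    have : (C s : K[X]) ^ 2 = C r := by rw [← C_pow, hs]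
    rw [← hre] at hde
    linear_combination hde + d ^ 2 * this
  have h0 : (C s * d - y) * (C s * d + y) ≠ 0 := by rw [hfac]; simpa using hc
  obtain ⟨h1, h2⟩ := natDegree_eq_zero_of_mul (by rw [hfac, natDegree_C]) h0
  have h2y : C (2 : K) * y = (C s * d + y) - (C s * d - y) := by
    rw [show (C (2 : K) : K[X]) = 2 from rfl]; ring
  have := natDegree_sub_le (C s * d + y) (C s * d - y)
  rw [← h2y, natDegree_C_mul two_ne_zero] at this
  omega

lemma aeval_isWeightedHomogeneous {F : Type*} [Field F] [Algebra ℂ F]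
    {P : MvPolynomial (Fin 2) ℂ} {n : ℕ} (hP : P.IsWeightedHomogeneous ![4, 6] n) (s a b : F) :
    MvPolynomial.aeval ![s ^ 4 * a, s ^ 6 * b] P = s ^ n * MvPolynomial.aeval ![a, b] P := by
  rw [MvPolynomial.aeval_def, MvPolynomial.aeval_def, MvPolynomial.eval₂_eq',
    MvPolynomial.eval₂_eq', Finset.mul_sum]
  refine Finset.sum_congr rfl fun d hd => ?_
  have hw : 4 * d 0 + 6 * d 1 = n := by
    rw [← hP (MvPolynomial.mem_support_iff.mp hd), Finsupp.weight_apply,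
      Finsupp.sum_fintype _ _ (by simp)]
    simp [mul_comm]
  simp only [Fin.prod_univ_two, Matrix.cons_val_zero, Matrix.cons_val_one, ← hw]
  ring

lemma eval_aeval_pair {F : Type*} [Field F] [Algebra ℂ F] (P : MvPolynomial (Fin 2) ℂ)
    (p q : F[X]) (t : F) : (MvPolynomial.aeval ![p, q] P).eval t
      = MvPolynomial.aeval ![p.eval t, q.eval t] P := by
  have := MvPolynomial.comp_aeval_apply (f := ![p, q]) ((Polynomial.aeval t).restrictScalars ℂ) P
  simp only [AlgHom.coe_restrictScalars', coe_aeval_eq_eval] at this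
  rw [this]
  congr 2
  ext j
  fin_cases j <;> rfl

/-- A quasi-homogeneous polynomial of positive degree in two variables has a nontrivial zero. -/
lemma exists_zero_of_isWeightedHomogeneous {P : MvPolynomial (Fin 2) ℂ} {n : ℕ} (hn : n ≠ 0)
    (hP : P.IsWeightedHomogeneous ![4, 6] n) :
    ∃ a b : ℂ, (a ≠ 0 ∨ b ≠ 0) ∧ MvPolynomial.aeval ![a, b] P = 0 := by
  by_contra! hne
  have heval := eval_aeval_pair P (F := ℂ)
  have hdeg : (MvPolynomial.aeval ![X, (1 : ℂ[X])] P).degree = 0 := by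
    by_contra hd
    obtain ⟨t, ht⟩ := IsAlgClosed.exists_root _ hd
    rw [IsRoot, heval] at ht
    exact hne _ _ (Or.inr (by simp)) ht
  have hconst := eq_C_of_degree_eq_zero hdeg
  set c := (MvPolynomial.aeval ![X, (1 : ℂ[X])] P).coeff 0
  have hc : ∀ t : ℂ, MvPolynomial.aeval ![t, 1] P = c := by
    intro t
    have := heval X 1 t
    rw [hconst] at this
    simpa using this.symm
  have hzero : MvPolynomial.aeval ![(1 : ℂ[X]), X ^ 6] P - C c * X ^ n = 0 := by
    refine eq_zero_of_infinite_isRoot _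
      ((Set.finite_singleton (0 : ℂ)).infinite_compl.mono ?_)
    intro s hs
    have hs : s ≠ 0 := hs
    have h1 := aeval_isWeightedHomogeneous hP s ((s ^ 4)⁻¹) 1
    rw [hc, mul_inv_cancel₀ (pow_ne_zero 4 hs), mul_one] at h1
    simp only [Set.mem_ofPred_eq, IsRoot, eval_sub, heval, eval_one, eval_pow, eval_X, eval_mul,
      eval_C, h1]
    ring
  have := congrArg (eval 0) hzero
  simp only [eval_sub, heval, eval_one, eval_pow, eval_X, eval_mul, eval_C, zero_pow hn,
    mul_zero, sub_zero, eval_zero] at this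
  exact hne _ _ (Or.inl one_ne_zero) this

/-- The points with `a³ y² = b² x³` lie on the orbit of `(a, b)` under `s ↦ (s⁴ a, s⁶ b)`. -/
lemma exists_orbit [IsAlgClosed K] {a b x y : K} (hab : a ≠ 0 ∨ b ≠ 0)
    (h : a ^ 3 * y ^ 2 = b ^ 2 * x ^ 3) : ∃ s : K, x = s ^ 4 * a ∧ y = s ^ 6 * b := by
  by_cases ha : a = 0
  · have hb : b ≠ 0 := hab.resolve_left (not_not.mpr ha)
    subst ha
    have hx : x = 0 := by simpa [hb] using h.symm
    obtain ⟨s, hs⟩ := IsAlgClosed.exists_pow_nat_eq (y / b) (n := 6) (by norm_num)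
    exact ⟨s, by simp [hx], by rw [hs]; field_simp⟩
  by_cases hb : b = 0
  · subst hb
    have hy : y = 0 := by simpa [ha] using h
    obtain ⟨s, hs⟩ := IsAlgClosed.exists_pow_nat_eq (x / a) (n := 4) (by norm_num)
    exact ⟨s, by rw [hs]; field_simp, by simp [hy]⟩
  by_cases hx : x = 0
  · subst hx
    have hy : y = 0 := by simpa [ha] using h
    exact ⟨0, by simp, by simp [hy]⟩
  obtain ⟨s, hs⟩ := IsAlgClosed.exists_pow_nat_eq ((y / b) / (x / a)) (n := 2) (by norm_num)
  refine ⟨s, ?_, ?_⟩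
  · rw [show s ^ 4 = (s ^ 2) ^ 2 by ring, hs]
    field_simp
    linear_combination -h
  · rw [show s ^ 6 = (s ^ 2) ^ 3 by ring, hs]
    field_simp
    linear_combination -y * h

/-- If a quasi-homogeneous polynomial of positive degree is constant along a polynomial curve in the
Klein surface and does not vanish there, then the curve is constant. -/
lemma natDegree_eq_zero_of_klein [IsAlgClosed K] [CharZero K] [Algebra ℂ K] {x y z : K[X]}
    (hf : x ^ 3 * y + y ^ 3 + z ^ 2 = 0) {P : MvPolynomial (Fin 2) ℂ} {n : ℕ} (hn : n ≠ 0)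
    (hP : P.IsWeightedHomogeneous ![4, 6] n) {c : K} (hc : c ≠ 0)
    (hPc : MvPolynomial.aeval ![x, y] P = C c) : x.natDegree = 0 ∧ y.natDegree = 0 := by
  obtain ⟨a, b, hab, hzero⟩ := exists_zero_of_isWeightedHomogeneous hn hP
  set a₁ := algebraMap ℂ K a
  set b₁ := algebraMap ℂ K b
  have hab' : a₁ ≠ 0 ∨ b₁ ≠ 0 := hab.imp (by simp [a₁]) (by simp [b₁])
  have hzero' : MvPolynomial.aeval ![a₁, b₁] P = 0 := by
    have := MvPolynomial.comp_aeval_apply (f := ![a, b]) (Algebra.ofId ℂ K) P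
    rw [hzero, map_zero] at this
    rw [this]
    congr 2
    ext j
    fin_cases j <;> rfl
  obtain ⟨w, hw, hN⟩ : ∃ w : K, w ≠ 0 ∧ C (a₁ ^ 3) * y ^ 2 + C (-b₁ ^ 2) * x ^ 3 = C w := by
    have hroot : ∀ t, (C (a₁ ^ 3) * y ^ 2 + C (-b₁ ^ 2) * x ^ 3).eval t ≠ 0 := by
      intro t ht
      simp only [eval_add, eval_mul, eval_C, eval_pow] at ht
      obtain ⟨s, hx, hy⟩ := exists_orbit hab' (x := x.eval t) (y := y.eval t)
        (by linear_combination ht)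
      have h1 := congrArg (eval t) hPc
      rw [eval_aeval_pair, hx, hy, aeval_isWeightedHomogeneous hP, hzero', mul_zero, eval_C] at h1
      exact hc h1.symm
    have hdeg : (C (a₁ ^ 3) * y ^ 2 + C (-b₁ ^ 2) * x ^ 3).degree = 0 := by
      by_contra hd
      obtain ⟨t, ht⟩ := IsAlgClosed.exists_root _ hd
      exact hroot t ht
    have hconst := eq_C_of_degree_eq_zero hdeg
    refine ⟨_, ?_, hconst⟩
    have := hroot 0
    rwa [hconst, eval_C] at this
  have hpow : ∀ {q : K[X]} {t : K} {m : ℕ}, m ≠ 0 → C t * q ^ m = C w →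
      ∃ r, r ≠ 0 ∧ q = C r := by
    intro q t m hm hq
    have h0 : C t * q ^ m ≠ 0 := by rw [hq]; simpa using hw
    have h1 := (natDegree_eq_zero_of_mul (by rw [hq, natDegree_C]) h0).2
    rw [natDegree_pow] at h1
    have h2 := eq_C_of_natDegree_eq_zero ((Nat.mul_eq_zero.mp h1).resolve_left hm)
    refine ⟨_, fun h3 => ?_, h2⟩
    rw [h3, C_0] at h2
    exact h0 (by rw [h2, zero_pow hm, mul_zero])
  by_cases ha : a₁ = 0
  · obtain ⟨r, hr, rfl⟩ := hpow (q := x) (t := -b₁ ^ 2) (m := 3) (by norm_num)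
      (by rw [← hN, ha]; simp)
    exact ⟨natDegree_C _, natDegree_eq_zero_of_elliptic (pow_ne_zero 3 hr) (z := z)
      (by rw [C_pow]; exact hf)⟩
  by_cases hb : b₁ = 0
  · obtain ⟨r, hr, rfl⟩ := hpow (q := y) (t := a₁ ^ 3) (m := 2) (by norm_num)
      (by rw [← hN, hb]; simp)
    refine ⟨(natDegree_eq_zero_of_sq_add_cube one_ne_zero hr (w := -r ^ 3)
      (by simpa using hr) (a := z) (b := x) ?_).2, natDegree_C _⟩
    rw [C_neg, C_pow, C_1]
    linear_combination hf
  · exact (natDegree_eq_zero_of_sq_add_cube (pow_ne_zero 3 ha)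
      (neg_ne_zero.mpr (pow_ne_zero 2 hb)) hw hN).symm

end Polynomial

namespace Ae7

/-- The class of the first variable. -/
def x : Ae7 := Ideal.Quotient.mk Ie7 (X 0)

/-- The class of the second variable. -/
def y : Ae7 := Ideal.Quotient.mk Ie7 (X 1)

/-- The class of the third variable. -/
def z : Ae7 := Ideal.Quotient.mk Ie7 (X 2)

lemma relation : x ^ 3 * y + y ^ 3 + z ^ 2 = 0 :=
  Ideal.Quotient.eq_zero_iff_mem.mpr (Ideal.mem_span_singleton_self _)

lemma smul_eq (c : ℂ) (a : Ae7) : c • a = algebraMap ℂ Ae7 c * a := Algebra.smul_def c a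

lemma derivation_smul (D : Derivation ℂ Ae7 Ae7) (c : ℂ) (a : Ae7) : D (c • a) = c • D a :=
  D.map_smul c a

lemma monomial_induction {p : Ae7 → Prop} (add : ∀ a b, p a → p b → p (a + b))
    (smul : ∀ (c : ℂ) a, p a → p (c • a)) (mon : ∀ i j k : ℕ, p (x ^ i * y ^ j * z ^ k))
    (a : Ae7) : p a := by
  obtain ⟨q, rfl⟩ := Ideal.Quotient.mk_surjective a
  induction q using MvPolynomial.induction_on' with
  | monomial d c =>
    have : Ideal.Quotient.mk Ie7 (monomial d c) = c • (x ^ d 0 * y ^ d 1 * z ^ d 2) := by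
      rw [monomial_eq, Finsupp.prod_fintype _ _ (by simp), Fin.prod_univ_three,
        ← MvPolynomial.smul_eq_C_mul]
      rfl
    rw [this]
    exact smul _ _ (mon _ _ _)
  | add q r hq hr => rw [map_add]; exact add _ _ hq hr

section lift

variable {B : Type*} [CommRing B] [Algebra ℂ B] (a b c : B) (h : a ^ 3 * b + b ^ 3 + c ^ 2 = 0)

/-- The universal property of the coordinate ring. -/
def lift : Ae7 →ₐ[ℂ] B :=
  Ideal.Quotient.liftₐ Ie7 (aeval ![a, b, c]) (by
    intro q hq
    obtain ⟨r, rfl⟩ := Ideal.mem_span_singleton'.mp hq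
    simp [h])

@[simp] lemma lift_x : lift a b c h x = a := by
  change aeval ![a, b, c] (X 0 : MvPolynomial (Fin 3) ℂ) = a
  simp

@[simp] lemma lift_y : lift a b c h y = b := by
  change aeval ![a, b, c] (X 1 : MvPolynomial (Fin 3) ℂ) = b
  simp

@[simp] lemma lift_z : lift a b c h z = c := by
  change aeval ![a, b, c] (X 2 : MvPolynomial (Fin 3) ℂ) = c
  simp

end lift

/-- The subring generated by `x` and `y`. -/
def ofXY : MvPolynomial (Fin 2) ℂ →ₐ[ℂ] Ae7 := aeval ![x, y]

@[simp] lemma ofXY_X_zero : ofXY (X 0) = x := by simp [ofXY]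

@[simp] lemma ofXY_X_one : ofXY (X 1) = y := by simp [ofXY]

/-- The element `-y(x³ + y²)`, whose square root is `z`. -/
def zSq : MvPolynomial (Fin 2) ℂ := -(X 0 ^ 3 * X 1 + X 1 ^ 3)

lemma ofXY_zSq : ofXY zSq = z ^ 2 := by
  simp only [zSq, map_neg, map_add, map_mul, map_pow, ofXY_X_zero, ofXY_X_one]
  linear_combination -relation

lemma monomial_even (i j k : ℕ) :
    x ^ i * y ^ j * z ^ (2 * k) = ofXY (X 0 ^ i * X 1 ^ j * zSq ^ k) := by
  simp [ofXY_zSq, pow_mul]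

lemma monomial_odd (i j k : ℕ) :
    x ^ i * y ^ j * z ^ (2 * k + 1) = z * ofXY (X 0 ^ i * X 1 ^ j * zSq ^ k) := by
  rw [← monomial_even]; ring

lemma exists_normal_form (a : Ae7) : ∃ p q, a = ofXY p + z * ofXY q := by
  induction a using monomial_induction with
  | add a b ha hb =>
    obtain ⟨p, q, rfl⟩ := ha
    obtain ⟨r, s, rfl⟩ := hb
    exact ⟨p + r, q + s, by simp only [map_add]; ring⟩
  | smul c a ha =>
    obtain ⟨p, q, rfl⟩ := ha
    exact ⟨c • p, c • q, by simp only [map_smul, smul_add, mul_smul_comm]⟩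
  | mon i j k =>
    obtain ⟨k, rfl | rfl⟩ := Nat.even_or_odd' k
    · exact ⟨X 0 ^ i * X 1 ^ j * zSq ^ k, 0, by rw [monomial_even, map_zero, mul_zero, add_zero]⟩
    · exact ⟨0, X 0 ^ i * X 1 ^ j * zSq ^ k, by rw [monomial_odd, map_zero, zero_add]⟩

/-- An algebraic closure of the function field of the plane. -/
abbrev Omega : Type := AlgebraicClosure (FractionRing (MvPolynomial (Fin 2) ℂ))

/-- The embedding of the polynomial ring of the plane. -/
def planeHom : MvPolynomial (Fin 2) ℂ →ₐ[ℂ] Omega :=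
  (IsScalarTower.toAlgHom ℂ (FractionRing (MvPolynomial (Fin 2) ℂ)) Omega).comp
    (IsScalarTower.toAlgHom ℂ (MvPolynomial (Fin 2) ℂ) (FractionRing (MvPolynomial (Fin 2) ℂ)))

lemma planeHom_injective : Function.Injective planeHom :=
  (algebraMap (FractionRing (MvPolynomial (Fin 2) ℂ)) Omega).injective.comp
    (IsFractionRing.injective (MvPolynomial (Fin 2) ℂ) (FractionRing (MvPolynomial (Fin 2) ℂ)))

lemma exists_sqrt_zSq : ∃ ζ : Omega, ζ ^ 2 = planeHom zSq :=
  IsAlgClosed.exists_pow_nat_eq _ (by norm_num)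

/-- An embedding of the coordinate ring in an algebraically closed field. -/
def toOmega : Ae7 →ₐ[ℂ] Omega :=
  lift (planeHom (X 0)) (planeHom (X 1)) exists_sqrt_zSq.choose (by
    rw [exists_sqrt_zSq.choose_spec, zSq]
    simp only [map_neg, map_add, map_mul, map_pow]
    ring)

lemma toOmega_ofXY (p : MvPolynomial (Fin 2) ℂ) : toOmega (ofXY p) = planeHom p := by
  have : toOmega.comp ofXY = planeHom := by
    ext i
    fin_cases i <;> simp [toOmega]
  exact DFunLike.congr_fun this p

lemma degreeOf_zSq : degreeOf 0 zSq = 3 := by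
  have hX : finSuccEquiv ℂ 1 (X 1) = Polynomial.C (X 0) := finSuccEquiv_X_succ (j := 0)
  rw [← natDegree_finSuccEquiv, zSq, map_neg, map_add, map_mul, map_pow, map_pow,
    finSuccEquiv_X_zero, hX, Polynomial.natDegree_neg]
  compute_degree!

lemma zSq_ne_zero : zSq ≠ 0 := fun h => by simpa [h] using degreeOf_zSq

lemma eq_zero_of_toOmega {p q : MvPolynomial (Fin 2) ℂ} (h : toOmega (ofXY p + z * ofXY q) = 0) :
    p = 0 ∧ q = 0 := by
  have hz : toOmega z ^ 2 = planeHom zSq := by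
    rw [← map_pow, ← ofXY_zSq, toOmega_ofXY]
  rw [map_add, map_mul, toOmega_ofXY, toOmega_ofXY] at h
  have hsq : p ^ 2 = zSq * q ^ 2 := by
    apply planeHom_injective
    simp only [map_pow, map_mul, ← hz]
    linear_combination (planeHom p - toOmega z * planeHom q) * h
  have hq : q = 0 := by
    by_contra hq
    have hp : p ≠ 0 := by
      rintro rfl
      exact mul_ne_zero zSq_ne_zero (pow_ne_zero 2 hq) (by rw [← hsq]; ring)
    have := congrArg (degreeOf 0) hsq
    rw [degreeOf_mul_eq zSq_ne_zero (pow_ne_zero 2 hq), degreeOf_pow_eq _ _ _ hp,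
      degreeOf_pow_eq _ _ _ hq, degreeOf_zSq] at this
    omega
  subst hq
  exact ⟨by simpa using hsq, rfl⟩

lemma toOmega_injective : Function.Injective toOmega := by
  rw [injective_iff_map_eq_zero]
  intro a ha
  obtain ⟨p, q, rfl⟩ := exists_normal_form a
  obtain ⟨rfl, rfl⟩ := eq_zero_of_toOmega ha
  simp

instance : IsDomain Ae7 := toOmega_injective.isDomain toOmega

instance : CharZero Ae7 := charZero_of_injective_algebraMap (algebraMap ℂ Ae7).injective

lemma ofXY_add_z_mul_ofXY_eq_zero {p q : MvPolynomial (Fin 2) ℂ} (h : ofXY p + z * ofXY q = 0) :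
    p = 0 ∧ q = 0 :=
  eq_zero_of_toOmega (by rw [h, map_zero])

lemma ofXY_injective : Function.Injective ofXY := by
  rw [injective_iff_map_eq_zero]
  intro p hp
  exact (ofXY_add_z_mul_ofXY_eq_zero (q := 0) (by simpa using hp)).1

lemma x_ne_zero : x ≠ 0 := by
  rw [← ofXY_X_zero]
  exact (map_ne_zero_iff _ ofXY_injective).mpr (X_ne_zero _)

lemma y_ne_zero : y ≠ 0 := by
  rw [← ofXY_X_one]
  exact (map_ne_zero_iff _ ofXY_injective).mpr (X_ne_zero _)

lemma z_ne_zero : z ≠ 0 := by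
  intro h
  have := ofXY_zSq
  rw [h, zero_pow two_ne_zero] at this
  exact zSq_ne_zero (ofXY_injective (by rw [this, map_zero]))

/-- The coaction of the multiplicative group defining the grading with weights `4, 6, 9`. -/
def coaction : Ae7 →ₐ[ℂ] Polynomial Ae7 :=
  lift (Polynomial.monomial 4 x) (Polynomial.monomial 6 y) (Polynomial.monomial 9 z) (by
    simp only [Polynomial.monomial_pow, Polynomial.monomial_mul_monomial]
    norm_num
    rw [← map_add, ← map_add, relation, map_zero])

/-- The projection to the homogeneous component of degree `n`. -/
def component (n : ℕ) : Ae7 →ₗ[ℂ] Ae7 :=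
  (Polynomial.lcoeff Ae7 n).restrictScalars ℂ ∘ₗ coaction.toLinearMap

lemma component_apply (n : ℕ) (a : Ae7) : component n a = (coaction a).coeff n := rfl

/-- The homogeneous elements of degree `n`. -/
def homogeneous (n : ℕ) : Submodule ℂ Ae7 where
  carrier := {a | coaction a = Polynomial.monomial n a}
  add_mem' := by
    intro a b ha hb
    rw [Set.mem_ofPred_eq] at *
    rw [map_add, ha, hb, map_add]
  zero_mem' := by simp
  smul_mem' := by
    intro c a ha
    rw [Set.mem_ofPred_eq] at *
    rw [map_smul, ha, Polynomial.smul_monomial]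

lemma mem_homogeneous {n : ℕ} {a : Ae7} :
    a ∈ homogeneous n ↔ coaction a = Polynomial.monomial n a := Iff.rfl

lemma x_mem : x ∈ homogeneous 4 := lift_x _ _ _ _

lemma y_mem : y ∈ homogeneous 6 := lift_y _ _ _ _

lemma z_mem : z ∈ homogeneous 9 := lift_z _ _ _ _

lemma one_mem : (1 : Ae7) ∈ homogeneous 0 := by
  rw [mem_homogeneous, map_one]; rfl

lemma mul_mem {n m : ℕ} {a b : Ae7} (ha : a ∈ homogeneous n) (hb : b ∈ homogeneous m) :
    a * b ∈ homogeneous (n + m) := by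
  rw [mem_homogeneous] at *
  rw [map_mul, ha, hb, Polynomial.monomial_mul_monomial]

lemma monomial_mem (i j k : ℕ) : x ^ i * y ^ j * z ^ k ∈ homogeneous (4 * i + 6 * j + 9 * k) := by
  have hx := mem_homogeneous.mp x_mem
  have hy := mem_homogeneous.mp y_mem
  have hz := mem_homogeneous.mp z_mem
  rw [mem_homogeneous]
  simp only [map_mul, map_pow, hx, hy, hz, Polynomial.monomial_pow,
    Polynomial.monomial_mul_monomial]

lemma component_of_mem {n : ℕ} {a : Ae7} (ha : a ∈ homogeneous n) (m : ℕ) :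
    component m a = if n = m then a else 0 := by
  rw [component_apply, mem_homogeneous.mp ha, Polynomial.coeff_monomial]

lemma component_self {n : ℕ} {a : Ae7} (ha : a ∈ homogeneous n) : component n a = a := by
  simp [component_of_mem ha]

lemma component_mem_of_monomial {n : ℕ} {S : Submodule ℂ Ae7}
    (h : ∀ i j k, 4 * i + 6 * j + 9 * k = n → x ^ i * y ^ j * z ^ k ∈ S) (a : Ae7) :
    component n a ∈ S := by
  induction a using monomial_induction with
  | add a b ha hb => rw [map_add]; exact S.add_mem ha hb
  | smul c a ha => rw [map_smul]; exact S.smul_mem c ha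
  | mon i j k =>
    rw [component_of_mem (monomial_mem i j k)]
    split_ifs with hn
    · exact h i j k hn
    · exact S.zero_mem

lemma component_mem (n : ℕ) (a : Ae7) : component n a ∈ homogeneous n :=
  component_mem_of_monomial (by rintro i j k rfl; exact monomial_mem i j k) a

lemma eval_coaction (a : Ae7) : (coaction a).eval 1 = a := by
  induction a using monomial_induction with
  | add a b ha hb => rw [map_add, Polynomial.eval_add, ha, hb]
  | smul c a ha => rw [map_smul, Polynomial.eval_smul, ha]
  | mon i j k => rw [mem_homogeneous.mp (monomial_mem i j k), Polynomial.eval_monomial]; simp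

/-- The elements of degree at most `n`. -/
def filtration (n : ℕ) : Submodule ℂ Ae7 where
  carrier := {a | ∀ k, n < k → component k a = 0}
  add_mem' := by
    intro a b ha hb k hk
    rw [map_add, ha k hk, hb k hk, add_zero]
  zero_mem' := by intro k _; rw [map_zero]
  smul_mem' := by
    intro c a ha k hk
    rw [map_smul, ha k hk, smul_zero]

lemma exists_mem_filtration (a : Ae7) : ∃ n, a ∈ filtration n :=
  ⟨(coaction a).natDegree, fun _ hk => Polynomial.coeff_eq_zero_of_natDegree_lt hk⟩

lemma filtration_mono {n m : ℕ} (h : n ≤ m) : filtration n ≤ filtration m :=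
  fun _ ha k hk => ha k (lt_of_le_of_lt h hk)

lemma homogeneous_le_filtration (n : ℕ) : homogeneous n ≤ filtration n :=
  fun _ ha k hk => by rw [component_of_mem ha, if_neg hk.ne]

lemma eq_sum_component {n : ℕ} {a : Ae7} (ha : a ∈ filtration n) :
    a = ∑ i ∈ Finset.range (n + 1), component i a := by
  have hdeg : (coaction a).natDegree < n + 1 :=
    Nat.lt_succ_of_le (Polynomial.natDegree_le_iff_coeff_eq_zero.mpr ha)
  conv_lhs => rw [← eval_coaction a, Polynomial.eval_eq_sum_range' hdeg]
  simp [component_apply]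

lemma component_mul {n : ℕ} {a : Ae7} (ha : a ∈ homogeneous n) (b : Ae7) (m : ℕ) :
    component (n + m) (a * b) = a * component m b := by
  rw [component_apply, component_apply, map_mul, mem_homogeneous.mp ha,
    ← Polynomial.C_mul_X_pow_eq_monomial, mul_assoc, Polynomial.coeff_C_mul, add_comm n m,
    Polynomial.coeff_X_pow_mul]

lemma mul_mem_filtration {n m : ℕ} {a b : Ae7} (ha : a ∈ homogeneous n) (hb : b ∈ filtration m) :
    a * b ∈ filtration (n + m) := by
  intro k hk
  obtain ⟨l, rfl⟩ := Nat.exists_eq_add_of_le (show n ≤ k by omega)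
  rw [component_mul ha, hb l (by omega), mul_zero]

lemma component_even {n : ℕ} (hn : Even n) (a : Ae7) :
    ∃ P : MvPolynomial (Fin 2) ℂ, P.IsWeightedHomogeneous ![4, 6] n ∧ component n a = ofXY P := by
  have hz : zSq.IsWeightedHomogeneous ![4, 6] 18 := by
    refine (((isWeightedHomogeneous_X ℂ ![4, 6] 0).pow 3).mul
      (isWeightedHomogeneous_X ℂ ![4, 6] 1)).add ?_ |>.neg
    exact (isWeightedHomogeneous_X ℂ ![4, 6] 1).pow 3
  have := component_mem_of_monomial
    (S := (weightedHomogeneousSubmodule ℂ ![4, 6] n).map ofXY.toLinearMap) (n := n) ?_ a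
  · obtain ⟨P, hP, h⟩ := this
    exact ⟨P, hP, h.symm⟩
  · rintro i j k rfl
    obtain ⟨k, rfl | rfl⟩ := Nat.even_or_odd' k
    · refine ⟨X 0 ^ i * X 1 ^ j * zSq ^ k, ?_, (monomial_even i j k).symm⟩
      have := ((((isWeightedHomogeneous_X ℂ ![4, 6] 0).pow i).mul
        ((isWeightedHomogeneous_X ℂ ![4, 6] 1).pow j)).mul (hz.pow k))
      change IsWeightedHomogeneous ![4, 6] _ _
      convert this using 1
      simp only [Matrix.cons_val_zero, Matrix.cons_val_one, smul_eq_mul]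
      ring
    · exfalso
      obtain ⟨l, hl⟩ := hn
      omega

lemma component_odd {n : ℕ} (hn : Odd n) (a : Ae7) :
    ∃ P : MvPolynomial (Fin 2) ℂ, component n a = z * ofXY P := by
  have := component_mem_of_monomial
    (S := LinearMap.range (LinearMap.mulLeft ℂ z ∘ₗ ofXY.toLinearMap)) (n := n) ?_ a
  · obtain ⟨P, h⟩ := this
    exact ⟨P, h.symm⟩
  · rintro i j k rfl
    obtain ⟨k, rfl | rfl⟩ := Nat.even_or_odd' k
    · exfalso
      obtain ⟨l, hl⟩ := hn
      omega
    · exact ⟨X 0 ^ i * X 1 ^ j * zSq ^ k, (monomial_odd i j k).symm⟩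

lemma derivation_eq_zero {D : Derivation ℂ Ae7 Ae7} (hx : D x = 0) (hy : D y = 0) : D z = 0 := by
  have h := congrArg D relation
  simp only [map_add, Derivation.leibniz, Derivation.leibniz_pow, hx, hy, map_zero, smul_zero,
    add_zero, zero_add] at h
  simpa [z_ne_zero] using h

/-- The Klein surface is rigid: a locally nilpotent derivation which is homogeneous of
nonnegative degree vanishes. -/
lemma rigid {D : Derivation ℂ Ae7 Ae7} {d : ℕ}
    (hD : ∀ n, ∀ a ∈ homogeneous n, D a ∈ homogeneous (n + d))
    (hnil : ∀ n, ∀ a ∈ homogeneous n, ∃ k, D^[k] a = 0) : D x = 0 ∧ D y = 0 ∧ D z = 0 := by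
  obtain ⟨px, hpx⟩ := D.exists_coe_eq_expHom toOmega (hnil _ _ x_mem)
  obtain ⟨py, hpy⟩ := D.exists_coe_eq_expHom toOmega (hnil _ _ y_mem)
  obtain ⟨pz, hpz⟩ := D.exists_coe_eq_expHom toOmega (hnil _ _ z_mem)
  have hcoe := Polynomial.coe_injective Omega
  have hrel : px ^ 3 * py + py ^ 3 + pz ^ 2 = 0 := by
    apply hcoe
    rw [Polynomial.coe_add, Polynomial.coe_add, Polynomial.coe_mul, Polynomial.coe_pow,
      Polynomial.coe_pow, Polynomial.coe_pow, hpx, hpy, hpz, Polynomial.coe_zero,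
      ← map_zero (D.expHom toOmega), ← relation]
    simp only [map_add, map_mul, map_pow]
  suffices h : px.natDegree = 0 ∧ py.natDegree = 0 by
    have h1 := D.eq_zero_of_natDegree_eq_zero toOmega toOmega_injective hpx h.1
    have h2 := D.eq_zero_of_natDegree_eq_zero toOmega toOmega_injective hpy h.2
    exact ⟨h1, h2, derivation_eq_zero h1 h2⟩
  have hofXY : ∀ P, D.expHom toOmega (ofXY P)
      = ((aeval ![px, py] P : Polynomial Omega) : PowerSeries Omega) := by
    intro P
    have : (D.expHom toOmega).comp ofXY
        = ((Polynomial.coeToPowerSeries.algHom Omega).restrictScalars ℂ).comp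
          (aeval ![px, py]) := by
      ext i : 1
      fin_cases i <;> simp [hpx, hpy]
    simpa using DFunLike.congr_fun this P
  obtain ⟨n, h, hn, hh, hh0, hDh⟩ : ∃ (n : ℕ) (h : Ae7), n ≠ 0 ∧ h ∈ homogeneous n ∧ h ≠ 0 ∧
      D h = 0 := by
    classical
    have hex := hnil _ _ x_mem
    have hpos : Nat.find hex ≠ 0 := fun h0 => x_ne_zero (by simpa [h0] using Nat.find_spec hex)
    obtain ⟨k, hk⟩ := Nat.exists_eq_succ_of_ne_zero hpos
    have hmem : ∀ k, D^[k] x ∈ homogeneous (4 + k * d) := by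
      intro k
      induction k with
      | zero => simpa using x_mem
      | succ k ih =>
        rw [Function.iterate_succ_apply', Nat.succ_mul, ← add_assoc]
        exact hD _ _ ih
    refine ⟨_, _, by omega, hmem k, Nat.find_min hex (m := k) (by omega), ?_⟩
    have := Nat.find_spec hex
    rwa [hk, Function.iterate_succ_apply'] at this
  have hc : toOmega h ≠ 0 := (map_ne_zero_iff _ toOmega_injective).mpr hh0
  have hconst := D.expHom_of_eq_zero toOmega hDh
  obtain hev | hodd := Nat.even_or_odd n
  · obtain ⟨P, hP, hPh⟩ := component_even hev h
    rw [component_self hh] at hPh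
    refine Polynomial.natDegree_eq_zero_of_klein hrel hn hP hc (hcoe ?_)
    rw [← hofXY, ← hPh, hconst, Polynomial.coe_C]
  · obtain ⟨P, hPh⟩ := component_odd hodd h
    rw [component_self hh] at hPh
    have hprod : pz * aeval ![px, py] P = Polynomial.C (toOmega h) := by
      apply hcoe
      rw [Polynomial.coe_mul, ← hofXY, hpz, ← map_mul, ← hPh, hconst, Polynomial.coe_C]
    have hne : pz * aeval ![px, py] P ≠ 0 := by rw [hprod]; simpa using hc
    have hz := (Polynomial.natDegree_eq_zero_of_mul
      (by rw [hprod, Polynomial.natDegree_C]) hne).1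
    have hz0 : pz ≠ 0 := left_ne_zero_of_mul hne
    have hy : py * (px ^ 3 + py ^ 2) = -pz ^ 2 := by linear_combination hrel
    have hy0 : py * (px ^ 3 + py ^ 2) ≠ 0 := by rw [hy]; simpa using hz0
    obtain ⟨h1, h2⟩ := Polynomial.natDegree_eq_zero_of_mul
      (by rw [hy, Polynomial.natDegree_neg, Polynomial.natDegree_pow, hz, mul_zero]) hy0
    refine ⟨?_, h1⟩
    have h3 := Polynomial.natDegree_sub_le (px ^ 3 + py ^ 2) (py ^ 2)
    rw [add_sub_cancel_right, Polynomial.natDegree_pow, Polynomial.natDegree_pow, h1, h2] at h3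
    simpa using h3

/-- The component of degree `d` of a derivation. -/
def derivationComponent (D : Derivation ℂ Ae7 Ae7) (d : ℕ) : Ae7 →ₗ[ℂ] Ae7 :=
  Polynomial.lsum (fun n => component (n + d) ∘ₗ (D : Ae7 →ₗ[ℂ] Ae7)) ∘ₗ coaction.toLinearMap

section derivation

variable {D : Derivation ℂ Ae7 Ae7} {d : ℕ}

lemma derivationComponent_of_mem {n : ℕ} {a : Ae7} (ha : a ∈ homogeneous n) :
    derivationComponent D d a = component (n + d) (D a) := by
  rw [derivationComponent, LinearMap.comp_apply, AlgHom.toLinearMap_apply, mem_homogeneous.mp ha,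
    Polynomial.lsum_apply, Polynomial.sum_monomial_index _ _ (by simp)]
  rfl

lemma derivationComponent_mem {n : ℕ} {a : Ae7} (ha : a ∈ homogeneous n) :
    derivationComponent D d a ∈ homogeneous (n + d) := by
  rw [derivationComponent_of_mem ha]
  exact component_mem _ _

lemma derivationComponent_mul (a b : Ae7) : derivationComponent D d (a * b)
    = a • derivationComponent D d b + b • derivationComponent D d a := by
  simp only [smul_eq_mul]
  induction a using monomial_induction with
  | add a a' ha ha' => simp only [add_mul, map_add, ha, ha']; ring
  | smul c a ha => simp only [smul_mul_assoc, map_smul, ha, mul_smul_comm, smul_add]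
  | mon i j k =>
    induction b using monomial_induction with
    | add b b' hb hb' => simp only [mul_add, map_add, hb, hb']; ring
    | smul c b hb => simp only [mul_smul_comm, map_smul, hb, smul_mul_assoc, smul_add]
    | mon i' j' k' =>
      have ha := monomial_mem i j k
      have hb := monomial_mem i' j' k'
      rw [derivationComponent_of_mem ha, derivationComponent_of_mem hb,
        derivationComponent_of_mem (mul_mem ha hb), Derivation.leibniz, map_add, smul_eq_mul,
        smul_eq_mul, ← component_mul ha, ← component_mul hb, add_assoc,
        add_left_comm (4 * i' + 6 * j' + 9 * k')]

/-- The component of degree `d` of a derivation, as a derivation. -/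
def homogeneousPart (D : Derivation ℂ Ae7 Ae7) (d : ℕ) : Derivation ℂ Ae7 Ae7 :=
  Derivation.mk' (derivationComponent D d) derivationComponent_mul

lemma homogeneousPart_apply (a : Ae7) : homogeneousPart D d a = derivationComponent D d a := rfl

lemma derivation_mem_filtration_of_homogeneous (hx : D x ∈ filtration (4 + d))
    (hy : D y ∈ filtration (6 + d)) (hz : D z ∈ filtration (9 + d))
    {n : ℕ} {a : Ae7} (ha : a ∈ homogeneous n) :
    D a ∈ filtration (n + d) := by
  have hmul : ∀ {m l : ℕ} {a b : Ae7}, (a ∈ homogeneous m ∧ D a ∈ filtration (m + d)) →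
      (b ∈ homogeneous l ∧ D b ∈ filtration (l + d)) →
      (a * b ∈ homogeneous (m + l) ∧ D (a * b) ∈ filtration (m + l + d)) := by
    rintro m l a b ⟨ha, ha'⟩ ⟨hb, hb'⟩
    refine ⟨mul_mem ha hb, ?_⟩
    rw [Derivation.leibniz]
    refine Submodule.add_mem _ ?_ ?_
    · rw [add_assoc]; exact mul_mem_filtration ha hb'
    · rw [add_comm m, add_assoc]; exact mul_mem_filtration hb ha'
  have hpow : ∀ {m : ℕ} {a : Ae7}, (a ∈ homogeneous m ∧ D a ∈ filtration (m + d)) →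
      ∀ k, (a ^ k ∈ homogeneous (m * k) ∧ D (a ^ k) ∈ filtration (m * k + d)) := by
    intro m a ha k
    induction k with
    | zero => simpa using one_mem
    | succ k ih => rw [pow_succ, Nat.mul_succ]; exact hmul ih ha
  rw [← component_self ha]
  refine component_mem_of_monomial (S := (filtration (n + d)).comap (D : Ae7 →ₗ[ℂ] Ae7)) ?_ a
  rintro i j k rfl
  exact (hmul (hmul (hpow ⟨x_mem, hx⟩ i) (hpow ⟨y_mem, hy⟩ j)) (hpow ⟨z_mem, hz⟩ k)).2

lemma derivation_mem_filtration (hx : D x ∈ filtration (4 + d))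
    (hy : D y ∈ filtration (6 + d)) (hz : D z ∈ filtration (9 + d))
    {n : ℕ} {a : Ae7} (ha : a ∈ filtration n) :
    D a ∈ filtration (n + d) ∧
      component (n + d) (D a) = homogeneousPart D d (component n a) := by
  have hle : ∀ i, D (component i a) ∈ filtration (i + d) := fun i =>
    derivation_mem_filtration_of_homogeneous hx hy hz (component_mem i a)
  have hsum : D a = ∑ i ∈ Finset.range (n + 1), D (component i a) := by
    conv_lhs => rw [eq_sum_component ha]
    rw [map_sum]
  refine ⟨?_, ?_⟩
  · rw [hsum]
    refine Submodule.sum_mem _ fun i hi => filtration_mono ?_ (hle i)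
    have := Finset.mem_range.mp hi
    omega
  · rw [hsum, map_sum, Finset.sum_range_succ, Finset.sum_eq_zero, zero_add,
      homogeneousPart_apply, derivationComponent_of_mem (component_mem n a)]
    intro i hi
    have := Finset.mem_range.mp hi
    exact hle i _ (by omega)

lemma homogeneousPart_iterate (hx : D x ∈ filtration (4 + d))
    (hy : D y ∈ filtration (6 + d)) (hz : D z ∈ filtration (9 + d))
    {n : ℕ} {a : Ae7} (ha : a ∈ homogeneous n) (k : ℕ) :
    D^[k] a ∈ filtration (n + k * d) ∧
      component (n + k * d) (D^[k] a) = (homogeneousPart D d)^[k] a := by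
  induction k with
  | zero => simpa using ⟨homogeneous_le_filtration n ha, component_self ha⟩
  | succ k ih =>
    have := derivation_mem_filtration hx hy hz ih.1
    rwa [ih.2, ← Function.iterate_succ_apply' D, ← Function.iterate_succ_apply'
      (homogeneousPart D d), show n + k * d + d = n + (k + 1) * d by ring] at this

end derivation

/-- A locally finite derivation of the Klein surface does not raise degrees. -/
lemma mem_filtration_of_locally_finite {D : Derivation ℂ Ae7 Ae7}
    (hD : ∀ a, ∃ N, ∀ k, D^[k] a ∈ filtration N) :
    D x ∈ filtration 4 ∧ D y ∈ filtration 6 ∧ D z ∈ filtration 9 := by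
  classical
  have hex : ∃ d, D x ∈ filtration (4 + d) ∧ D y ∈ filtration (6 + d) ∧
      D z ∈ filtration (9 + d) := by
    obtain ⟨l, hl⟩ := exists_mem_filtration (D x)
    obtain ⟨m, hm⟩ := exists_mem_filtration (D y)
    obtain ⟨n, hn⟩ := exists_mem_filtration (D z)
    exact ⟨l + m + n, filtration_mono (by omega) hl, filtration_mono (by omega) hm,
      filtration_mono (by omega) hn⟩
  obtain ⟨hx, hy, hz⟩ := Nat.find_spec hex
  obtain h0 | ⟨d, hd⟩ : Nat.find hex = 0 ∨ ∃ d, Nat.find hex = d + 1 := by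
    cases Nat.find hex <;> simp
  · simpa [h0] using Nat.find_spec hex
  exfalso
  rw [hd] at hx hy hz
  obtain ⟨h1, h2, h3⟩ := rigid (D := homogeneousPart D (d + 1)) (d := d + 1)
    (fun n a ha => derivationComponent_mem ha) (by
      intro n a ha
      obtain ⟨N, hN⟩ := hD a
      refine ⟨N + 1, ?_⟩
      rw [← (homogeneousPart_iterate hx hy hz ha (N + 1)).2]
      exact hN (N + 1) _ (by nlinarith))
  have hlower : ∀ {n : ℕ} {a : Ae7}, a ∈ homogeneous n → D a ∈ filtration (n + (d + 1)) →
      homogeneousPart D (d + 1) a = 0 → D a ∈ filtration (n + d) := by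
    intro n a ha hDa h k hk
    obtain rfl | hk' := eq_or_ne k (n + (d + 1))
    · rwa [homogeneousPart_apply, derivationComponent_of_mem ha] at h
    · exact hDa k (by omega)
  exact Nat.find_min hex (m := d) (by omega)
    ⟨hlower x_mem hx h1, hlower y_mem hy h2, hlower z_mem hz h3⟩

lemma component_eq_smul {n : ℕ} {b : Ae7}
    (h : ∀ i j k, 4 * i + 6 * j + 9 * k = n → x ^ i * y ^ j * z ^ k = b) (a : Ae7) :
    ∃ c : ℂ, component n a = c • b := by
  have := component_mem_of_monomial (S := Submodule.span ℂ {b}) (n := n)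
    (fun i j k hn => by rw [h i j k hn]; exact Submodule.mem_span_singleton_self b) a
  obtain ⟨c, hc⟩ := Submodule.mem_span_singleton.mp this
  exact ⟨c, hc.symm⟩

lemma component_zero (a : Ae7) : ∃ c : ℂ, component 0 a = c • 1 :=
  component_eq_smul (fun i j k h => by
    obtain ⟨rfl, rfl, rfl⟩ : i = 0 ∧ j = 0 ∧ k = 0 := by omega
    simp) a

lemma component_four (a : Ae7) : ∃ c : ℂ, component 4 a = c • x :=
  component_eq_smul (fun i j k h => by
    obtain ⟨rfl, rfl, rfl⟩ : i = 1 ∧ j = 0 ∧ k = 0 := by omega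
    simp) a

lemma component_six (a : Ae7) : ∃ c : ℂ, component 6 a = c • y :=
  component_eq_smul (fun i j k h => by
    obtain ⟨rfl, rfl, rfl⟩ : i = 0 ∧ j = 1 ∧ k = 0 := by omega
    simp) a

lemma component_nine (a : Ae7) : ∃ c : ℂ, component 9 a = c • z :=
  component_eq_smul (fun i j k h => by
    obtain ⟨rfl, rfl, rfl⟩ : i = 0 ∧ j = 0 ∧ k = 1 := by omega
    simp) a

lemma component_eq_zero {n : ℕ} (h : ∀ i j k, 4 * i + 6 * j + 9 * k ≠ n) (a : Ae7) :
    component n a = 0 := by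
  simpa using component_mem_of_monomial (S := ⊥) (n := n)
    (fun i j k hn => absurd hn (h i j k)) a

lemma ofXY_C (c : ℂ) : ofXY (C c) = algebraMap ℂ Ae7 c := ofXY.commutes c

lemma exists_of_mem_filtration_four {a : Ae7} (ha : a ∈ filtration 4) :
    ∃ c₀ c₁ : ℂ, a = ofXY (C c₀ + C c₁ * X 0) := by
  obtain ⟨c₀, h₀⟩ := component_zero a
  obtain ⟨c₁, h₁⟩ := component_four a
  refine ⟨c₀, c₁, ?_⟩
  rw [eq_sum_component ha]
  simp only [Finset.sum_range_succ, Finset.sum_range_zero, h₀, h₁,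
    component_eq_zero (n := 1) (by omega), component_eq_zero (n := 2) (by omega),
    component_eq_zero (n := 3) (by omega), map_add, map_mul, ofXY_C, ofXY_X_zero,
    smul_eq]
  ring

lemma exists_of_mem_filtration_six {a : Ae7} (ha : a ∈ filtration 6) :
    ∃ c₀ c₁ c₂ : ℂ, a = ofXY (C c₀ + C c₁ * X 0 + C c₂ * X 1) := by
  obtain ⟨c₀, h₀⟩ := component_zero a
  obtain ⟨c₁, h₁⟩ := component_four a
  obtain ⟨c₂, h₂⟩ := component_six a
  refine ⟨c₀, c₁, c₂, ?_⟩
  rw [eq_sum_component ha]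
  simp only [Finset.sum_range_succ, Finset.sum_range_zero, h₀, h₁, h₂,
    component_eq_zero (n := 1) (by omega), component_eq_zero (n := 2) (by omega),
    component_eq_zero (n := 3) (by omega), component_eq_zero (n := 5) (by omega), map_add, map_mul,
    ofXY_C, ofXY_X_zero, ofXY_X_one, smul_eq]
  ring

lemma exists_of_mem_filtration_nine {a : Ae7} (ha : a ∈ filtration 9) :
    ∃ (q : MvPolynomial (Fin 2) ℂ) (c : ℂ), a = ofXY q + z * ofXY (C c) := by
  have heven : ∀ n, Even n → ∃ P, component n a = ofXY P := fun n hn =>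
    (component_even hn a).imp fun _ h => h.2
  obtain ⟨p₀, h₀⟩ := heven 0 (by decide)
  obtain ⟨p₄, h₄⟩ := heven 4 (by decide)
  obtain ⟨p₆, h₆⟩ := heven 6 (by decide)
  obtain ⟨p₈, h₈⟩ := heven 8 (by decide)
  obtain ⟨c, h₉⟩ := component_nine a
  refine ⟨p₀ + p₄ + p₆ + p₈, c, ?_⟩
  rw [eq_sum_component ha]
  simp only [Finset.sum_range_succ, Finset.sum_range_zero, h₀, h₄, h₆, h₈, h₉,
    component_eq_zero (n := 1) (by omega), component_eq_zero (n := 2) (by omega),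
    component_eq_zero (n := 3) (by omega), component_eq_zero (n := 5) (by omega),
    component_eq_zero (n := 7) (by omega), map_add, ofXY_C, smul_eq]
  ring

/-- A derivation which does not raise degrees is a multiple of the Euler derivation. -/
lemma diagonal_of_mem_filtration {D : Derivation ℂ Ae7 Ae7} (hx : D x ∈ filtration 4)
    (hy : D y ∈ filtration 6) (hz : D z ∈ filtration 9) :
    ∃ μ : ℂ, D x = (4 * μ) • x ∧ D y = (6 * μ) • y ∧ D z = (9 * μ) • z := by
  obtain ⟨a₀, a, ha⟩ := exists_of_mem_filtration_four hx
  obtain ⟨b₀, b₁, b, hb⟩ := exists_of_mem_filtration_six hy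
  obtain ⟨q, c, hc⟩ := exists_of_mem_filtration_nine hz
  have h := congrArg D relation
  simp only [map_add, Derivation.leibniz, Derivation.leibniz_pow, map_zero, smul_eq_mul,
    nsmul_eq_mul, ha, hb, hc] at h
  obtain ⟨hp, hq⟩ := ofXY_add_z_mul_ofXY_eq_zero
    (p := 3 * X 0 ^ 2 * X 1 * (C a₀ + C a * X 0)
      + (X 0 ^ 3 + 3 * X 1 ^ 2) * (C b₀ + C b₁ * X 0 + C b * X 1) + 2 * zSq * C c)
    (q := 2 * q) (by
      simp only [map_add, map_mul, map_pow, ofXY_X_zero, ofXY_X_one, ofXY_zSq, map_ofNat] at h ⊢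
      push_cast at h
      linear_combination h)
  have heval : ∀ s t : ℂ, 3 * s ^ 2 * t * (a₀ + a * s)
      + (s ^ 3 + 3 * t ^ 2) * (b₀ + b₁ * s + b * t) - 2 * (s ^ 3 * t + t ^ 3) * c = 0 := by
    intro s t
    have := congrArg (eval ![s, t]) hp
    simp only [zSq, map_add, map_mul, map_neg, map_pow, eval_X, eval_C, map_ofNat, map_zero,
      Matrix.cons_val_zero, Matrix.cons_val_one] at this
    linear_combination this
  have h₁ := heval 0 1
  have h₂ := heval 0 (-1)
  have h₃ := heval 1 0
  have h₄ := heval 1 1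
  have h₅ := heval (-1) 1
  have hb₀ : b₀ = 0 := by linear_combination (h₁ + h₂) / 6
  have hb₁ : b₁ = 0 := by linear_combination h₃ - hb₀
  have hbc : c = 9 * (b / 6) := by linear_combination (h₂ - h₁) / 4
  subst hb₀ hb₁ hbc
  have ha₀ : a₀ = 0 := by linear_combination (h₄ + h₅) / 6
  have haa : a = 4 * (b / 6) := by linear_combination (h₄ - h₅) / 6
  have hq0 : q = 0 := (mul_eq_zero.mp hq).resolve_left two_ne_zero
  refine ⟨b / 6, ?_, ?_, ?_⟩
  · rw [ha, ha₀, haa]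
    simp [smul_eq]
  · rw [hb, show 6 * (b / 6) = b by ring]
    simp [smul_eq]
  · rw [hc, hq0, ofXY_C, smul_eq]
    simp [mul_comm]

/-- The Euler derivation, acting on homogeneous elements of degree `n` as multiplication by `n`. -/
def euler : Derivation ℂ Ae7 Ae7 :=
  Derivation.mk'
    ((Polynomial.leval (1 : Ae7)).restrictScalars ℂ ∘ₗ
      (Polynomial.derivative (R := Ae7)).restrictScalars ℂ ∘ₗ coaction.toLinearMap)
    (by
      intro a b
      simp only [LinearMap.comp_apply, LinearMap.restrictScalars_apply, AlgHom.toLinearMap_apply,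
        map_mul, Polynomial.derivative_mul, Polynomial.leval_apply, Polynomial.eval_add,
        Polynomial.eval_mul, eval_coaction, smul_eq_mul]
      ring)

lemma euler_of_mem {n : ℕ} {a : Ae7} (ha : a ∈ homogeneous n) : euler a = (n : ℂ) • a := by
  change (Polynomial.derivative (coaction a)).eval 1 = _
  rw [mem_homogeneous.mp ha, Polynomial.derivative_monomial, Polynomial.eval_monomial,
    smul_eq]
  simp [mul_comm]

lemma component_euler (n : ℕ) (a : Ae7) : component n (euler a) = (n : ℂ) • component n a := by
  induction a using monomial_induction with
  | add a b ha hb => simp only [map_add, ha, hb, smul_add]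
  | smul c a ha => rw [derivation_smul, map_smul, ha, map_smul, smul_comm]
  | mon i j k =>
    have h := monomial_mem i j k
    rw [euler_of_mem h, map_smul, component_of_mem h]
    split_ifs with hn
    · rw [hn]
    · simp

lemma exists_component_ne_zero {a : Ae7} (ha : a ≠ 0) : ∃ n, component n a ≠ 0 := by
  by_contra! h
  exact ha (by rw [eq_sum_component (n := 0) (a := a) fun k _ => h k]; simp [h])

lemma mem_homogeneous_of_euler {a : Ae7} (ha : a ≠ 0) {c : ℂ} (h : euler a = c • a) :
    ∃ n : ℕ, (n : ℂ) = c ∧ a ∈ homogeneous n := by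
  have hcomp : ∀ k : ℕ, component k a ≠ 0 → (k : ℂ) = c := by
    intro k hk
    have := component_euler k a
    rw [h, map_smul] at this
    exact (smul_left_injective ℂ hk this).symm
  obtain ⟨n, hn⟩ := exists_component_ne_zero ha
  refine ⟨n, hcomp n hn, ?_⟩
  have hother : ∀ k, k ≠ n → component k a = 0 := by
    intro k hk
    by_contra h0
    exact hk (by exact_mod_cast (hcomp k h0).trans (hcomp n hn).symm)
  have hsum := eq_sum_component (n := n) (a := a) fun k hk => hother k hk.ne'
  rw [Finset.sum_eq_single n (fun k _ hk => hother k hk) (by simp)] at hsum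
  rw [hsum]
  exact component_mem n a

/-- The conjugate of the Euler derivation by an automorphism. -/
def conjEuler (φ : Ae7 ≃ₐ[ℂ] Ae7) : Derivation ℂ Ae7 Ae7 :=
  Derivation.mk' (φ.toLinearMap ∘ₗ (euler : Ae7 →ₗ[ℂ] Ae7) ∘ₗ φ.symm.toLinearMap) (by
    intro a b
    simp)

lemma conjEuler_apply (φ : Ae7 ≃ₐ[ℂ] Ae7) (a : Ae7) :
    conjEuler φ a = φ (euler (φ.symm a)) := rfl

lemma conjEuler_locally_finite (φ : Ae7 ≃ₐ[ℂ] Ae7) (a : Ae7) :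
    ∃ N, ∀ k, (conjEuler φ)^[k] a ∈ filtration N := by
  obtain ⟨m, hm⟩ := exists_mem_filtration (φ.symm a)
  choose f hf using fun n => exists_mem_filtration (φ (component n (φ.symm a)))
  have hbound : ∀ n, φ (component n (φ.symm a)) ∈
      filtration (∑ i ∈ Finset.range (m + 1), f i) := by
    intro n
    by_cases hn : n < m + 1
    · exact filtration_mono (Finset.single_le_sum (f := f) (fun _ _ => Nat.zero_le _)
        (Finset.mem_range.mpr hn)) (hf n)
    · rw [hm n (by omega), map_zero]
      exact Submodule.zero_mem _
  refine ⟨∑ i ∈ Finset.range (m + 1), f i, fun k => ?_⟩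
  have hstable : ∀ k n, φ (component n (φ.symm ((conjEuler φ)^[k] a))) ∈
      filtration (∑ i ∈ Finset.range (m + 1), f i) := by
    intro k
    induction k with
    | zero => exact hbound
    | succ k ih =>
      intro n
      rw [Function.iterate_succ_apply', conjEuler_apply, AlgEquiv.symm_apply_apply,
        component_euler, map_smul]
      exact Submodule.smul_mem _ _ (ih n)
  obtain ⟨l, hl⟩ := exists_mem_filtration (φ.symm ((conjEuler φ)^[k] a))
  rw [← φ.apply_symm_apply ((conjEuler φ)^[k] a), eq_sum_component hl, map_sum]
  exact Submodule.sum_mem _ fun n _ => hstable k n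

lemma derivation_ext {D D' : Derivation ℂ Ae7 Ae7} (hx : D x = D' x) (hy : D y = D' y)
    (hz : D z = D' z) : D = D' := by
  ext a
  induction a using monomial_induction with
  | add a b ha hb => rw [map_add, map_add, ha, hb]
  | smul c a ha => rw [derivation_smul, derivation_smul, ha]
  | mon i j k => simp only [Derivation.leibniz, Derivation.leibniz_pow, hx, hy, hz]

lemma exists_conjEuler_eq_smul (φ : Ae7 ≃ₐ[ℂ] Ae7) : ∃ μ : ℕ, conjEuler φ = (μ : ℂ) • euler := by
  obtain ⟨hx, hy, hz⟩ := mem_filtration_of_locally_finite (conjEuler_locally_finite φ)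
  obtain ⟨μ, hx, hy, hz⟩ := diagonal_of_mem_filtration hx hy hz
  have heigen : ∀ {a : Ae7} {c : ℂ}, a ≠ 0 → conjEuler φ a = c • a → ∃ n : ℕ, (n : ℂ) = c := by
    intro a c ha h
    have h' : euler (φ.symm a) = c • φ.symm a := by
      rw [← map_smul, ← h, conjEuler_apply, AlgEquiv.symm_apply_apply]
    exact (mem_homogeneous_of_euler (by simpa using ha) h').imp fun _ h => h.1
  obtain ⟨n, hn⟩ := heigen x_ne_zero hx
  obtain ⟨m, hm⟩ := heigen z_ne_zero hz
  have hμ : ((m - 2 * n : ℤ) : ℂ) = μ := by push_cast; rw [hn, hm]; ring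
  have hnm : 9 * n = 4 * m := by
    have : (9 * n : ℂ) = 4 * m := by rw [hn, hm]; ring
    exact_mod_cast this
  refine ⟨m - 2 * n, derivation_ext ?_ ?_ ?_⟩
  all_goals
    rw [Nat.cast_sub (by omega)]
    push_cast at hμ ⊢
    rw [hμ, Derivation.smul_apply]
  · rw [hx, euler_of_mem x_mem, smul_smul, mul_comm]; norm_num
  · rw [hy, euler_of_mem y_mem, smul_smul, mul_comm]; norm_num
  · rw [hz, euler_of_mem z_mem, smul_smul, mul_comm]; norm_num

lemma euler_comm (φ : Ae7 ≃ₐ[ℂ] Ae7) (a : Ae7) : euler (φ a) = φ (euler a) := by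
  obtain ⟨μ, hμ⟩ := exists_conjEuler_eq_smul φ
  obtain ⟨ν, hν⟩ := exists_conjEuler_eq_smul φ.symm
  have h₁ : ∀ a, φ (euler a) = (μ : ℂ) • euler (φ a) := by
    intro a
    have := DFunLike.congr_fun hμ (φ a)
    rwa [conjEuler_apply, AlgEquiv.symm_apply_apply, Derivation.smul_apply] at this
  have h₂ : ∀ a, euler (φ a) = (ν : ℂ) • φ (euler a) := by
    intro a
    have := congrArg φ (DFunLike.congr_fun hν a)
    rwa [conjEuler_apply, AlgEquiv.symm_symm, AlgEquiv.apply_symm_apply, Derivation.smul_apply,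
      map_smul] at this
  have h₃ : (1 : ℂ) • φ (euler x) = ((μ : ℂ) * ν) • φ (euler x) := by
    rw [mul_smul, ← h₂, ← h₁, one_smul]
  have hne : φ (euler x) ≠ 0 := by
    rw [euler_of_mem x_mem]
    simpa using x_ne_zero
  have hμν : μ * ν = 1 := by exact_mod_cast (smul_left_injective ℂ hne h₃).symm
  rw [h₁, Nat.eq_one_of_mul_eq_one_right hμν, Nat.cast_one, one_smul]

lemma map_mem_homogeneous (φ : Ae7 ≃ₐ[ℂ] Ae7) {n : ℕ} {a : Ae7} (ha : a ∈ homogeneous n) :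
    φ a ∈ homogeneous n := by
  obtain rfl | h0 := eq_or_ne a 0
  · rw [map_zero]; exact Submodule.zero_mem _
  obtain ⟨m, hm, h⟩ := mem_homogeneous_of_euler (a := φ a) (c := n) (by simpa using h0)
    (by rw [euler_comm, euler_of_mem ha, map_smul])
  rwa [Nat.cast_injective hm] at h

end Ae7

/-- Every ℂ-algebra automorphism of A is diagonal. -/
theorem e7_autos_diagonal (φ : Ae7 ≃ₐ[ℂ] Ae7) :
    ∃ α β γ : ℂ, α ≠ 0 ∧ β ≠ 0 ∧ γ ≠ 0 ∧ (α ^ 3 * β = β ^ 3 ∧ β ^ 3 = γ ^ 2) ∧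
      φ (Ideal.Quotient.mk Ie7 (X 0)) = α • Ideal.Quotient.mk Ie7 (X 0) ∧
      φ (Ideal.Quotient.mk Ie7 (X 1)) = β • Ideal.Quotient.mk Ie7 (X 1) ∧
      φ (Ideal.Quotient.mk Ie7 (X 2)) = γ • Ideal.Quotient.mk Ie7 (X 2) := by
  obtain ⟨α, hα⟩ := Ae7.component_four (φ Ae7.x)
  obtain ⟨β, hβ⟩ := Ae7.component_six (φ Ae7.y)
  obtain ⟨γ, hγ⟩ := Ae7.component_nine (φ Ae7.z)
  rw [Ae7.component_self (Ae7.map_mem_homogeneous φ Ae7.x_mem)] at hα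
  rw [Ae7.component_self (Ae7.map_mem_homogeneous φ Ae7.y_mem)] at hβ
  rw [Ae7.component_self (Ae7.map_mem_homogeneous φ Ae7.z_mem)] at hγ
  have hne : ∀ {a : Ae7} {c : ℂ}, a ≠ 0 → φ a = c • a → c ≠ 0 := by
    rintro a c ha h rfl
    exact ha (by simpa using h)
  have hrel : (α ^ 3 * β - γ ^ 2 = 0) ∧ (β ^ 3 - γ ^ 2 = 0) := by
    have h := congrArg φ Ae7.relation
    simp only [map_add, map_mul, map_pow, hα, hβ, hγ, map_zero, Ae7.smul_eq] at h
    have hp : (C (α ^ 3 * β - γ ^ 2) * (X 0 ^ 3 * X 1) + C (β ^ 3 - γ ^ 2) * X 1 ^ 3 :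
        MvPolynomial (Fin 2) ℂ) = 0 := by
      apply Ae7.ofXY_injective
      simp only [map_add, map_sub, map_mul, map_pow, Ae7.ofXY_C, Ae7.ofXY_X_zero, Ae7.ofXY_X_one,
        map_zero]
      linear_combination h - algebraMap ℂ Ae7 γ ^ 2 * Ae7.relation
    have hy := congrArg (eval ![0, 1]) hp
    have hxy := congrArg (eval ![1, 1]) hp
    simp only [map_add, map_mul, map_pow, eval_X, eval_C, map_zero, Matrix.cons_val_zero,
      Matrix.cons_val_one] at hy hxy
    exact ⟨by linear_combination hxy - hy, by linear_combination hy⟩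
  exact ⟨α, β, γ, hne Ae7.x_ne_zero hα, hne Ae7.y_ne_zero hβ, hne Ae7.z_ne_zero hγ,
    ⟨by linear_combination hrel.1 - hrel.2, by linear_combination hrel.2⟩, hα, hβ, hγ⟩

end
end

section
/- Every ℂ-algebra automorphism φ of A = ℂ[x,y,z]/(x⁵ + y³ + z²) is diagonal: there exist α, β, γ ∈ ℂ* with α⁵ = β³ = γ² such that φ(x) = αx, φ(y) = βy, φ(z) = γz, where x, y, z denote the images of the variables in A. In particular, every automorphism of the Klein surface {x⁵ + y³ + z² = 0} ⊂ ℂ³ extends to a diagonal linear automorphism of ℂ³. -/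
open MvPolynomial

noncomputable section

/-- The ideal (x⁵ + y³ + z²) in ℂ[x,y,z]. -/
def Ie8 : Ideal (MvPolynomial (Fin 3) ℂ) :=
  Ideal.span {(X 0 ^ 5 + X 1 ^ 3 + X 2 ^ 2 : MvPolynomial (Fin 3) ℂ)}

/-- The coordinate ring A = ℂ[x,y,z]/(x⁵ + y³ + z²) of the Klein surface. -/
abbrev Ae8 : Type := MvPolynomial (Fin 3) ℂ ⧸ Ie8

section LocallyNilpotent

variable {R : Type*} [CommRing R] [Algebra ℂ R]

theorem Derivation.iterate_mul_of_apply_eq_zero (D : Derivation ℂ R R) {f : R} (hf : D f = 0)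
    (n : ℕ) (g : R) : D^[n] (f * g) = f * D^[n] g := by
  induction n generalizing g with
  | zero => rfl
  | succ n ih => simp [Function.iterate_succ_apply, hf, ih]

theorem Derivation.iterate_zero_apply (D : Derivation ℂ R R) (n : ℕ) : D^[n] 0 = 0 :=
  Function.iterate_fixed (map_zero D) n

theorem Derivation.iterate_add_apply (D : Derivation ℂ R R) (n : ℕ) (f g : R) :
    D^[n] (f + g) = D^[n] f + D^[n] g :=
  iterate_map_add D n f g

theorem Derivation.iterate_mul_top (D : Derivation ℂ R R) (m n : ℕ) (f g : R)
    (hf : D^[m + 1] f = 0) (hg : D^[n + 1] g = 0) :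
    D^[m + n] (f * g) = ((m + n).choose m : R) * (D^[m] f * D^[n] g) := by
  induction hs : m + n generalizing m n f g with
  | zero =>
    obtain ⟨rfl, rfl⟩ : m = 0 ∧ n = 0 := by omega
    simp
  | succ s ih =>
    rcases m with _ | m
    · obtain rfl : n = s + 1 := by omega
      simp [D.iterate_mul_of_apply_eq_zero (by simpa using hf)]
    rcases n with _ | n
    · obtain rfl : m = s := by omega
      rw [mul_comm f g, D.iterate_mul_of_apply_eq_zero (by simpa using hg)]
      simp [mul_comm]
    · have h₁ := ih (m + 1) n f (D g) hf (by simpa using hg) (by omega)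
      have h₂ := ih m (n + 1) (D f) g (by simpa using hf) hg (by omega)
      rw [Function.iterate_succ_apply, D.leibniz, smul_eq_mul, smul_eq_mul, mul_comm g,
        D.iterate_add_apply, h₁, h₂, Nat.choose_succ_succ]
      simp only [Function.iterate_succ_apply]
      push_cast
      ring

/-- `D.HasDegree n f` says that `n` is the last index with `Dⁿ f ≠ 0`. -/
def Derivation.HasDegree (D : Derivation ℂ R R) (n : ℕ) (f : R) : Prop :=
  D^[n] f ≠ 0 ∧ D^[n + 1] f = 0

namespace Derivation

variable {D : Derivation ℂ R R}

theorem hasDegree_zero_iff {f : R} : D.HasDegree 0 f ↔ f ≠ 0 ∧ D f = 0 := by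
  simp [HasDegree]

theorem HasDegree.apply {n : ℕ} {f : R} (h : D.HasDegree (n + 1) f) : D.HasDegree n (D f) := by
  simpa [HasDegree] using h

theorem HasDegree.iterate_eq_zero {n k : ℕ} {f : R} (h : D.HasDegree n f) (hk : n < k) :
    D^[k] f = 0 := by
  obtain ⟨j, rfl⟩ := Nat.exists_eq_add_of_le' (show n + 1 ≤ k from hk)
  rw [Function.iterate_add_apply, h.2, D.iterate_zero_apply]

theorem HasDegree.unique {m n : ℕ} {f : R} (hm : D.HasDegree m f) (hn : D.HasDegree n f) :
    m = n := by
  by_contra hne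
  rcases lt_or_gt_of_ne hne with h | h
  · exact hn.1 (hm.iterate_eq_zero h)
  · exact hm.1 (hn.iterate_eq_zero h)

theorem exists_hasDegree {f : R} (hf : f ≠ 0) (h : ∃ n, D^[n] f = 0) : ∃ n, D.HasDegree n f := by
  classical
  obtain ⟨k, hk⟩ : ∃ k, Nat.find h = k + 1 :=
    Nat.exists_eq_succ_of_ne_zero fun h0 => hf (by simpa [h0] using Nat.find_spec h)
  exact ⟨k, Nat.find_min h (by omega), by simpa [hk] using Nat.find_spec h⟩

variable [IsDomain R]

theorem HasDegree.mul {m n : ℕ} {f g : R} (hf : D.HasDegree m f) (hg : D.HasDegree n g) :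
    D.HasDegree (m + n) (f * g) := by
  have : CharZero R := charZero_of_injective_algebraMap (algebraMap ℂ R).injective
  constructor
  · rw [D.iterate_mul_top m n f g hf.2 hg.2]
    have := Nat.choose_pos (Nat.le_add_right m n)
    exact mul_ne_zero (by exact_mod_cast this.ne') (mul_ne_zero hf.1 hg.1)
  · have := D.iterate_mul_top (m + 1) n f g (hf.iterate_eq_zero (by omega)) hg.2
    rw [hf.2, zero_mul, mul_zero] at this
    rwa [add_right_comm] at this

theorem HasDegree.le_of_dvd (hD : ∀ f, ∃ n, D^[n] f = 0) {m n : ℕ} {f g : R}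
    (hf : D.HasDegree m f) (hg : D.HasDegree n g) (h : f ∣ g) : m ≤ n := by
  obtain ⟨q, rfl⟩ := h
  have hq : q ≠ 0 := by
    rintro rfl
    exact hg.1 (by rw [mul_zero, D.iterate_zero_apply])
  obtain ⟨k, hk⟩ := exists_hasDegree hq (hD q)
  have := hg.unique (hf.mul hk)
  omega

theorem apply_eq_zero_of_dvd (hD : ∀ f, ∃ n, D^[n] f = 0) {f g : R} (hg : g ≠ 0) (h : D g = 0)
    (hfg : f ∣ g) : D f = 0 := by
  have hf : f ≠ 0 := ne_zero_of_dvd_ne_zero hg hfg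
  obtain ⟨k, hk⟩ := exists_hasDegree hf (hD f)
  obtain rfl : k = 0 := by
    simpa using hk.le_of_dvd hD (hasDegree_zero_iff.2 ⟨hg, h⟩) hfg
  exact (hasDegree_zero_iff.1 hk).2

/-- A locally nilpotent derivation killing a nonzero `p ^ a + e * q ^ b`, where `a, b ≥ 2` and `e`
is in the kernel, kills `p`. -/
theorem apply_eq_zero_of_pow_add_pow (hD : ∀ f, ∃ n, D^[n] f = 0) {a b : ℕ} {p q e : R}
    (hDe : D e = 0) (hc : p ^ (a + 2) + e * q ^ (b + 2) ≠ 0)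
    (hDc : D (p ^ (a + 2) + e * q ^ (b + 2)) = 0) : D p = 0 := by
  have : CharZero R := charZero_of_injective_algebraMap (algebraMap ℂ R).injective
  set c := p ^ (a + 2) + e * q ^ (b + 2) with hcdef
  have hrel : ((a + 2 : ℕ) : R) * p ^ (a + 1) * D p + e * ((b + 2 : ℕ) : R) * q ^ (b + 1) * D q
      = 0 := by
    rw [← hDc, hcdef, map_add, D.leibniz, D.leibniz_pow, D.leibniz_pow, hDe]
    simp only [smul_eq_mul, nsmul_eq_mul]
    have h1 : a + 2 - 1 = a + 1 := rfl
    have h2 : b + 2 - 1 = b + 1 := rfl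
    rw [h1, h2]
    ring
  have hq : ((b + 2 : ℕ) : R) * c * D q =
      p * (p ^ a * (((b + 2 : ℕ) : R) * p * D q - ((a + 2 : ℕ) : R) * q * D p)) := by
    rw [hcdef]; linear_combination q * hrel
  have hp : ((a + 2 : ℕ) : R) * c * D p =
      q * (q ^ b * e * (((a + 2 : ℕ) : R) * q * D p - ((b + 2 : ℕ) : R) * p * D q)) := by
    rw [hcdef]; linear_combination p * hrel
  by_contra hDp
  have hp0 : p ≠ 0 := by rintro rfl; exact hDp (map_zero D)
  have hDq : D q ≠ 0 := by
    intro h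
    rw [h, mul_zero, add_zero] at hrel
    exact mul_ne_zero (mul_ne_zero (Nat.cast_ne_zero.2 (by omega)) (pow_ne_zero _ hp0)) hDp hrel
  have hq0 : q ≠ 0 := by rintro rfl; exact hDq (map_zero D)
  obtain ⟨m, hm⟩ := exists_hasDegree hp0 (hD p)
  obtain ⟨n, hn⟩ := exists_hasDegree hq0 (hD q)
  rcases m with _ | m
  · exact hDp (hasDegree_zero_iff.1 hm).2
  rcases n with _ | n
  · exact hDq (hasDegree_zero_iff.1 hn).2
  have hconst (k : ℕ) : D.HasDegree 0 (((k + 2 : ℕ) : R) * c) :=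
    hasDegree_zero_iff.2 ⟨mul_ne_zero (Nat.cast_ne_zero.2 (by omega)) hc, by
      rw [D.leibniz, hDc, D.map_natCast, smul_zero, smul_zero, add_zero]⟩
  have h₁ := hm.le_of_dvd hD ((hconst b).mul hn.apply) ⟨_, hq⟩
  have h₂ := hn.le_of_dvd hD ((hconst a).mul hm.apply) ⟨_, hp⟩
  omega

end Derivation

end LocallyNilpotent

namespace Polynomial
section Coaction

variable {A : Type*} [CommRing A] [Algebra ℂ A]

/-- A coaction of the multiplicative monoid, i.e. an `ℕ`-grading: the coefficient of `Xⁿ` in `τ a`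
is the homogeneous component of `a` of weight `n`. -/
structure IsCoaction (τ : A →ₐ[ℂ] A[X]) : Prop where
  eval_one : ∀ a, (τ a).eval 1 = a
  coaction_coeff : ∀ a n, τ ((τ a).coeff n) = monomial n ((τ a).coeff n)

namespace IsCoaction

variable {τ : A →ₐ[ℂ] A[X]}

theorem of_span {S : Set A} (hS : Submodule.span ℂ S = ⊤)
    (h : ∀ a ∈ S, ∃ n, τ a = monomial n a) : IsCoaction τ := by
  have key (a : A) : (τ a).eval 1 = a ∧
      ∀ n, τ ((τ a).coeff n) = monomial n ((τ a).coeff n) := by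
    have ha : a ∈ Submodule.span ℂ S := hS ▸ Submodule.mem_top
    induction ha using Submodule.span_induction with
    | mem a ha =>
      obtain ⟨m, hm⟩ := h a ha
      refine ⟨by simp [hm], fun n => ?_⟩
      rw [hm, coeff_monomial]
      split_ifs with hmn
      · rw [← hmn, hm]
      · simp
    | zero => simp
    | add a b _ _ ha hb => simp [ha.1, hb.1, ha.2, hb.2]
    | smul c a _ ha =>
      simp only [map_smul, coeff_smul, eval_smul, ha.1, ha.2, smul_monomial, implies_true, and_self]
  exact ⟨fun a => (key a).1, fun a => (key a).2⟩

theorem sum_coeff (hτ : IsCoaction τ) (a : A) : ∑ n ∈ (τ a).support, (τ a).coeff n = a := by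
  conv_rhs => rw [← hτ.eval_one a, eval_eq_sum, Polynomial.sum]
  simp

theorem sum_range_coeff (hτ : IsCoaction τ) {a : A} {n : ℕ} (ha : (τ a).natDegree ≤ n) :
    ∑ m ∈ Finset.range (n + 1), (τ a).coeff m = a := by
  conv_rhs => rw [← hτ.eval_one a, eval_eq_sum_range' (Nat.lt_succ_of_le ha)]
  simp

theorem induction (hτ : IsCoaction τ) {P : A → Prop} (h0 : P 0)
    (hadd : ∀ a b, P a → P b → P (a + b))
    (hhom : ∀ n a, τ a = monomial n a → P a) (a : A) : P a := by
  rw [← hτ.sum_coeff a]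
  exact Finset.sum_induction _ P hadd h0 fun n _ => hhom n _ (hτ.coaction_coeff a n)

/-- The homogeneous component of degree `d` of a derivation, as a linear map. -/
def linearComponent (τ : A →ₐ[ℂ] A[X]) (D : Derivation ℂ A A) (d : ℕ) : A →ₗ[ℂ] A :=
  lsum (fun n => (Polynomial.lcoeff A (n + d)).restrictScalars ℂ ∘ₗ τ.toLinearMap ∘ₗ
    (D : A →ₗ[ℂ] A)) ∘ₗ τ.toLinearMap

theorem linearComponent_of_homogeneous {D : Derivation ℂ A A} {d n : ℕ} {a : A}
    (ha : τ a = monomial n a) : linearComponent τ D d a = (τ (D a)).coeff (n + d) := by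
  simp [linearComponent, lsum, ha]

theorem linearComponent_mul (hτ : IsCoaction τ) (D : Derivation ℂ A A) (d : ℕ) (a b : A) :
    linearComponent τ D d (a * b) =
      a * linearComponent τ D d b + b * linearComponent τ D d a := by
  induction a using hτ.induction with
  | h0 => simp
  | hadd a a' h h' => rw [add_mul, map_add, h, h', map_add]; ring
  | hhom n a ha =>
    induction b using hτ.induction with
    | h0 => simp
    | hadd b b' h h' => rw [mul_add, map_add, h, h', map_add]; ring
    | hhom m b hb =>
      have hab : τ (a * b) = monomial (n + m) (a * b) := by
        rw [map_mul, ha, hb, monomial_mul_monomial]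
      rw [linearComponent_of_homogeneous hab, linearComponent_of_homogeneous ha,
        linearComponent_of_homogeneous hb, D.leibniz, smul_eq_mul, smul_eq_mul, map_add, map_mul,
        map_mul, ha, hb, coeff_add, show n + m + d = (m + d) + n by ring, coeff_monomial_mul,
        show (m + d) + n = (n + d) + m by ring, coeff_monomial_mul]

variable (hτ : IsCoaction τ)

/-- The homogeneous component of degree `d` of a derivation. -/
def component (D : Derivation ℂ A A) (d : ℕ) : Derivation ℂ A A :=
  Derivation.mk' (linearComponent τ D d) (by simpa using hτ.linearComponent_mul D d)

theorem component_of_homogeneous {D : Derivation ℂ A A} {d n : ℕ} {a : A}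
    (ha : τ a = monomial n a) : hτ.component D d a = (τ (D a)).coeff (n + d) :=
  linearComponent_of_homogeneous ha

theorem component_homogeneous {D : Derivation ℂ A A} {d n : ℕ} {a : A}
    (ha : τ a = monomial n a) :
    τ (hτ.component D d a) = monomial (n + d) (hτ.component D d a) := by
  rw [hτ.component_of_homogeneous ha, hτ.coaction_coeff]

/-- The Euler derivation, multiplying elements of weight `n` by `n`. -/
def euler : Derivation ℂ A A :=
  Derivation.mk' ((Polynomial.leval (1 : A)).restrictScalars ℂ ∘ₗ
    (Polynomial.derivative (R := A)).restrictScalars ℂ ∘ₗ τ.toLinearMap) (by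
      intro a b
      simp [hτ.eval_one]
      ring)

theorem euler_of_homogeneous {n : ℕ} {a : A} (ha : τ a = monomial n a) :
    hτ.euler a = (n : ℂ) • a := by
  simp [euler, ha, derivative_monomial, Algebra.smul_def, mul_comm]

theorem coeff_euler (a : A) (n : ℕ) :
    (τ (hτ.euler a)).coeff n = (n : ℂ) • (τ a).coeff n := by
  induction a using hτ.induction with
  | h0 => simp
  | hadd a b h h' => simp [h, h']
  | hhom m a ha =>
    rw [hτ.euler_of_homogeneous ha, map_smul, ha, coeff_smul, coeff_monomial]
    split_ifs with h <;> simp [h]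

theorem coeff_iterate_euler (a : A) (n k : ℕ) :
    (τ (hτ.euler^[k] a)).coeff n = (n : ℂ) ^ k • (τ a).coeff n := by
  induction k with
  | zero => simp
  | succ k ih => rw [Function.iterate_succ_apply', hτ.coeff_euler, ih, smul_smul, pow_succ']

/-- An eigenvector of the Euler derivation is homogeneous. -/
theorem exists_homogeneous_of_euler_eq_smul {a : A} {μ : ℂ} (ha0 : a ≠ 0)
    (ha : hτ.euler a = μ • a) : ∃ n : ℕ, (n : ℂ) = μ ∧ τ a = monomial n a := by
  have hcoeff (n : ℕ) : ((n : ℂ) - μ) • (τ a).coeff n = 0 := by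
    rw [sub_smul, ← hτ.coeff_euler, ha, map_smul, coeff_smul, sub_self]
  have hne : τ a ≠ 0 := fun h => ha0 (by rw [← hτ.eval_one a, h, eval_zero])
  obtain ⟨n, hn⟩ := nonempty_support_iff.2 hne
  have huniq (m : ℕ) (hm : (τ a).coeff m ≠ 0) : (m : ℂ) = μ :=
    sub_eq_zero.1 ((smul_eq_zero.1 (hcoeff m)).resolve_right hm)
  have hnμ := huniq n (mem_support_iff.1 hn)
  have hmon : τ a = monomial n ((τ a).coeff n) := by
    ext m
    rw [coeff_monomial]
    split_ifs with h
    · rw [h]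
    · by_contra hm
      exact h (by exact_mod_cast hnμ.trans (huniq m hm).symm)
  refine ⟨n, hnμ, ?_⟩
  have : (τ a).coeff n = a := by
    conv_rhs => rw [← hτ.eval_one a, hmon, eval_monomial, one_pow, mul_one]
  rwa [this] at hmon

/-- If `D` raises weights by at most `d`, then its component of degree `d` gives leading terms. -/
theorem coeff_apply_of_natDegree_le {D : Derivation ℂ A A} {d : ℕ}
    (hD : ∀ n a, τ a = monomial n a → (τ (D a)).natDegree ≤ n + d) {n : ℕ} {a : A}
    (ha : (τ a).natDegree ≤ n) :
    (τ (D a)).natDegree ≤ n + d ∧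
      (τ (D a)).coeff (n + d) = hτ.component D d ((τ a).coeff n) := by
  have hDa : τ (D a) = ∑ m ∈ Finset.range (n + 1), τ (D ((τ a).coeff m)) := by
    rw [← map_sum, ← map_sum, hτ.sum_range_coeff ha]
  have hdeg (m : ℕ) : (τ (D ((τ a).coeff m))).natDegree ≤ m + d :=
    hD m _ (hτ.coaction_coeff a m)
  constructor
  · rw [hDa]
    refine natDegree_sum_le_of_forall_le _ _ fun m hm => (hdeg m).trans ?_
    have := Finset.mem_range.1 hm
    omega
  · rw [hDa, finsetSum_coeff, Finset.sum_range_succ, Finset.sum_eq_zero, zero_add,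
      hτ.component_of_homogeneous (hτ.coaction_coeff a n)]
    intro m hm
    have := Finset.mem_range.1 hm
    exact coeff_eq_zero_of_natDegree_lt ((hdeg m).trans_lt (by omega))

theorem coeff_iterate_of_natDegree_le {D : Derivation ℂ A A} {d : ℕ}
    (hD : ∀ n a, τ a = monomial n a → (τ (D a)).natDegree ≤ n + d) {n : ℕ} {a : A}
    (ha : (τ a).natDegree ≤ n) (k : ℕ) :
    (τ (D^[k] a)).natDegree ≤ n + k * d ∧
      (τ (D^[k] a)).coeff (n + k * d) = (hτ.component D d)^[k] ((τ a).coeff n) := by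
  induction k with
  | zero => simpa using ha
  | succ k ih =>
    have := hτ.coeff_apply_of_natDegree_le hD ih.1
    rw [Function.iterate_succ_apply', Function.iterate_succ_apply', ← ih.2,
      show n + (k + 1) * d = n + k * d + d by ring]
    exact this

/-- The leading component, of positive degree, of a derivation with bounded orbits is locally
nilpotent. -/
theorem component_locally_nilpotent {D : Derivation ℂ A A} {d : ℕ} (hd : 0 < d)
    (hD : ∀ n a, τ a = monomial n a → (τ (D a)).natDegree ≤ n + d)
    (hfin : ∀ a, ∃ N, ∀ k, (τ (D^[k] a)).natDegree ≤ N) (a : A) :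
    ∃ k, (hτ.component D d)^[k] a = 0 := by
  have hadd {a : A} {k j : ℕ} (h : (hτ.component D d)^[k] a = 0) :
      (hτ.component D d)^[j + k] a = 0 := by
    rw [Function.iterate_add_apply, h, Function.iterate_fixed (map_zero _)]
  induction a using hτ.induction with
  | h0 => exact ⟨0, rfl⟩
  | hadd a b ha hb =>
    obtain ⟨k, hk⟩ := ha
    obtain ⟨l, hl⟩ := hb
    exact ⟨l + k, by rw [iterate_map_add, hadd hk, add_comm l k, hadd hl, add_zero]⟩
  | hhom n a ha =>
    obtain ⟨N, hN⟩ := hfin a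
    refine ⟨N + 1, ?_⟩
    have hdeg : (τ a).natDegree ≤ n := ha ▸ natDegree_monomial_le a
    have h := (hτ.coeff_iterate_of_natDegree_le hD hdeg (N + 1)).2
    rw [ha, coeff_monomial_same] at h
    rw [← h]
    refine coeff_eq_zero_of_natDegree_lt ((hN _).trans_lt ?_)
    nlinarith

end IsCoaction

end Coaction

/-- Generators `x`, `y`, `z` of an algebra satisfying the Klein equation of type `E₈`, of weights
`6`, `10` and `15` for a given coaction. -/
structure E8Presentation (A : Type*) [CommRing A] [Algebra ℂ A] where
  x : A
  y : A
  z : A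
  τ : A →ₐ[ℂ] A[X]
  rel : x ^ 5 + y ^ 3 + z ^ 2 = 0
  span_eq_top :
    Submodule.span ℂ {a | ∃ i j k, k < 2 ∧ x ^ i * y ^ j * z ^ k = a} = ⊤
  τ_x : τ x = monomial 6 x
  τ_y : τ y = monomial 10 y
  τ_z : τ z = monomial 15 z
  indep : ∀ a b : ℂ, a • x ^ 5 + b • y ^ 3 = 0 → a = 0 ∧ b = 0

namespace E8Presentation

variable {A : Type*} [CommRing A] [Algebra ℂ A] (P : E8Presentation A)

theorem τ_monomial (i j k : ℕ) : P.τ (P.x ^ i * P.y ^ j * P.z ^ k) =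
    monomial (6 * i + 10 * j + 15 * k) (P.x ^ i * P.y ^ j * P.z ^ k) := by
  simp only [map_mul, map_pow, P.τ_x, P.τ_y, P.τ_z, monomial_pow, monomial_mul_monomial]

theorem isCoaction : IsCoaction P.τ :=
  IsCoaction.of_span P.span_eq_top (by rintro a ⟨i, j, k, -, rfl⟩; exact ⟨_, P.τ_monomial i j k⟩)

theorem x_ne_zero : P.x ≠ 0 := fun h => one_ne_zero (P.indep 1 0 (by simp [h])).1

theorem y_ne_zero : P.y ≠ 0 := fun h => one_ne_zero (P.indep 0 1 (by simp [h])).2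

theorem z_ne_zero : P.z ≠ 0 := fun h =>
  one_ne_zero (P.indep 1 1 (by simpa [h] using P.rel)).2

theorem coeff_mem_span (a : A) (n : ℕ) : (P.τ a).coeff n ∈ Submodule.span ℂ
    {b | ∃ i j k, k < 2 ∧ 6 * i + 10 * j + 15 * k = n ∧ P.x ^ i * P.y ^ j * P.z ^ k = b} := by
  have ha : a ∈ Submodule.span ℂ {a | ∃ i j k, k < 2 ∧ P.x ^ i * P.y ^ j * P.z ^ k = a} :=
    P.span_eq_top ▸ Submodule.mem_top
  induction ha using Submodule.span_induction with
  | mem a ha =>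
    obtain ⟨i, j, k, hk, rfl⟩ := ha
    rw [P.τ_monomial, coeff_monomial]
    split_ifs with h
    · exact Submodule.subset_span ⟨i, j, k, hk, h, rfl⟩
    · exact zero_mem _
  | zero => simp
  | add a b _ _ ha hb => simpa using add_mem ha hb
  | smul c a _ ha => simpa using Submodule.smul_mem _ c ha

theorem mem_span_of_homogeneous {a : A} {n : ℕ} (ha : P.τ a = monomial n a) :
    a ∈ Submodule.span ℂ
      {b | ∃ i j k, k < 2 ∧ 6 * i + 10 * j + 15 * k = n ∧ P.x ^ i * P.y ^ j * P.z ^ k = b} := by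
  simpa [ha] using P.coeff_mem_span a n

theorem mem_span_of_natDegree_le {a : A} {n : ℕ} (ha : (P.τ a).natDegree ≤ n) :
    a ∈ Submodule.span ℂ
      {b | ∃ i j k, k < 2 ∧ 6 * i + 10 * j + 15 * k ≤ n ∧ P.x ^ i * P.y ^ j * P.z ^ k = b} := by
  rw [← P.isCoaction.sum_range_coeff ha]
  refine sum_mem fun m hm => Submodule.span_mono ?_ (P.coeff_mem_span a m)
  rintro b ⟨i, j, k, hk, h, rfl⟩
  have := Finset.mem_range.1 hm
  exact ⟨i, j, k, hk, by omega, rfl⟩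

theorem exists_eq_monomial_mul_homogenize {a : A} {n : ℕ} (ha0 : a ≠ 0)
    (ha : P.τ a = monomial n a) :
    ∃ (i j k N : ℕ) (c : ℂ[X]), 6 * i + 10 * j + 15 * k + 30 * N = n ∧ c.natDegree ≤ N ∧
      a = P.x ^ i * P.y ^ j * P.z ^ k * MvPolynomial.aeval ![P.x ^ 5, P.y ^ 3] (c.homogenize N) := by
  have hmem := P.mem_span_of_homogeneous ha
  obtain ⟨i₀, j₀, k₀, hk₀, hn⟩ : ∃ i j k, k < 2 ∧ 6 * i + 10 * j + 15 * k = n := by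
    by_contra! h
    refine ha0 ?_
    rwa [(Set.eq_empty_iff_forall_notMem (s := {b | ∃ i j k, k < 2 ∧
      6 * i + 10 * j + 15 * k = n ∧ P.x ^ i * P.y ^ j * P.z ^ k = b})).2
      (fun b ⟨i, j, k, hk, hn, _⟩ => h i j k hk hn), Submodule.span_empty,
      Submodule.mem_bot] at hmem
  refine ⟨i₀ % 5, j₀ % 3, k₀, i₀ / 5 + j₀ / 3, ?_⟩
  suffices h : ∃ c : ℂ[X], c.natDegree ≤ i₀ / 5 + j₀ / 3 ∧ a = P.x ^ (i₀ % 5) * P.y ^ (j₀ % 3) *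
      P.z ^ k₀ * MvPolynomial.aeval ![P.x ^ 5, P.y ^ 3] (c.homogenize (i₀ / 5 + j₀ / 3)) by
    obtain ⟨c, hc⟩ := h
    exact ⟨c, by omega, hc⟩
  clear ha ha0
  induction hmem using Submodule.span_induction with
  | mem a ha =>
    obtain ⟨i, j, k, hk, h, rfl⟩ := ha
    obtain ⟨p, hp⟩ : ∃ p, p = i / 5 := ⟨_, rfl⟩
    obtain ⟨q, hq⟩ : ∃ q, q = j / 3 := ⟨_, rfl⟩
    have hi : i = i₀ % 5 + 5 * p := by omega
    have hj : j = j₀ % 3 + 3 * q := by omega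
    have hkk : k = k₀ := by omega
    have hN : i₀ / 5 + j₀ / 3 = p + q := by omega
    refine ⟨monomial p 1, (natDegree_monomial_le _).trans (by omega), ?_⟩
    rw [hN, homogenize_monomial (by omega), MvPolynomial.aeval_monomial]
    rw [hi, hj, hkk]
    simp [pow_add, pow_mul, Finsupp.prod_fintype]
    ring
  | zero => exact ⟨0, by simp, by simp⟩
  | add a b _ _ ha hb =>
    obtain ⟨c, hc, rfl⟩ := ha
    obtain ⟨e, he, rfl⟩ := hb
    exact ⟨c + e, natDegree_add_le_of_degree_le hc he, by rw [homogenize_add, map_add, mul_add]⟩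
  | smul r a _ ha =>
    obtain ⟨c, hc, rfl⟩ := ha
    exact ⟨r • c, (natDegree_smul_le r c).trans hc, by
      rw [homogenize_smul, map_smul, mul_smul_comm]⟩

end E8Presentation

/-- A binary form of positive degree over `ℂ` is divisible by a nonzero linear form. -/
theorem exists_linear_dvd_homogenize {c : Polynomial ℂ} {N : ℕ}
    (hc : c.natDegree ≤ N + 1) : ∃ a b : ℂ, (a ≠ 0 ∨ b ≠ 0) ∧
      MvPolynomial.C a * MvPolynomial.X 0 + MvPolynomial.C b * MvPolynomial.X 1 ∣
        c.homogenize (N + 1) := by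
  rcases hc.lt_or_eq with hlt | heq
  · refine ⟨0, 1, by simp, c.homogenize N, ?_⟩
    have := homogenize_mul (1 : Polynomial ℂ) c (m := 1) (n := N) (by simp) (by omega)
    rw [one_mul, homogenize_one, add_comm] at this
    simpa using this
  · obtain ⟨r, hr⟩ := IsAlgClosed.exists_root c
      (by rw [Polynomial.degree_eq_natDegree (by rintro rfl; simp at heq), heq]
          exact_mod_cast Nat.succ_ne_zero N)
    obtain ⟨q, rfl⟩ := Polynomial.dvd_iff_isRoot.2 hr
    have hq : q.natDegree ≤ N := by
      rcases eq_or_ne q 0 with rfl | hq0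
      · simp
      · rw [Polynomial.natDegree_mul (Polynomial.X_sub_C_ne_zero r) hq0,
          Polynomial.natDegree_X_sub_C] at heq
        omega
    refine ⟨1, -r, by simp, q.homogenize N, ?_⟩
    rw [add_comm N 1, homogenize_mul _ _ (Polynomial.natDegree_X_sub_C_le r) hq,
      homogenize_sub, homogenize_X one_ne_zero, homogenize_C]
    simp [sub_eq_add_neg]

namespace E8Presentation

variable {A : Type*} [CommRing A] [Algebra ℂ A] (P : E8Presentation A)

theorem derivation_rel (D : Derivation ℂ A A) :
    5 * P.x ^ 4 * D P.x + 3 * P.y ^ 2 * D P.y + 2 * P.z * D P.z = 0 := by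
  have h := congrArg D P.rel
  simp only [map_add, D.leibniz_pow, map_zero, smul_eq_mul, nsmul_eq_mul] at h
  norm_num at h
  linear_combination h

variable [IsDomain A]

/-- A homogeneous locally nilpotent derivation vanishes. -/
theorem derivation_eq_zero_of_locally_nilpotent {D : Derivation ℂ A A} {d : ℕ}
    (hhom : ∀ n a, P.τ a = monomial n a → P.τ (D a) = monomial (n + d) (D a))
    (hD : ∀ a, ∃ n, D^[n] a = 0) : D P.x = 0 ∧ D P.y = 0 ∧ D P.z = 0 := by
  have : CharZero A := charZero_of_injective_algebraMap (algebraMap ℂ A).injective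
  have hx0 := P.x_ne_zero
  have hy0 := P.y_ne_zero
  have hz0 := P.z_ne_zero
  have hrel := P.derivation_rel D
  have hxy (hx : D P.x = 0) (hy : D P.y = 0) : D P.x = 0 ∧ D P.y = 0 ∧ D P.z = 0 := by
    refine ⟨hx, hy, ?_⟩
    simpa [hx, hy, hz0] using hrel
  have hpow {a : A} (n : ℕ) (ha : D a = 0) : D (a ^ n) = 0 := by simp [D.leibniz_pow, ha]
  have of_x (hx : D P.x = 0) : D P.x = 0 ∧ D P.y = 0 ∧ D P.z = 0 := by
    have hc : P.y ^ 3 + 1 * P.z ^ 2 = -P.x ^ 5 := by linear_combination P.rel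
    refine hxy hx (D.apply_eq_zero_of_pow_add_pow hD (a := 1) (b := 0) (q := P.z) D.map_one_eq_zero ?_ ?_)
    · rw [hc]; exact neg_ne_zero.2 (pow_ne_zero _ hx0)
    · rw [hc, map_neg, hpow 5 hx, neg_zero]
  have of_y (hy : D P.y = 0) : D P.x = 0 ∧ D P.y = 0 ∧ D P.z = 0 := by
    have hc : P.x ^ 5 + 1 * P.z ^ 2 = -P.y ^ 3 := by linear_combination P.rel
    refine hxy (D.apply_eq_zero_of_pow_add_pow hD (a := 3) (b := 0) (q := P.z) D.map_one_eq_zero ?_ ?_) hy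
    · rw [hc]; exact neg_ne_zero.2 (pow_ne_zero _ hy0)
    · rw [hc, map_neg, hpow 3 hy, neg_zero]
  have of_form {a b : ℂ} (hab : a ≠ 0 ∨ b ≠ 0) (h : D (a • P.x ^ 5 + b • P.y ^ 3) = 0) :
      D P.x = 0 ∧ D P.y = 0 ∧ D P.z = 0 := by
    rcases eq_or_ne a 0 with rfl | ha
    · have hb : b ≠ 0 := by simpa using hab
      apply of_y
      simpa [D.leibniz_pow, hb, hy0] using h
    · apply of_x
      have hc : P.x ^ 5 + algebraMap ℂ A (b / a) * P.y ^ 3 =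
          a⁻¹ • (a • P.x ^ 5 + b • P.y ^ 3) := by
        rw [smul_add, smul_smul, smul_smul, inv_mul_cancel₀ ha, one_smul, Algebra.smul_def,
          div_eq_inv_mul]
      refine D.apply_eq_zero_of_pow_add_pow hD (a := 3) (b := 1) (q := P.y)
        (D.map_algebraMap (b / a)) ?_ ?_
      · rw [hc]
        exact smul_ne_zero (inv_ne_zero ha) fun h0 => ha (P.indep a b h0).1
      · rw [hc, D.map_smul, h, smul_zero]
  have of_z (hz : D P.z = 0) : D P.x = 0 ∧ D P.y = 0 ∧ D P.z = 0 := by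
    refine of_form (a := 1) (b := 1) (by simp) ?_
    rw [one_smul, one_smul, eq_neg_of_add_eq_zero_left P.rel, map_neg, hpow 2 hz, neg_zero]
  obtain ⟨m, hm⟩ := D.exists_hasDegree hx0 (hD P.x)
  have hhomog (m : ℕ) : P.τ (D^[m] P.x) = monomial (6 + m * d) (D^[m] P.x) := by
    induction m with
    | zero => simpa using P.τ_x
    | succ m ih =>
      rw [Function.iterate_succ_apply', hhom _ _ ih, add_assoc, ← Nat.succ_mul]
  have hker : D (D^[m] P.x) = 0 := (Function.iterate_succ_apply' D m P.x).symm.trans hm.2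
  obtain ⟨i, j, k, N, c, hsum, hc, heq⟩ := P.exists_eq_monomial_mul_homogenize hm.1 (hhomog m)
  have hdvd {f : A} (hf : f ∣ D^[m] P.x) : D f = 0 := D.apply_eq_zero_of_dvd hD hm.1 hker hf
  rcases Nat.eq_zero_or_pos i with rfl | hi
  swap
  · refine of_x (hdvd ?_)
    rw [heq, mul_assoc, mul_assoc]
    exact (dvd_pow_self _ hi.ne').mul_right _
  rcases Nat.eq_zero_or_pos j with rfl | hj
  swap
  · refine of_y (hdvd ?_)
    rw [heq, mul_assoc, mul_assoc]
    exact ((dvd_pow_self _ hj.ne').mul_right _).mul_left _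
  rcases Nat.eq_zero_or_pos k with rfl | hk
  swap
  · refine of_z (hdvd ?_)
    rw [heq, mul_assoc, mul_assoc]
    exact (((dvd_pow_self _ hk.ne').mul_right _).mul_left _).mul_left _
  obtain ⟨M, rfl⟩ : ∃ M, N = M + 1 := Nat.exists_eq_succ_of_ne_zero (by omega)
  obtain ⟨a, b, hab, hdiv⟩ := Polynomial.exists_linear_dvd_homogenize hc
  refine of_form hab (hdvd ?_)
  rw [heq]
  refine Dvd.dvd.mul_left ?_ _
  simpa [Algebra.smul_def] using
    _root_.map_dvd (MvPolynomial.aeval ![P.x ^ 5, P.y ^ 3]) hdiv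

end E8Presentation

namespace E8Presentation

variable {A : Type*} [CommRing A] [Algebra ℂ A] (P : E8Presentation A)

theorem derivation_ext {D₁ D₂ : Derivation ℂ A A} (hx : D₁ P.x = D₂ P.x) (hy : D₁ P.y = D₂ P.y)
    (hz : D₁ P.z = D₂ P.z) : D₁ = D₂ := by
  ext a
  have ha : a ∈ Submodule.span ℂ {a | ∃ i j k, k < 2 ∧ P.x ^ i * P.y ^ j * P.z ^ k = a} :=
    P.span_eq_top ▸ Submodule.mem_top
  induction ha using Submodule.span_induction with
  | mem a ha =>
    obtain ⟨i, j, k, -, rfl⟩ := ha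
    simp only [Derivation.leibniz, Derivation.leibniz_pow, hx, hy, hz]
  | zero => simp
  | add a b _ _ ha hb => rw [map_add, map_add, ha, hb]
  | smul c a _ ha => rw [D₁.map_smul, D₂.map_smul, ha]

/-- If a derivation raises the weights of the generators by at most `d`, then it does so for all
homogeneous elements. -/
theorem natDegree_derivation_le {D : Derivation ℂ A A} {d : ℕ}
    (hx : (P.τ (D P.x)).natDegree ≤ 6 + d) (hy : (P.τ (D P.y)).natDegree ≤ 10 + d)
    (hz : (P.τ (D P.z)).natDegree ≤ 15 + d) (n : ℕ) (a : A) (ha : P.τ a = monomial n a) :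
    (P.τ (D a)).natDegree ≤ n + d := by
  have hmul {f g : A} {m n : ℕ} (hf : P.τ f = monomial m f) (hg : P.τ g = monomial n g)
      (hDf : (P.τ (D f)).natDegree ≤ m + d) (hDg : (P.τ (D g)).natDegree ≤ n + d) :
      (P.τ (D (f * g))).natDegree ≤ m + n + d := by
    rw [D.leibniz, smul_eq_mul, smul_eq_mul, map_add, map_mul, map_mul, hf, hg]
    refine natDegree_add_le_of_degree_le ?_ ?_
    · exact (natDegree_mul_le_of_le (natDegree_monomial_le f) hDg).trans (by omega)
    · exact (natDegree_mul_le_of_le (natDegree_monomial_le g) hDf).trans (by omega)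
  have hpow {f : A} {m : ℕ} (hf : P.τ f = monomial m f)
      (hDf : (P.τ (D f)).natDegree ≤ m + d) (k : ℕ) :
      P.τ (f ^ k) = monomial (m * k) (f ^ k) ∧ (P.τ (D (f ^ k))).natDegree ≤ m * k + d := by
    have hk (k : ℕ) : P.τ (f ^ k) = monomial (m * k) (f ^ k) := by
      rw [map_pow, hf, monomial_pow]
    refine ⟨hk k, ?_⟩
    induction k with
    | zero => simp
    | succ k ih => rw [pow_succ, Nat.mul_succ]; exact hmul (hk k) hf ih hDf
  have hmem := P.mem_span_of_homogeneous ha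
  clear ha
  induction hmem using Submodule.span_induction with
  | mem a ha =>
    obtain ⟨i, j, k, -, rfl, rfl⟩ := ha
    have h₁ := hpow P.τ_x hx i
    have h₂ := hpow P.τ_y hy j
    have h₃ := hpow P.τ_z hz k
    refine hmul ?_ h₃.1 (hmul h₁.1 h₂.1 h₁.2 h₂.2) h₃.2
    rw [map_mul, h₁.1, h₂.1, monomial_mul_monomial]
  | zero => simp
  | add a b _ _ ha hb =>
    rw [map_add, map_add]
    exact natDegree_add_le_of_degree_le ha hb
  | smul c a _ ha =>
    rw [D.map_smul, map_smul]
    exact (natDegree_smul_le c _).trans ha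

theorem exists_eq_of_natDegree_le_six {a : A} (ha : (P.τ a).natDegree ≤ 6) :
    ∃ c₀ c₁ : ℂ, a = c₀ • 1 + c₁ • P.x := by
  have h := Submodule.span_mono (t := {1, P.x}) ?_ (P.mem_span_of_natDegree_le ha)
  · obtain ⟨c₀, c₁, h⟩ := Submodule.mem_span_pair.1 h
    exact ⟨c₀, c₁, h.symm⟩
  · rintro b ⟨i, j, k, -, h, rfl⟩
    obtain rfl : k = 0 := by omega
    obtain rfl : j = 0 := by omega
    have : i < 2 := by omega
    interval_cases i <;> simp

theorem exists_eq_of_natDegree_le_ten {a : A} (ha : (P.τ a).natDegree ≤ 10) :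
    ∃ c₀ c₁ c₂ : ℂ, a = c₀ • 1 + c₁ • P.x + c₂ • P.y := by
  have h := Submodule.span_mono (t := {1, P.x, P.y}) ?_ (P.mem_span_of_natDegree_le ha)
  · obtain ⟨c₀, c₁, c₂, h⟩ := Submodule.mem_span_triple.1 h
    exact ⟨c₀, c₁, c₂, h.symm⟩
  · rintro b ⟨i, j, k, -, h, rfl⟩
    obtain rfl : k = 0 := by omega
    have hi : i < 2 := by omega
    have hj : j < 2 := by omega
    interval_cases i <;> interval_cases j <;> simp at h ⊢

theorem exists_eq_of_natDegree_le_fifteen {a : A} (ha : (P.τ a).natDegree ≤ 15) :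
    ∃ c₀ c₁ c₂ c₃ c₄ : ℂ,
      a = c₀ • 1 + c₁ • P.x + c₂ • P.y + c₃ • P.x ^ 2 + c₄ • P.z := by
  have h := Submodule.span_mono (t := {1, P.x, P.y, P.x ^ 2, P.z}) ?_
    (P.mem_span_of_natDegree_le ha)
  · simp only [Submodule.mem_span_insert, Submodule.mem_span_singleton] at h
    obtain ⟨c₀, _, ⟨c₁, _, ⟨c₂, _, ⟨c₃, _, ⟨c₄, rfl⟩, rfl⟩, rfl⟩, rfl⟩, h⟩ := h
    exact ⟨c₀, c₁, c₂, c₃, c₄, by simp only [h, add_assoc]⟩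
  · rintro b ⟨i, j, k, -, h, rfl⟩
    have hi : i < 3 := by omega
    have hj : j < 2 := by omega
    have hk : k < 2 := by omega
    interval_cases i <;> interval_cases j <;> interval_cases k <;> simp at h ⊢

theorem exists_natDegree_conj_euler_le (φ : A ≃ₐ[ℂ] A) (b : A) :
    ∃ N, ∀ k, (P.τ (φ (P.isCoaction.euler^[k] b))).natDegree ≤ N := by
  refine ⟨(Finset.range ((P.τ b).natDegree + 1)).sup
    fun n => (P.τ (φ ((P.τ b).coeff n))).natDegree, fun k => ?_⟩
  have hdeg : (P.τ (P.isCoaction.euler^[k] b)).natDegree ≤ (P.τ b).natDegree := by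
    refine natDegree_le_iff_coeff_eq_zero.2 fun m hm => ?_
    rw [P.isCoaction.coeff_iterate_euler, coeff_eq_zero_of_natDegree_lt hm, smul_zero]
  rw [← P.isCoaction.sum_range_coeff hdeg, map_sum, map_sum]
  refine natDegree_sum_le_of_forall_le _ _ fun n hn => ?_
  rw [P.isCoaction.coeff_iterate_euler, map_smul, map_smul]
  exact (natDegree_smul_le _ _).trans
    (Finset.le_sup (f := fun n => (P.τ (φ ((P.τ b).coeff n))).natDegree) hn)

variable [IsDomain A]

/-- A derivation which does not raise weights is a multiple of the Euler derivation. -/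
theorem exists_eq_smul_euler {D : Derivation ℂ A A}
    (hx : (P.τ (D P.x)).natDegree ≤ 6) (hy : (P.τ (D P.y)).natDegree ≤ 10)
    (hz : (P.τ (D P.z)).natDegree ≤ 15) : ∃ r : ℂ, D = r • P.isCoaction.euler := by
  obtain ⟨a₀, a₁, ha⟩ := P.exists_eq_of_natDegree_le_six hx
  obtain ⟨b₀, b₁, b₂, hb⟩ := P.exists_eq_of_natDegree_le_ten hy
  obtain ⟨c₀, c₁, c₂, c₃, c₄, hc⟩ := P.exists_eq_of_natDegree_le_fifteen hz
  have hx0 := P.x_ne_zero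
  have hy0 := P.y_ne_zero
  have hz0 := P.z_ne_zero
  have hrel := P.derivation_rel D
  have key : (5 * a₀) • P.x ^ 4 + (3 * b₀) • P.y ^ 2 + (3 * b₁) • (P.x * P.y ^ 2) +
      (2 * c₀) • P.z + (2 * c₁) • (P.x * P.z) + (2 * c₂) • (P.y * P.z) +
      (2 * c₃) • (P.x ^ 2 * P.z) +
      ((5 * a₁ - 2 * c₄) • P.x ^ 5 + (3 * b₂ - 2 * c₄) • P.y ^ 3) = 0 := by
    rw [ha, hb, hc] at hrel
    simp only [Algebra.smul_def, map_mul, map_sub, map_ofNat] at hrel ⊢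
    linear_combination hrel - 2 * algebraMap ℂ A c₄ * P.rel
  have hτ := congrArg P.τ key
  simp only [map_add, map_smul, map_mul, map_pow, P.τ_x, P.τ_y, P.τ_z, monomial_pow,
    monomial_mul_monomial, map_zero] at hτ
  have hcoeff (n : ℕ) := congrArg (fun p => p.coeff n) hτ
  simp only [coeff_add, coeff_smul, coeff_monomial, coeff_zero] at hcoeff
  have ha₀ : a₀ = 0 := by simpa [hx0] using hcoeff 24
  have hb₀ : b₀ = 0 := by simpa [hy0] using hcoeff 20
  have hb₁ : b₁ = 0 := by simpa [hx0, hy0] using hcoeff 26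
  have hc₀ : c₀ = 0 := by simpa [hz0] using hcoeff 15
  have hc₁ : c₁ = 0 := by simpa [hx0, hz0] using hcoeff 21
  have hc₂ : c₂ = 0 := by simpa [hy0, hz0] using hcoeff 25
  have hc₃ : c₃ = 0 := by simpa [hx0, hz0] using hcoeff 27
  have h30 := P.indep (5 * a₁ - 2 * c₄) (3 * b₂ - 2 * c₄) (by simpa using hcoeff 30)
  have hb₂ : b₂ = a₁ / 6 * 10 := by linear_combination (h30.2 - h30.1) / 3
  have hc₄ : c₄ = a₁ / 6 * 15 := by linear_combination -h30.1 / 2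
  refine ⟨a₁ / 6, P.derivation_ext ?_ ?_ ?_⟩
  · rw [Derivation.smul_apply, P.isCoaction.euler_of_homogeneous P.τ_x, smul_smul, ha, ha₀]
    simp
  · rw [Derivation.smul_apply, P.isCoaction.euler_of_homogeneous P.τ_y, smul_smul, hb, hb₀, hb₁,
      hb₂]
    simp
  · rw [Derivation.smul_apply, P.isCoaction.euler_of_homogeneous P.τ_z, smul_smul, hc, hc₀, hc₁,
      hc₂, hc₃, hc₄]
    simp

/-- A derivation with bounded orbits is a multiple of the Euler derivation. -/
theorem exists_eq_smul_euler_of_bounded {D : Derivation ℂ A A}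
    (hfin : ∀ a, ∃ N, ∀ k, (P.τ (D^[k] a)).natDegree ≤ N) :
    ∃ r : ℂ, D = r • P.isCoaction.euler := by
  have descend (d : ℕ) (h : (P.τ (D P.x)).natDegree ≤ 6 + d ∧ (P.τ (D P.y)).natDegree ≤ 10 + d ∧
      (P.τ (D P.z)).natDegree ≤ 15 + d) : (P.τ (D P.x)).natDegree ≤ 6 ∧
        (P.τ (D P.y)).natDegree ≤ 10 ∧ (P.τ (D P.z)).natDegree ≤ 15 := by
    induction d with
    | zero => simpa using h
    | succ d ih =>
      obtain ⟨hx, hy, hz⟩ := h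
      have hzero := P.derivation_eq_zero_of_locally_nilpotent
        (fun n a => P.isCoaction.component_homogeneous (D := D) (d := d + 1))
        (P.isCoaction.component_locally_nilpotent d.succ_pos
          (P.natDegree_derivation_le hx hy hz) hfin)
      rw [P.isCoaction.component_of_homogeneous P.τ_x,
        P.isCoaction.component_of_homogeneous P.τ_y,
        P.isCoaction.component_of_homogeneous P.τ_z] at hzero
      have drop {p : A[X]} {n : ℕ} (hp : p.natDegree ≤ n + (d + 1))
          (h0 : p.coeff (n + (d + 1)) = 0) : p.natDegree ≤ n + d := by
        refine natDegree_le_iff_coeff_eq_zero.2 fun m hm => ?_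
        rcases (show n + (d + 1) ≤ m from hm).eq_or_lt with rfl | hlt
        · exact h0
        · exact coeff_eq_zero_of_natDegree_lt (hp.trans_lt hlt)
      exact ih ⟨drop hx hzero.1, drop hy hzero.2.1, drop hz hzero.2.2⟩
  obtain ⟨hx, hy, hz⟩ := descend ((P.τ (D P.x)).natDegree + (P.τ (D P.y)).natDegree +
    (P.τ (D P.z)).natDegree) ⟨by omega, by omega, by omega⟩
  exact P.exists_eq_smul_euler hx hy hz

/-- Automorphisms commute with the Euler derivation up to a scalar. -/
theorem exists_map_euler (φ : A ≃ₐ[ℂ] A) :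
    ∃ r : ℂ, ∀ a, φ (P.isCoaction.euler a) = r • P.isCoaction.euler (φ a) := by
  let D : Derivation ℂ A A := Derivation.mk'
    (φ.toLinearMap ∘ₗ (P.isCoaction.euler : A →ₗ[ℂ] A) ∘ₗ φ.symm.toLinearMap) (by
      intro a b
      simp)
  have hDapply (a : A) : D a = φ (P.isCoaction.euler (φ.symm a)) := rfl
  have hiter (k : ℕ) (a : A) : D^[k] a = φ (P.isCoaction.euler^[k] (φ.symm a)) := by
    induction k with
    | zero => simp
    | succ k ih =>
      rw [Function.iterate_succ_apply', Function.iterate_succ_apply', ih, hDapply,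
        φ.symm_apply_apply]
  obtain ⟨r, hr⟩ := P.exists_eq_smul_euler_of_bounded (D := D) fun a => by
    simp only [hiter]
    exact P.exists_natDegree_conj_euler_le φ (φ.symm a)
  refine ⟨r, fun a => ?_⟩
  rw [← Derivation.smul_apply, ← hr, hDapply, φ.symm_apply_apply]

/-- Every automorphism sends each generator to a homogeneous element, multiplying all weights by
the same natural number. -/
theorem exists_nat_map_homogeneous (φ : A ≃ₐ[ℂ] A) : ∃ r : ℂ, ∃ m : ℕ, r * m = 1 ∧
    (∀ a, φ (P.isCoaction.euler a) = r • P.isCoaction.euler (φ a)) ∧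
    P.τ (φ P.x) = monomial (6 * m) (φ P.x) ∧ P.τ (φ P.y) = monomial (10 * m) (φ P.y) ∧
    P.τ (φ P.z) = monomial (15 * m) (φ P.z) := by
  obtain ⟨r, hr⟩ := P.exists_map_euler φ
  have hr0 : r ≠ 0 := by
    rintro rfl
    have := hr P.x
    rw [P.isCoaction.euler_of_homogeneous P.τ_x, zero_smul, map_smul] at this
    simp [P.x_ne_zero] at this
  have hom {a : A} {n : ℕ} (ha0 : a ≠ 0) (ha : P.τ a = monomial n a) :
      ∃ k : ℕ, (k : ℂ) = r⁻¹ * n ∧ P.τ (φ a) = monomial k (φ a) := by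
    refine P.isCoaction.exists_homogeneous_of_euler_eq_smul (by simpa using ha0) ?_
    have := hr a
    rw [P.isCoaction.euler_of_homogeneous ha, map_smul] at this
    rw [mul_smul, this, smul_smul, inv_mul_cancel₀ hr0, one_smul]
  obtain ⟨i, hi, hφx⟩ := hom P.x_ne_zero P.τ_x
  obtain ⟨j, hj, hφy⟩ := hom P.y_ne_zero P.τ_y
  obtain ⟨k, hk, hφz⟩ := hom P.z_ne_zero P.τ_z
  push_cast at hi hj hk
  have hm : ((i + j - k : ℤ) : ℂ) = r⁻¹ := by
    push_cast
    linear_combination hi + hj - hk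
  have h₁ : (i : ℤ) = 6 * (i + j - k) := by
    have : (i : ℂ) = 6 * ((i + j - k : ℤ) : ℂ) := by rw [hm, hi, mul_comm]
    exact_mod_cast this
  have h₂ : (j : ℤ) = 10 * (i + j - k) := by
    have : (j : ℂ) = 10 * ((i + j - k : ℤ) : ℂ) := by rw [hm, hj, mul_comm]
    exact_mod_cast this
  obtain ⟨m, hmm⟩ := Int.eq_ofNat_of_zero_le (show (0 : ℤ) ≤ i + j - k by omega)
  refine ⟨r, m, ?_, hr, ?_⟩
  · rw [hmm] at hm
    push_cast at hm
    rw [hm, mul_inv_cancel₀ hr0]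
  · rw [show 6 * m = i by omega, show 10 * m = j by omega, show 15 * m = k by omega]
    exact ⟨hφx, hφy, hφz⟩

theorem map_homogeneous (φ : A ≃ₐ[ℂ] A) : P.τ (φ P.x) = monomial 6 (φ P.x) ∧
    P.τ (φ P.y) = monomial 10 (φ P.y) ∧ P.τ (φ P.z) = monomial 15 (φ P.z) := by
  obtain ⟨r, m, hm, hr, h⟩ := P.exists_nat_map_homogeneous φ
  obtain ⟨s, n, hn, hs, -⟩ := P.exists_nat_map_homogeneous φ.symm
  have hrs : r * s = 1 := by
    have := hs (φ P.x)
    have hx := P.isCoaction.euler_of_homogeneous P.τ_x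
    have h2 := hr P.x
    rw [φ.symm_apply_apply, hx] at this
    rw [hx] at h2
    have h3 := congrArg φ.symm h2
    rw [φ.symm_apply_apply, map_smul, this, smul_smul, smul_smul, ← sub_eq_zero, ← sub_smul] at h3
    have h4 := (smul_eq_zero.1 h3).resolve_right P.x_ne_zero
    push_cast at h4
    linear_combination -h4 / 6
  have hmn : m * n = 1 := by
    have : (m : ℂ) * n = 1 := by linear_combination s * n * hm + hn - m * n * hrs
    exact_mod_cast this
  obtain rfl := Nat.eq_one_of_mul_eq_one_right hmn
  simpa using h

theorem exists_map_eq_smul (φ : A ≃ₐ[ℂ] A) :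
    ∃ α β γ : ℂ, α ≠ 0 ∧ β ≠ 0 ∧ γ ≠ 0 ∧ (α ^ 5 = β ^ 3 ∧ β ^ 3 = γ ^ 2) ∧
      φ P.x = α • P.x ∧ φ P.y = β • P.y ∧ φ P.z = γ • P.z := by
  obtain ⟨hx, hy, hz⟩ := P.map_homogeneous φ
  have scalar {a b : A} {n : ℕ} (ha : P.τ a = monomial n a)
      (h : ∀ i j k, k < 2 → 6 * i + 10 * j + 15 * k = n → P.x ^ i * P.y ^ j * P.z ^ k = b) :
      ∃ c : ℂ, a = c • b := by
    have hmem := Submodule.span_mono (t := {b}) (by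
      rintro _ ⟨i, j, k, hk, hn, rfl⟩
      exact h i j k hk hn) (P.mem_span_of_homogeneous ha)
    obtain ⟨c, hc⟩ := Submodule.mem_span_singleton.1 hmem
    exact ⟨c, hc.symm⟩
  obtain ⟨α, hα⟩ := scalar (b := P.x) hx (by
    intro i j k hk h
    obtain ⟨rfl, rfl, rfl⟩ : i = 1 ∧ j = 0 ∧ k = 0 := by omega
    simp)
  obtain ⟨β, hβ⟩ := scalar (b := P.y) hy (by
    intro i j k hk h
    obtain ⟨rfl, rfl, rfl⟩ : i = 0 ∧ j = 1 ∧ k = 0 := by omega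
    simp)
  obtain ⟨γ, hγ⟩ := scalar (b := P.z) hz (by
    intro i j k hk h
    obtain ⟨rfl, rfl, rfl⟩ : i = 0 ∧ j = 0 ∧ k = 1 := by omega
    simp)
  have hne {a : A} {c : ℂ} (ha : a ≠ 0) (h : φ a = c • a) : c ≠ 0 := by
    rintro rfl
    exact ha (by simpa using h)
  have hrel := congrArg φ P.rel
  rw [map_add, map_add, map_pow, map_pow, map_pow, hα, hβ, hγ, map_zero, _root_.smul_pow, _root_.smul_pow,
    _root_.smul_pow] at hrel
  have h := P.indep (α ^ 5 - γ ^ 2) (β ^ 3 - γ ^ 2) (by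
    simp only [Algebra.smul_def, map_sub] at hrel ⊢
    linear_combination hrel - algebraMap ℂ A (γ ^ 2) * P.rel)
  refine ⟨α, β, γ, hne P.x_ne_zero hα, hne P.y_ne_zero hβ, hne P.z_ne_zero hγ, ⟨?_, ?_⟩,
    hα, hβ, hγ⟩
  · linear_combination h.1 - h.2
  · linear_combination h.2

end E8Presentation

end Polynomial

/-- The polynomial `x⁵ + y³ + z²` is prime. -/
theorem prime_klein_e8 : Prime (X 0 ^ 5 + X 1 ^ 3 + X 2 ^ 2 : MvPolynomial (Fin 3) ℂ) := by
  let e : MvPolynomial (Fin 3) ℂ ≃ₐ[ℂ] Polynomial (MvPolynomial (Fin 2) ℂ) :=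
    (renameEquiv ℂ (finRotate 3)).trans (finSuccEquiv ℂ 2)
  have he : e (X 0 ^ 5 + X 1 ^ 3 + X 2 ^ 2) =
      Polynomial.X ^ 2 + Polynomial.C (X 0 ^ 5 + X 1 ^ 3) := by
    have h0 : e (X 0) = Polynomial.C (X 0) := by
      simpa [e] using finSuccEquiv_X_succ (R := ℂ) (n := 2) (j := 0)
    have h1 : e (X 1) = Polynomial.C (X 1) := by
      simpa [e] using finSuccEquiv_X_succ (R := ℂ) (n := 2) (j := 1)
    have h2 : e (X 2) = Polynomial.X := by
      simpa [e] using finSuccEquiv_X_zero (R := ℂ) (n := 2)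
    rw [map_add, map_add, map_pow, map_pow, map_pow, h0, h1, h2]
    simp only [map_add, map_pow]
    ring
  rw [← MulEquiv.prime_iff e.toMulEquiv]
  change Prime (e _)
  rw [he, ← UniqueFactorizationMonoid.irreducible_iff_prime]
  have hdeg := Polynomial.natDegree_X_pow_add_C (n := 2)
    (r := (X 0 ^ 5 + X 1 ^ 3 : MvPolynomial (Fin 2) ℂ))
  rw [(Polynomial.monic_X_pow_add_C _ two_ne_zero).irreducible_iff_roots_eq_zero_of_degree_le_three
    (by rw [hdeg]) (by rw [hdeg]; norm_num), Multiset.eq_zero_iff_forall_notMem]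
  intro r hr
  have hroot : r ^ 2 + (X 0 ^ 5 + X 1 ^ 3) = 0 := by
    simpa using (Polynomial.mem_roots'.1 hr).2
  have h := congrArg (aeval ![(Polynomial.X : Polynomial ℂ), 0]) hroot
  simp only [map_add, map_pow, aeval_X, map_zero, Matrix.cons_val_zero, Matrix.cons_val_one] at h
  have h' := congrArg Polynomial.natDegree (eq_neg_of_add_eq_zero_left h)
  rw [Polynomial.natDegree_pow] at h'
  simp at h'
  omega

instance : IsDomain Ae8 := by
  rw [Ideal.Quotient.isDomain_iff_prime, Ie8,
    Ideal.span_singleton_prime prime_klein_e8.ne_zero]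
  exact prime_klein_e8

theorem mk_klein_e8 : (Ideal.Quotient.mk Ie8 (X 0)) ^ 5 + (Ideal.Quotient.mk Ie8 (X 1)) ^ 3 +
    (Ideal.Quotient.mk Ie8 (X 2)) ^ 2 = 0 := by
  simp only [← map_pow, ← map_add]
  exact Ideal.Quotient.eq_zero_iff_mem.2 (Ideal.mem_span_singleton_self _)

/-- The homomorphism out of the Klein surface ring given by a solution of its equation. -/
def liftE8 {B : Type*} [CommRing B] [Algebra ℂ B] (v : Fin 3 → B)
    (hv : v 0 ^ 5 + v 1 ^ 3 + v 2 ^ 2 = 0) : Ae8 →ₐ[ℂ] B :=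
  Ideal.Quotient.liftₐ Ie8 (aeval v) fun p hp => by
    obtain ⟨q, rfl⟩ := Ideal.mem_span_singleton'.1 hp
    simp [hv]

theorem liftE8_mk_X {B : Type*} [CommRing B] [Algebra ℂ B] (v : Fin 3 → B)
    (hv : v 0 ^ 5 + v 1 ^ 3 + v 2 ^ 2 = 0) (i : Fin 3) :
    liftE8 v hv (Ideal.Quotient.mk Ie8 (X i)) = v i :=
  (Ideal.Quotient.lift_mk Ie8 _ _).trans (aeval_X v i)

theorem span_monomials_e8 : Submodule.span ℂ {a : Ae8 | ∃ i j k, k < 2 ∧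
    Ideal.Quotient.mk Ie8 (X 0) ^ i * Ideal.Quotient.mk Ie8 (X 1) ^ j *
      Ideal.Quotient.mk Ie8 (X 2) ^ k = a} = ⊤ := by
  have hrel := mk_klein_e8
  set x := Ideal.Quotient.mk Ie8 (X 0)
  set y := Ideal.Quotient.mk Ie8 (X 1)
  set z := Ideal.Quotient.mk Ie8 (X 2)
  set S := Submodule.span ℂ {a : Ae8 | ∃ i j k, k < 2 ∧ x ^ i * y ^ j * z ^ k = a}
  have mem (i j k : ℕ) (hk : k < 2) : x ^ i * y ^ j * z ^ k ∈ S :=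
    Submodule.subset_span ⟨i, j, k, hk, rfl⟩
  have mul_mem_of (g : Ae8) (hg : ∀ i j k, k < 2 → x ^ i * y ^ j * z ^ k * g ∈ S) (a : Ae8)
      (ha : a ∈ S) : a * g ∈ S := by
    induction ha using Submodule.span_induction with
    | mem a ha => obtain ⟨i, j, k, hk, rfl⟩ := ha; exact hg i j k hk
    | zero => simp
    | add a b _ _ ha hb => rw [add_mul]; exact add_mem ha hb
    | smul c a _ ha => rw [smul_mul_assoc]; exact Submodule.smul_mem _ c ha
  rw [eq_top_iff]
  rintro a -
  obtain ⟨p, rfl⟩ := Ideal.Quotient.mk_surjective a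
  induction p using MvPolynomial.induction_on with
  | C c =>
    have := Submodule.smul_mem S c (mem 0 0 0 two_pos)
    rw [pow_zero, pow_zero, pow_zero, one_mul, one_mul, ← Algebra.algebraMap_eq_smul_one] at this
    exact this
  | add p q hp hq => rw [map_add]; exact add_mem hp hq
  | mul_X p i hp =>
    rw [map_mul]
    refine mul_mem_of _ (fun a b k hk => ?_) _ hp
    fin_cases i
    · convert mem (a + 1) b k hk using 1
      change _ * x = _
      ring
    · convert mem a (b + 1) k hk using 1
      change _ * y = _
      ring
    · change _ * z ∈ S
      interval_cases k
      · simpa using mem a b 1 one_lt_two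
      · have := neg_mem (add_mem (mem (a + 5) b 0 two_pos) (mem a (b + 3) 0 two_pos))
        convert this using 1
        linear_combination x ^ a * y ^ b * hrel

/-- The Klein surface ring of type `E₈` with its standard generators and weights. -/
def presentationE8 : Polynomial.E8Presentation Ae8 where
  x := Ideal.Quotient.mk Ie8 (X 0)
  y := Ideal.Quotient.mk Ie8 (X 1)
  z := Ideal.Quotient.mk Ie8 (X 2)
  τ := liftE8 ![Polynomial.monomial 6 (Ideal.Quotient.mk Ie8 (X 0)),
    Polynomial.monomial 10 (Ideal.Quotient.mk Ie8 (X 1)),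
    Polynomial.monomial 15 (Ideal.Quotient.mk Ie8 (X 2))] (by
      simp only [Matrix.cons_val, Polynomial.monomial_pow]
      rw [← map_add, ← map_add, mk_klein_e8, map_zero])
  rel := mk_klein_e8
  span_eq_top := span_monomials_e8
  τ_x := liftE8_mk_X _ _ 0
  τ_y := liftE8_mk_X _ _ 1
  τ_z := liftE8_mk_X _ _ 2
  indep := by
    intro a b h
    have h₁ := congrArg (liftE8 ![1, 0, Complex.I] (by simp)) h
    have h₂ := congrArg (liftE8 ![0, 1, Complex.I] (by simp)) h
    simp only [map_add, map_smul, map_pow, liftE8_mk_X] at h₁ h₂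
    constructor
    · simpa using h₁
    · simpa using h₂

/-- Every ℂ-algebra automorphism of A is diagonal. -/
theorem e8_autos_diagonal (φ : Ae8 ≃ₐ[ℂ] Ae8) :
    ∃ α β γ : ℂ, α ≠ 0 ∧ β ≠ 0 ∧ γ ≠ 0 ∧ (α ^ 5 = β ^ 3 ∧ β ^ 3 = γ ^ 2) ∧
      φ (Ideal.Quotient.mk Ie8 (X 0)) = α • Ideal.Quotient.mk Ie8 (X 0) ∧
      φ (Ideal.Quotient.mk Ie8 (X 1)) = β • Ideal.Quotient.mk Ie8 (X 1) ∧
      φ (Ideal.Quotient.mk Ie8 (X 2)) = γ • Ideal.Quotient.mk Ie8 (X 2) := by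
  exact presentationE8.exists_map_eq_smul φ

end
end

section
/- The group of ℂ-algebra automorphisms of A = ℂ[x,y,z]/(x⁴ + y³ + z²) is isomorphic, as a group, to ℂ* × ℤ/2ℤ; an isomorphism is induced by sending (t, ε) ∈ ℂ* × {±1} to the diagonal automorphism x ↦ t³x, y ↦ t⁴y, z ↦ εt⁶z. -/
open MvPolynomial

noncomputable section

/-- The ideal (x⁴ + y³ + z²) in ℂ[x,y,z]. -/
def Ie6 : Ideal (MvPolynomial (Fin 3) ℂ) :=
  Ideal.span {(X 0 ^ 4 + X 1 ^ 3 + X 2 ^ 2 : MvPolynomial (Fin 3) ℂ)}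

/-- The coordinate ring A = ℂ[x,y,z]/(x⁴ + y³ + z²) of the Klein surface E₆. -/
abbrev Ae6 : Type := MvPolynomial (Fin 3) ℂ ⧸ Ie6

open scoped Polynomial

section LocallyNilpotent

variable {A : Type*} [CommRing A] [Algebra ℂ A]

open Finset Nat in
/-- The general Leibniz rule for the iterates of a derivation. -/
theorem Derivation.iterate_apply_mul (D : Derivation ℂ A A) (n : ℕ) (a b : A) :
    D^[n] (a * b) = ∑ ij ∈ antidiagonal n, choose n ij.1 • (D^[ij.1] a * D^[ij.2] b) := by
  induction n with
  | zero => simp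
  | succ n ih =>
    rw [sum_antidiagonal_choose_succ_nsmul (M := A) (fun i j => D^[i] a * D^[j] b) n]
    simp only [Function.iterate_succ_apply', ih, map_sum, map_nsmul, Derivation.leibniz,
      smul_eq_mul, smul_add, sum_add_distrib, add_right_inj]
    refine sum_congr rfl fun ⟨i, j⟩ hij ↦ ?_
    rw [n.choose_symm_of_eq_add (mem_antidiagonal.1 hij).symm, mul_comm]

/-- A derivation is locally nilpotent if each element is killed by some iterate. -/
def Derivation.IsLocallyNilpotent (D : Derivation ℂ A A) : Prop :=
  ∀ a, ∃ n : ℕ, D^[n] a = 0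

namespace Derivation.IsLocallyNilpotent

theorem iterate_eq_zero_of_le (D : Derivation ℂ A A) {a : A} {n m : ℕ} (h : D^[n] a = 0)
    (hnm : n ≤ m) : D^[m] a = 0 := by
  obtain ⟨k, rfl⟩ := Nat.exists_eq_add_of_le' hnm
  rw [Function.iterate_add_apply, h, iterate_map_zero]

/-- The exponential `a ↦ ∑ Dⁿ(a) Tⁿ / n!` of a locally nilpotent derivation. -/
theorem exists_exp {D : Derivation ℂ A A} (hD : D.IsLocallyNilpotent) :
    ∃ E : A →+* A[X], ∀ a n, (E a).coeff n = ((n.factorial : ℂ)⁻¹) • D^[n] a := by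
  have key : ∀ a, ∃ p : A[X], ∀ n, p.coeff n = ((n.factorial : ℂ)⁻¹) • D^[n] a := by
    intro a
    obtain ⟨N, hN⟩ := hD a
    refine ⟨∑ n ∈ Finset.range N, Polynomial.monomial n (((n.factorial : ℂ)⁻¹) • D^[n] a),
      fun n => ?_⟩
    rw [Polynomial.finsetSum_coeff]
    simp only [Polynomial.coeff_monomial, Finset.sum_ite_eq', Finset.mem_range]
    split_ifs with h
    · rfl
    · rw [iterate_eq_zero_of_le D hN (not_lt.mp h), smul_zero]
  choose E hE using key
  refine ⟨{ toFun := E, map_one' := ?_, map_mul' := ?_, map_zero' := ?_, map_add' := ?_ }, hE⟩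
  · ext n
    rw [hE]
    rcases n with _ | n
    · simp
    · rw [Function.iterate_succ_apply, Derivation.map_one_eq_zero, iterate_map_zero, smul_zero,
        Polynomial.coeff_one, if_neg (Nat.succ_ne_zero n)]
  · intro a b
    ext n
    rw [hE, Polynomial.coeff_mul, Derivation.iterate_apply_mul, Finset.smul_sum]
    refine Finset.sum_congr rfl fun ij hij => ?_
    rw [hE, hE, smul_mul_smul_comm, ← Nat.cast_smul_eq_nsmul ℂ, smul_smul]
    congr 1
    rw [← Finset.HasAntidiagonal.mem_antidiagonal.1 hij, Nat.cast_add_choose]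
    have := Nat.cast_ne_zero (R := ℂ).2 (Nat.factorial_ne_zero (ij.1 + ij.2))
    field_simp
  · ext n
    rw [hE, iterate_map_zero, smul_zero, Polynomial.coeff_zero]
  · intro a b
    ext n
    rw [hE, Polynomial.coeff_add, hE, hE, iterate_map_add, smul_add]

/-- The exponential of a locally nilpotent derivation, with its kernel
described as the elements of degree zero. -/
theorem exists_exp_natDegree {D : Derivation ℂ A A} (hD : D.IsLocallyNilpotent) :
    ∃ E : A →+* A[X], (∀ a, D a = 0 → E a = Polynomial.C a) ∧
      (∀ a, (E a).natDegree = 0 → D a = 0) ∧ (∀ a, (E a).coeff 0 = a) := by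
  obtain ⟨E, hE⟩ := hD.exists_exp
  refine ⟨E, fun a ha => ?_, fun a ha => ?_, fun a => by simp [hE]⟩
  · ext n
    rw [hE]
    rcases n with _ | n
    · simp
    · rw [Function.iterate_succ_apply, ha, iterate_map_zero, smul_zero, Polynomial.coeff_C,
        if_neg (Nat.succ_ne_zero n)]
  · have := Polynomial.coeff_eq_zero_of_natDegree_lt (p := E a) (n := 1) (by omega)
    simpa [hE] using this

end Derivation.IsLocallyNilpotent

end LocallyNilpotent

section CubeOfPolynomial

variable {R : Type*} [CommRing R] [IsDomain R] [CharZero R]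

/-- A polynomial parametrization of the affine curve `y³ = P(x)`, with `P` separable of degree
at least two, is constant. -/
theorem Polynomial.natDegree_eq_zero_of_pow_three_eq_comp {P U V x y : R[X]} {c : R} (hc : c ≠ 0)
    (hUV : U * P + V * derivative P = C c) (hP : 2 ≤ P.natDegree) (h : y ^ 3 = P.comp x) :
    x.natDegree = 0 ∧ y.natDegree = 0 := by
  have hdeg : 3 * y.natDegree = P.natDegree * x.natDegree := by
    rw [← natDegree_pow, h, natDegree_comp]
  suffices hx : x.natDegree = 0 by
    refine ⟨hx, ?_⟩
    rw [hx] at hdeg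
    omega
  by_contra hx
  have hder : 3 * y ^ 2 * derivative y = derivative x * (derivative P).comp x := by
    rw [← derivative_comp, ← h, derivative_pow, C_eq_natCast]
    norm_num
  have hUVx : U.comp x * y ^ 3 + V.comp x * (derivative P).comp x = C c := by
    rw [h, ← mul_comp, ← mul_comp, ← add_comp, hUV, C_comp]
  have hdvd : C c * derivative x =
      y ^ 2 * (U.comp x * y * derivative x + 3 * V.comp x * derivative y) := by
    rw [← hUVx]
    linear_combination (-V.comp x) * hder
  have hx' : derivative x ≠ 0 := fun h0 => hx (derivative_eq_zero.1 h0)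
  have hne : C c * derivative x ≠ 0 := mul_ne_zero (C_ne_zero.2 hc) hx'
  have hle := natDegree_le_of_dvd (Dvd.intro _ hdvd.symm) hne
  rw [natDegree_pow, natDegree_C_mul hc] at hle
  have := natDegree_derivative_lt hx
  nlinarith [Nat.mul_le_mul_right x.natDegree hP]

end CubeOfPolynomial

/-- A nonzero-degree binary form over `ℂ` is divisible by a nonzero linear form. -/
theorem MvPolynomial.IsHomogeneous.exists_linear_dvd {F : MvPolynomial (Fin 2) ℂ} {m : ℕ}
    (hF : F.IsHomogeneous (m + 1)) :
    ∃ α β : ℂ, (α ≠ 0 ∨ β ≠ 0) ∧ (C α * X 0 + C β * X 1) ∣ F := by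
  obtain ⟨p, hp⟩ : ∃ p : ℂ[X], MvPolynomial.aeval ![Polynomial.X, 1] F = p := ⟨_, rfl⟩
  have hpF := Polynomial.homogenize_eq_of_isHomogeneous hF hp
  have hdeg : p.natDegree ≤ m + 1 := by
    rw [← hp]
    have := MvPolynomial.aeval_natDegree_le F hF.totalDegree_le ![Polynomial.X, (1 : ℂ[X])] (n := 1)
      (by intro i; fin_cases i <;> simp)
    simpa using this
  rcases Nat.lt_or_ge p.natDegree (m + 1) with hlt | hge
  · refine ⟨0, 1, Or.inr one_ne_zero, ?_⟩
    have := Polynomial.homogenize_mul 1 p (m := 1) (n := m) (by simp) (by omega)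
    rw [one_mul, add_comm 1 m, hpF] at this
    rw [this]
    simp
  · have hroot : p.degree ≠ 0 := by
      intro h0
      rw [Polynomial.natDegree_eq_zero_iff_degree_le_zero.2 h0.le] at hge
      omega
    obtain ⟨r, hr⟩ := IsAlgClosed.exists_root p hroot
    obtain ⟨q, hq⟩ := Polynomial.dvd_iff_isRoot.2 hr
    refine ⟨1, -r, Or.inl one_ne_zero, ?_⟩
    have hqd : q.natDegree ≤ m := by
      by_cases hq0 : q = 0
      · simp [hq0]
      · rw [hq, Polynomial.natDegree_mul (Polynomial.X_sub_C_ne_zero r) hq0,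
          Polynomial.natDegree_X_sub_C] at hdeg
        omega
    have := Polynomial.homogenize_mul (Polynomial.X - Polynomial.C r) q (m := 1) (n := m)
      (by simp) hqd
    rw [← hq, add_comm 1 m, hpF] at this
    rw [this]
    simp [sub_eq_add_neg]

section Grading

variable {A : Type*} [CommRing A] [Algebra ℂ A]

/-- A coaction `a ↦ ∑ aₙ Tⁿ` on `A`, i.e. an `ℕ`-grading in which `aₙ` is the component of
degree `n` of `a`. -/
structure IsGradingMap (τ : A →ₐ[ℂ] A[X]) : Prop where
  map_coeff : ∀ a n, τ ((τ a).coeff n) = Polynomial.monomial n ((τ a).coeff n)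
  eval_one : ∀ a, (τ a).eval 1 = a

namespace IsGradingMap

variable {τ : A →ₐ[ℂ] A[X]}

theorem sum_coeff (hτ : IsGradingMap τ) (a : A) :
    ∑ n ∈ (τ a).support, (τ a).coeff n = a := by
  conv_rhs => rw [← hτ.eval_one a, Polynomial.eval_eq_sum, Polynomial.sum]
  simp

theorem sum_coeff_range (hτ : IsGradingMap τ) {a : A} {N : ℕ} (hN : (τ a).natDegree ≤ N) :
    ∑ n ∈ Finset.range (N + 1), (τ a).coeff n = a := by
  conv_rhs => rw [← hτ.eval_one a, Polynomial.eval_eq_sum_range' (Nat.lt_succ_of_le hN)]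
  simp

/-- To check an additive property it suffices to consider homogeneous elements. -/
theorem induction (hτ : IsGradingMap τ) {p : A → Prop} (zero : p 0)
    (add : ∀ a b, p a → p b → p (a + b))
    (homogeneous : ∀ n a, τ a = Polynomial.monomial n a → p a) (a : A) : p a := by
  rw [← hτ.sum_coeff a]
  exact Finset.sum_induction _ p add zero fun n _ => homogeneous n _ (hτ.map_coeff a n)

theorem coeff_mul_of_homogeneous {f : A} {n : ℕ} (hf : τ f = Polynomial.monomial n f) (g : A)
    (k : ℕ) : (τ (f * g)).coeff (k + n) = f * (τ g).coeff k := by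
  rw [map_mul, hf, Polynomial.coeff_monomial_mul]

/-- The Euler derivation, which multiplies an element of degree `n` by `n`. -/
def euler (hτ : IsGradingMap τ) : Derivation ℂ A A :=
  Derivation.mk'
    { toFun := fun a => (Polynomial.derivative (τ a)).eval 1
      map_add' := fun a b => by simp
      map_smul' := fun c a => by simp [Polynomial.eval_smul] }
    fun a b => by
      simp only [LinearMap.coe_mk, AddHom.coe_mk, map_mul, Polynomial.derivative_mul,
        Polynomial.eval_add, Polynomial.eval_mul, hτ.eval_one, smul_eq_mul]
      ring

theorem euler_apply (hτ : IsGradingMap τ) (a : A) :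
    hτ.euler a = (Polynomial.derivative (τ a)).eval 1 := rfl

theorem euler_of_homogeneous (hτ : IsGradingMap τ) {n : ℕ} {f : A}
    (hf : τ f = Polynomial.monomial n f) : hτ.euler f = (n : ℂ) • f := by
  rw [euler_apply, hf, Polynomial.derivative_monomial, Polynomial.eval_monomial, one_pow, mul_one,
    mul_comm, Nat.cast_smul_eq_nsmul, nsmul_eq_mul]

theorem coeff_euler (hτ : IsGradingMap τ) (a : A) (n : ℕ) :
    (τ (hτ.euler a)).coeff n = (n : ℂ) • (τ a).coeff n := by
  induction a using hτ.induction with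
  | zero => simp
  | add a b ha hb => simp [ha, hb]
  | homogeneous m f hf =>
    rw [hτ.euler_of_homogeneous hf, map_smul, hf, Polynomial.coeff_smul, Polynomial.coeff_monomial]
    split_ifs with h
    · rw [h]
    · simp

theorem iterate_euler (hτ : IsGradingMap τ) (a : A) (j : ℕ) :
    hτ.euler^[j] a = ∑ n ∈ (τ a).support, ((n : ℂ) ^ j) • (τ a).coeff n := by
  induction j with
  | zero => simpa using (hτ.sum_coeff a).symm
  | succ j ih =>
    rw [Function.iterate_succ_apply', ih, map_sum]
    refine Finset.sum_congr rfl fun n _ => ?_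
    rw [Derivation.map_smul, hτ.euler_of_homogeneous (hτ.map_coeff a n), smul_smul, pow_succ]

/-- An eigenvector of the Euler derivation is homogeneous. -/
theorem homogeneous_of_euler_eq_smul [IsDomain A] (hτ : IsGradingMap τ) {a : A} (ha : a ≠ 0)
    {c : ℂ} (h : hτ.euler a = c • a) : ∃ n : ℕ, (n : ℂ) = c ∧ τ a = Polynomial.monomial n a := by
  have hn : ∀ n, (τ a).coeff n ≠ 0 → (n : ℂ) = c := by
    intro n hn
    have := hτ.coeff_euler a n
    rw [h, map_smul, Polynomial.coeff_smul] at this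
    exact (smul_left_injective ℂ hn this).symm
  have hτa : τ a ≠ 0 := fun h0 => ha (by rw [← hτ.eval_one a, h0, Polynomial.eval_zero])
  have hlead := hn (τ a).natDegree (Polynomial.leadingCoeff_ne_zero.2 hτa)
  refine ⟨(τ a).natDegree, hlead, ?_⟩
  have hcoeff : ∀ m, m ≠ (τ a).natDegree → (τ a).coeff m = 0 := by
    intro m hm
    by_contra h0
    exact hm (Nat.cast_injective ((hn m h0).trans hlead.symm))
  have hlc : (τ a).coeff (τ a).natDegree = a := by
    conv_rhs => rw [← hτ.sum_coeff_range (a := a) le_rfl]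
    refine (Finset.sum_eq_single _ (fun m _ hm => hcoeff m hm) (fun hm => ?_)).symm
    exact absurd (Finset.self_mem_range_succ _) hm
  ext m
  rw [Polynomial.coeff_monomial]
  split_ifs with hm
  · rw [← hm, hlc]
  · exact hcoeff m (Ne.symm hm)

/-- The homogeneous component of degree `d` of a derivation. -/
def component (hτ : IsGradingMap τ) (δ : Derivation ℂ A A) (d : ℕ) : Derivation ℂ A A :=
  Derivation.mk'
    ((Polynomial.lsum fun n => ((Polynomial.lcoeff A (n + d)).restrictScalars ℂ).comp
      (τ.toLinearMap.comp (δ : A →ₗ[ℂ] A))).comp τ.toLinearMap)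
    (by
      have hom : ∀ {n : ℕ} {f : A}, τ f = Polynomial.monomial n f →
          ((Polynomial.lsum fun n => ((Polynomial.lcoeff A (n + d)).restrictScalars ℂ).comp
            (τ.toLinearMap.comp (δ : A →ₗ[ℂ] A))).comp τ.toLinearMap) f =
            (τ (δ f)).coeff (n + d) := by
        intro n f hf
        rw [LinearMap.comp_apply, AlgHom.toLinearMap_apply, hf, Polynomial.lsum_apply,
          Polynomial.sum_monomial_index _ _ (by simp)]
        rfl
      intro a b
      induction a using hτ.induction with
      | zero => simp
      | add a a' ha ha' => rw [add_mul, map_add, ha, ha', map_add, smul_add, add_smul]; abel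
      | homogeneous n f hf =>
        induction b using hτ.induction with
        | zero => simp
        | add b b' hb hb' => rw [mul_add, map_add, hb, hb', map_add, smul_add, add_smul]; abel
        | homogeneous m g hg =>
          have hfg : τ (f * g) = Polynomial.monomial (n + m) (f * g) := by
            rw [map_mul, hf, hg, Polynomial.monomial_mul_monomial]
          rw [hom hfg, hom hf, hom hg, δ.leibniz, map_add, Polynomial.coeff_add, smul_eq_mul,
            smul_eq_mul, smul_eq_mul, smul_eq_mul, ← coeff_mul_of_homogeneous hf,
            ← coeff_mul_of_homogeneous hg]
          congr 2 <;> omega)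

theorem component_of_homogeneous (hτ : IsGradingMap τ) (δ : Derivation ℂ A A) (d : ℕ) {n : ℕ}
    {f : A} (hf : τ f = Polynomial.monomial n f) :
    hτ.component δ d f = (τ (δ f)).coeff (n + d) := by
  rw [component, Derivation.coe_mk', LinearMap.comp_apply, AlgHom.toLinearMap_apply, hf,
    Polynomial.lsum_apply, Polynomial.sum_monomial_index _ _ (by simp)]
  rfl

theorem component_homogeneous (hτ : IsGradingMap τ) (δ : Derivation ℂ A A) (d : ℕ) {n : ℕ}
    {f : A} (hf : τ f = Polynomial.monomial n f) :
    τ (hτ.component δ d f) = Polynomial.monomial (n + d) (hτ.component δ d f) := by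
  rw [hτ.component_of_homogeneous δ d hf, hτ.map_coeff]

theorem iterate_component_homogeneous (hτ : IsGradingMap τ) (δ : Derivation ℂ A A) (d : ℕ) {n : ℕ}
    {f : A} (hf : τ f = Polynomial.monomial n f) (j : ℕ) :
    τ ((hτ.component δ d)^[j] f) =
      Polynomial.monomial (n + j * d) ((hτ.component δ d)^[j] f) := by
  induction j with
  | zero => simpa using hf
  | succ j ih =>
    rw [Function.iterate_succ_apply', hτ.component_homogeneous δ d ih]
    congr 2
    ring

theorem coeff_apply_of_natDegree_le (hτ : IsGradingMap τ) {δ : Derivation ℂ A A} {d : ℕ}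
    (hd : ∀ e, d < e → hτ.component δ e = 0) {a : A} {n : ℕ} (ha : (τ a).natDegree ≤ n) {e : ℕ}
    (he : d ≤ e) : (τ (δ a)).coeff (n + e) = hτ.component δ e ((τ a).coeff n) := by
  have hsum : (τ (δ a)).coeff (n + e) =
      ∑ i ∈ Finset.range (n + 1), (τ (δ ((τ a).coeff i))).coeff (n + e) := by
    conv_lhs => rw [← hτ.sum_coeff_range ha]
    rw [map_sum, map_sum, Polynomial.finsetSum_coeff]
  rw [hsum, Finset.sum_eq_single n]
  · rw [hτ.component_of_homogeneous δ e (hτ.map_coeff a n)]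
  · intro i hi hin
    have hi' : i < n := lt_of_le_of_ne (Nat.lt_succ_iff.1 (Finset.mem_range.1 hi)) hin
    have := hτ.component_of_homogeneous δ (e + (n - i)) (hτ.map_coeff a i)
    rw [hd _ (by omega), Derivation.zero_apply] at this
    rw [this]
    congr 1
    omega
  · exact fun h => absurd (Finset.self_mem_range_succ n) h

theorem natDegree_iterate_le (hτ : IsGradingMap τ) {δ : Derivation ℂ A A} {d : ℕ}
    (hd : ∀ e, d < e → hτ.component δ e = 0) {a : A} {n : ℕ} (ha : (τ a).natDegree ≤ n) (j : ℕ) :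
    (τ (δ^[j] a)).natDegree ≤ n + j * d ∧
      (τ (δ^[j] a)).coeff (n + j * d) = (hτ.component δ d)^[j] ((τ a).coeff n) := by
  induction j with
  | zero => simpa using ha
  | succ j ih =>
    obtain ⟨hdeg, hcoeff⟩ := ih
    have hsucc : n + (j + 1) * d = n + j * d + d := by ring
    rw [Function.iterate_succ_apply', Function.iterate_succ_apply', hsucc]
    refine ⟨?_, by rw [hτ.coeff_apply_of_natDegree_le hd hdeg le_rfl, hcoeff]⟩
    rw [Polynomial.natDegree_le_iff_coeff_eq_zero]
    intro k hk
    obtain ⟨e, rfl⟩ := Nat.exists_eq_add_of_le (show n + j * d ≤ k by omega)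
    rw [hτ.coeff_apply_of_natDegree_le hd hdeg (by omega), hd e (by omega), Derivation.zero_apply]

/-- The top homogeneous component, if of positive degree, of a derivation whose iterates do not
increase degrees unboundedly is locally nilpotent. -/
theorem isLocallyNilpotent_component (hτ : IsGradingMap τ) {δ : Derivation ℂ A A} {d : ℕ}
    (hd : ∀ e, d < e → hτ.component δ e = 0) (hd0 : 0 < d)
    (hδ : ∀ a, ∃ N, ∀ j, (τ (δ^[j] a)).natDegree ≤ N) :
    (hτ.component δ d).IsLocallyNilpotent := by
  intro a
  induction a using hτ.induction with
  | zero => exact ⟨0, rfl⟩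
  | add a b ha hb =>
    obtain ⟨n, hn⟩ := ha
    obtain ⟨m, hm⟩ := hb
    refine ⟨max n m, ?_⟩
    rw [iterate_map_add,
      Derivation.IsLocallyNilpotent.iterate_eq_zero_of_le _ hn (le_max_left n m),
      Derivation.IsLocallyNilpotent.iterate_eq_zero_of_le _ hm (le_max_right n m), add_zero]
  | homogeneous n f hf =>
    obtain ⟨N, hN⟩ := hδ f
    refine ⟨N + 1, ?_⟩
    have hle : (τ f).natDegree ≤ n := hf ▸ Polynomial.natDegree_monomial_le _
    have := (hτ.natDegree_iterate_le hd hle (N + 1)).2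
    rw [hf, Polynomial.coeff_monomial_same] at this
    rw [← this]
    refine Polynomial.coeff_eq_zero_of_natDegree_lt ((hN _).trans_lt ?_)
    nlinarith

/-- The conjugate of the Euler derivation by an automorphism. -/
def conjEuler (hτ : IsGradingMap τ) (φ : A ≃ₐ[ℂ] A) : Derivation ℂ A A :=
  Derivation.mk' (φ.toLinearMap.comp ((hτ.euler : A →ₗ[ℂ] A).comp φ.symm.toLinearMap))
    fun a b => by simp [Derivation.leibniz]

theorem conjEuler_apply (hτ : IsGradingMap τ) (φ : A ≃ₐ[ℂ] A) (a : A) :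
    hτ.conjEuler φ a = φ (hτ.euler (φ.symm a)) := rfl

theorem iterate_conjEuler_apply (hτ : IsGradingMap τ) (φ : A ≃ₐ[ℂ] A) (a : A) (j : ℕ) :
    (hτ.conjEuler φ)^[j] a = φ (hτ.euler^[j] (φ.symm a)) := by
  induction j with
  | zero => simp
  | succ j ih => simp [Function.iterate_succ_apply', ih, conjEuler_apply]

theorem natDegree_iterate_conjEuler_le (hτ : IsGradingMap τ) (φ : A ≃ₐ[ℂ] A) (a : A) :
    ∃ N, ∀ j, (τ ((hτ.conjEuler φ)^[j] a)).natDegree ≤ N := by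
  refine ⟨(τ (φ.symm a)).support.sup fun n => (τ (φ ((τ (φ.symm a)).coeff n))).natDegree,
    fun j => ?_⟩
  rw [iterate_conjEuler_apply, iterate_euler, map_sum, map_sum]
  refine Polynomial.natDegree_sum_le_of_forall_le _ _ fun n hn => ?_
  rw [map_smul, map_smul]
  exact (Polynomial.natDegree_smul_le _ _).trans
    (Finset.le_sup (f := fun n => (τ (φ ((τ (φ.symm a)).coeff n))).natDegree) hn)

end IsGradingMap

end Grading

namespace Ae6

/-- The classes of the coordinates `x`, `y`, `z`, as `gen 0`, `gen 1`, `gen 2`. -/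
abbrev gen (i : Fin 3) : Ae6 := Ideal.Quotient.mk Ie6 (X i)

theorem relation : gen 0 ^ 4 + gen 1 ^ 3 + gen 2 ^ 2 = 0 := by
  simp only [gen, ← map_pow, ← map_add]
  exact Ideal.Quotient.eq_zero_iff_mem.2 (Ideal.subset_span rfl)

section Lift

variable {B : Type*} [CommRing B] [Algebra ℂ B]

/-- The homomorphism out of the coordinate ring given by the images of `x`, `y`, `z`. -/
def lift (a b c : B) (h : a ^ 4 + b ^ 3 + c ^ 2 = 0) : Ae6 →ₐ[ℂ] B :=
  Ideal.Quotient.liftₐ Ie6 (aeval ![a, b, c]) fun p hp => by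
    obtain ⟨q, rfl⟩ := Ideal.mem_span_singleton.1 hp
    rw [map_mul]
    simp [h]

variable {a b c : B} (h : a ^ 4 + b ^ 3 + c ^ 2 = 0)

@[simp]
theorem lift_gen_zero : lift a b c h (gen 0) = a := by
  change aeval ![a, b, c] (X 0) = a
  simp

@[simp]
theorem lift_gen_one : lift a b c h (gen 1) = b := by
  change aeval ![a, b, c] (X 1) = b
  simp

@[simp]
theorem lift_gen_two : lift a b c h (gen 2) = c := by
  change aeval ![a, b, c] (X 2) = c
  simp

end Lift

theorem adjoin_gen : Algebra.adjoin ℂ (Set.range gen) = ⊤ := by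
  have h := congrArg (Subalgebra.map (Ideal.Quotient.mkₐ ℂ Ie6))
    (MvPolynomial.adjoin_range_X (σ := Fin 3) (R := ℂ))
  rw [AlgHom.map_adjoin, ← Set.range_comp, Algebra.map_top,
    (AlgHom.range_eq_top _).2 (Ideal.Quotient.mkₐ_surjective ℂ Ie6)] at h
  exact h

theorem algHom_ext {B : Type*} [Semiring B] [Algebra ℂ B] {f g : Ae6 →ₐ[ℂ] B}
    (h0 : f (gen 0) = g (gen 0)) (h1 : f (gen 1) = g (gen 1)) (h2 : f (gen 2) = g (gen 2)) :
    f = g := by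
  refine AlgHom.ext_of_adjoin_eq_top adjoin_gen ?_
  rintro _ ⟨i, rfl⟩
  fin_cases i <;> assumption

theorem derivation_ext {D E : Derivation ℂ Ae6 Ae6}
    (h0 : D (gen 0) = E (gen 0)) (h1 : D (gen 1) = E (gen 1)) (h2 : D (gen 2) = E (gen 2)) :
    D = E := by
  refine Derivation.ext_of_adjoin_eq_top _ adjoin_gen ?_
  rintro _ ⟨i, rfl⟩
  fin_cases i <;> assumption

theorem derivation_relation (D : Derivation ℂ Ae6 Ae6) :
    4 * gen 0 ^ 3 * D (gen 0) + 3 * gen 1 ^ 2 * D (gen 1) + 2 * gen 2 * D (gen 2) = 0 := by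
  have h := congrArg D relation
  simp only [map_add, Derivation.leibniz_pow, map_zero, smul_eq_mul, nsmul_eq_mul] at h
  push_cast at h
  linear_combination h

section Domain

/-- The equation of the surface as a monic quadratic polynomial in `z` over `ℂ[x][y]`. -/
def quadratic : ℂ[X][X][X] :=
  Polynomial.X ^ 2 + Polynomial.C (Polynomial.X ^ 3 + Polynomial.C (Polynomial.X ^ 4))

open Polynomial in
theorem prime_quadratic : Prime quadratic := by
  have hdeg : quadratic.natDegree = 2 := by unfold quadratic; compute_degree!
  have hmonic : quadratic.Monic := by unfold quadratic; monicity!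
  refine Irreducible.prime ?_
  rw [hmonic.irreducible_iff_roots_eq_zero_of_degree_le_three (by omega) (by omega),
    Multiset.eq_zero_iff_forall_notMem]
  intro r hr
  have hr' : r ^ 2 + (Polynomial.X ^ 3 + Polynomial.C (Polynomial.X ^ 4)) = 0 := by
    simpa [quadratic] using (mem_roots'.1 hr).2
  have h3 : (r ^ 2).natDegree = 3 := by
    rw [eq_neg_of_add_eq_zero_left hr', natDegree_neg]
    compute_degree!
  rw [natDegree_pow] at h3
  omega

theorem eval₂_quadratic {B : Type*} [CommRing B] (g : ℂ[X][X] →+* B) (b : B) :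
    quadratic.eval₂ g b = g (.C .X) ^ 4 + g .X ^ 3 + b ^ 2 := by
  rw [quadratic, Polynomial.eval₂_add, Polynomial.eval₂_pow, Polynomial.eval₂_X,
    Polynomial.eval₂_C, map_add, map_pow, map_pow, map_pow]
  ring

theorem exists_algHom_adjoinRoot : ∃ F : Ae6 →ₐ[ℂ] AdjoinRoot quadratic,
    F (gen 0) = AdjoinRoot.of quadratic (.C .X) ∧ F (gen 1) = AdjoinRoot.of quadratic .X ∧
      F (gen 2) = AdjoinRoot.root quadratic := by
  have h := AdjoinRoot.eval₂_root quadratic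
  rw [eval₂_quadratic] at h
  exact ⟨lift _ _ _ h, lift_gen_zero h, lift_gen_one h, lift_gen_two h⟩

theorem exists_ringHom_adjoinRoot : ∃ G : AdjoinRoot quadratic →+* Ae6,
    (∀ r : ℂ, G (AdjoinRoot.of quadratic (.C (.C r))) = algebraMap ℂ Ae6 r) ∧
      G (AdjoinRoot.of quadratic (.C .X)) = gen 0 ∧ G (AdjoinRoot.of quadratic .X) = gen 1 ∧
        G (AdjoinRoot.root quadratic) = gen 2 := by
  let g : ℂ[X][X] →+* Ae6 :=
    Polynomial.eval₂RingHom (Polynomial.eval₂RingHom (algebraMap ℂ Ae6) (gen 0)) (gen 1)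
  have hC : ∀ r, g (.C (.C r)) = algebraMap ℂ Ae6 r := fun r => by
    rw [Polynomial.coe_eval₂RingHom, Polynomial.eval₂_C, Polynomial.coe_eval₂RingHom,
      Polynomial.eval₂_C]
  have hx : g (.C .X) = gen 0 := by
    rw [Polynomial.coe_eval₂RingHom, Polynomial.eval₂_C, Polynomial.coe_eval₂RingHom,
      Polynomial.eval₂_X]
  have hy : g .X = gen 1 := by rw [Polynomial.coe_eval₂RingHom, Polynomial.eval₂_X]
  have hg : quadratic.eval₂ g (gen 2) = 0 := by rw [eval₂_quadratic, hx, hy, relation]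
  refine ⟨AdjoinRoot.lift g (gen 2) hg, fun r => ?_, ?_, ?_, AdjoinRoot.lift_root hg⟩
  · rw [AdjoinRoot.lift_of, hC]
  · rw [AdjoinRoot.lift_of, hx]
  · rw [AdjoinRoot.lift_of, hy]

instance : IsDomain Ae6 := by
  have := AdjoinRoot.isDomain_of_prime prime_quadratic
  obtain ⟨F, hF0, hF1, hF2⟩ := exists_algHom_adjoinRoot
  obtain ⟨G, hGC, hG0, hG1, hG2⟩ := exists_ringHom_adjoinRoot
  have hGF : G.comp F.toRingHom = RingHom.id _ := by
    refine Ideal.Quotient.ringHom_ext (MvPolynomial.ringHom_ext (fun r => ?_) fun i => ?_)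
    · have hC : F (algebraMap ℂ Ae6 r) = AdjoinRoot.of quadratic (.C (.C r)) := F.commutes r
      exact (congrArg G hC).trans (hGC r)
    · fin_cases i
      · exact (congrArg G hF0).trans hG0
      · exact (congrArg G hF1).trans hG1
      · exact (congrArg G hF2).trans hG2
  have hF : Function.Injective F :=
    Function.LeftInverse.injective (g := G) fun a => RingHom.congr_fun hGF a
  exact hF.isDomain F.toRingHom

instance : CharZero Ae6 := charZero_of_injective_algebraMap (algebraMap ℂ Ae6).injective

end Domain

/-- The grading with `x`, `y`, `z` in degrees `3`, `4`, `6`. -/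
def grading : Ae6 →ₐ[ℂ] Ae6[X] :=
  lift (Polynomial.monomial 3 (gen 0)) (Polynomial.monomial 4 (gen 1))
    (Polynomial.monomial 6 (gen 2)) (by
      simp only [Polynomial.monomial_pow, ← map_add, relation, map_zero])

theorem smul_eq_algebraMap_mul (c : ℂ) (a : Ae6) : c • a = algebraMap ℂ Ae6 c * a :=
  Algebra.smul_def c a

theorem grading_gen_zero : grading (gen 0) = Polynomial.monomial 3 (gen 0) := lift_gen_zero _

theorem grading_gen_one : grading (gen 1) = Polynomial.monomial 4 (gen 1) := lift_gen_one _

theorem grading_gen_two : grading (gen 2) = Polynomial.monomial 6 (gen 2) := lift_gen_two _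

theorem monomial_induction {p : Ae6 → Prop} (add : ∀ a b, p a → p b → p (a + b))
    (monomial : ∀ (c : ℂ) (i j k : ℕ), p (c • (gen 0 ^ i * gen 1 ^ j * gen 2 ^ k))) (a : Ae6) :
    p a := by
  obtain ⟨f, rfl⟩ := Ideal.Quotient.mk_surjective a
  induction f using MvPolynomial.induction_on' with
  | monomial u c =>
    have h : Ideal.Quotient.mk Ie6 (MvPolynomial.monomial u c) =
        c • (gen 0 ^ u 0 * gen 1 ^ u 1 * gen 2 ^ u 2) := by
      rw [MvPolynomial.monomial_eq, Finsupp.prod_fintype _ _ (by simp), Fin.prod_univ_three,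
        map_mul, smul_eq_algebraMap_mul, map_mul, map_mul, map_pow, map_pow, map_pow]
      rfl
    exact h ▸ monomial c _ _ _
  | add f g hf hg => exact map_add (Ideal.Quotient.mk Ie6) f g ▸ add _ _ hf hg

theorem grading_monomial (c : ℂ) (i j k : ℕ) :
    grading (c • (gen 0 ^ i * gen 1 ^ j * gen 2 ^ k)) =
      Polynomial.monomial (3 * i + 4 * j + 6 * k) (c • (gen 0 ^ i * gen 1 ^ j * gen 2 ^ k)) := by
  rw [map_smul, map_mul, map_mul, map_pow, map_pow, map_pow, grading_gen_zero, grading_gen_one,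
    grading_gen_two, Polynomial.monomial_pow, Polynomial.monomial_pow, Polynomial.monomial_pow,
    Polynomial.monomial_mul_monomial, Polynomial.monomial_mul_monomial, Polynomial.smul_monomial]

theorem coeff_grading_monomial (c : ℂ) (i j k n : ℕ) :
    (grading (c • (gen 0 ^ i * gen 1 ^ j * gen 2 ^ k))).coeff n =
      if 3 * i + 4 * j + 6 * k = n then c • (gen 0 ^ i * gen 1 ^ j * gen 2 ^ k) else 0 := by
  rw [grading_monomial, Polynomial.coeff_monomial]

theorem isGradingMap : IsGradingMap grading where
  map_coeff a n := by
    induction a using monomial_induction with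
    | add a b ha hb => rw [map_add, Polynomial.coeff_add, map_add, ha, hb, map_add]
    | monomial c i j k =>
      rw [coeff_grading_monomial]
      split_ifs with h
      · rw [grading_monomial, h]
      · rw [map_zero, map_zero]
  eval_one a := by
    induction a using monomial_induction with
    | add a b ha hb => rw [map_add, Polynomial.eval_add, ha, hb]
    | monomial c i j k => rw [grading_monomial, Polynomial.eval_monomial, one_pow, mul_one]

theorem exists_coeff_grading_eq_smul {n i j k : ℕ}
    (hn : ∀ i' j' k', 3 * i' + 4 * j' + 6 * k' = n → i' = i ∧ j' = j ∧ k' = k) (g : Ae6) :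
    ∃ c : ℂ, (grading g).coeff n = c • (gen 0 ^ i * gen 1 ^ j * gen 2 ^ k) := by
  induction g using monomial_induction with
  | add a b ha hb =>
    obtain ⟨c, hc⟩ := ha
    obtain ⟨c', hc'⟩ := hb
    exact ⟨c + c', by rw [map_add, Polynomial.coeff_add, hc, hc', add_smul]⟩
  | monomial c i' j' k' =>
    rw [coeff_grading_monomial]
    split_ifs with h
    · obtain ⟨rfl, rfl, rfl⟩ := hn i' j' k' h
      exact ⟨c, rfl⟩
    · exact ⟨0, (zero_smul ℂ _).symm⟩

theorem exists_coeff_grading_zero (g : Ae6) : ∃ c : ℂ, (grading g).coeff 0 = c • 1 := by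
  simpa using exists_coeff_grading_eq_smul (i := 0) (j := 0) (k := 0) (by omega) g

theorem exists_coeff_grading_three (g : Ae6) : ∃ c : ℂ, (grading g).coeff 3 = c • gen 0 := by
  simpa using exists_coeff_grading_eq_smul (i := 1) (j := 0) (k := 0) (by omega) g

theorem exists_coeff_grading_four (g : Ae6) : ∃ c : ℂ, (grading g).coeff 4 = c • gen 1 := by
  simpa using exists_coeff_grading_eq_smul (i := 0) (j := 1) (k := 0) (by omega) g

theorem exists_coeff_grading_six (g : Ae6) :
    ∃ c d : ℂ, (grading g).coeff 6 = c • gen 2 + d • gen 0 ^ 2 := by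
  induction g using monomial_induction with
  | add a b ha hb =>
    obtain ⟨c, d, hc⟩ := ha
    obtain ⟨c', d', hc'⟩ := hb
    refine ⟨c + c', d + d', ?_⟩
    rw [map_add, Polynomial.coeff_add, hc, hc', add_smul, add_smul]
    abel
  | monomial c i j k =>
    rw [coeff_grading_monomial]
    split_ifs with h
    · obtain ⟨rfl, rfl, rfl⟩ | ⟨rfl, rfl, rfl⟩ :
          (i = 0 ∧ j = 0 ∧ k = 1) ∨ (i = 2 ∧ j = 0 ∧ k = 0) := by omega
      · exact ⟨c, 0, by simp⟩
      · exact ⟨0, c, by simp⟩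
    · exact ⟨0, 0, by simp⟩

theorem coeff_grading_eq_zero (g : Ae6) {n : ℕ} (hn : ∀ i j k : ℕ, 3 * i + 4 * j + 6 * k ≠ n) :
    (grading g).coeff n = 0 := by
  induction g using monomial_induction with
  | add a b ha hb => rw [map_add, Polynomial.coeff_add, ha, hb, add_zero]
  | monomial c i j k => rw [coeff_grading_monomial, if_neg (hn i j k)]

/-- A homogeneous element is of the form `xᵃ yᵇ F(x², z)` with `F` a binary form. -/
theorem coeff_grading_eq_mul_aeval (g : Ae6) {a b m n : ℕ} (ha : a < 2) (hb : b < 3)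
    (hn : 3 * a + 4 * b + 6 * m = n) :
    ∃ F : MvPolynomial (Fin 2) ℂ, F.IsHomogeneous m ∧
      (grading g).coeff n = gen 0 ^ a * gen 1 ^ b * aeval ![gen 0 ^ 2, gen 2] F := by
  induction g using monomial_induction with
  | add f g hf hg =>
    obtain ⟨F, hF, hfF⟩ := hf
    obtain ⟨G, hG, hgG⟩ := hg
    exact ⟨F + G, hF.add hG, by rw [map_add, Polynomial.coeff_add, hfF, hgG, map_add, mul_add]⟩
  | monomial c i j k =>
    rw [coeff_grading_monomial]
    split_ifs with h
    · obtain ⟨i', rfl⟩ : ∃ i', i = 2 * i' + a := ⟨i / 2, by omega⟩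
      obtain ⟨j', rfl⟩ : ∃ j', j = 3 * j' + b := ⟨j / 3, by omega⟩
      obtain rfl : m = i' + 2 * j' + k := by omega
      refine ⟨C c * (X 0 ^ i' * (-(X 0 ^ 2 + X 1 ^ 2)) ^ j' * X 1 ^ k), ?_, ?_⟩
      · have hX := fun i (n : ℕ) => (isHomogeneous_X_pow i n : (X i ^ n :
          MvPolynomial (Fin 2) ℂ).IsHomogeneous n)
        have := (((hX 0 i').mul ((((hX 0 2).add (hX 1 2)).neg).pow j')).mul (hX 1 k)).C_mul c
        exact this
      · have hy : gen 1 ^ 3 = -((gen 0 ^ 2) ^ 2 + gen 2 ^ 2) := by linear_combination relation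
        simp only [map_mul, map_pow, map_neg, map_add, aeval_X, aeval_C, Matrix.cons_val_zero,
          Matrix.cons_val_one, pow_add, pow_mul, smul_eq_algebraMap_mul, hy]
        ring
    · exact ⟨0, isHomogeneous_zero _ _ _, by simp⟩

/-- The value at a point of the surface. -/
theorem exists_eval {a b c : ℂ} (h : a ^ 4 + b ^ 3 + c ^ 2 = 0) :
    ∃ f : Ae6 →ₐ[ℂ] ℂ, f (gen 0) = a ∧ f (gen 1) = b ∧ f (gen 2) = c :=
  ⟨lift a b c h, lift_gen_zero h, lift_gen_one h, lift_gen_two h⟩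

theorem gen_zero_ne_zero : gen 0 ≠ 0 := by
  obtain ⟨f, hf, -, -⟩ := exists_eval (show (1 : ℂ) ^ 4 + (-1) ^ 3 + 0 ^ 2 = 0 by norm_num)
  exact fun h => by simp [h] at hf

theorem gen_one_ne_zero : gen 1 ≠ 0 := by
  obtain ⟨f, -, hf, -⟩ := exists_eval (show (1 : ℂ) ^ 4 + (-1) ^ 3 + 0 ^ 2 = 0 by norm_num)
  exact fun h => by simp [h] at hf

theorem gen_two_ne_zero : gen 2 ≠ 0 := by
  obtain ⟨f, -, -, hf⟩ := exists_eval (show (0 : ℂ) ^ 4 + (-1) ^ 3 + 1 ^ 2 = 0 by norm_num)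
  exact fun h => by simp [h] at hf

end Ae6

theorem Polynomial.natDegree_eq_zero_of_biquadratic {R : Type*} [CommRing R] [IsDomain R]
    [CharZero R] {a b e : R} {x y : R[X]} (hab : a ≠ 0 ∨ b ≠ 0) (hΔ : e * (b ^ 2 - 4 * a * e) ≠ 0)
    (h : y ^ 3 + C a * x ^ 4 + C b * x ^ 2 + C e = 0) : x.natDegree = 0 ∧ y.natDegree = 0 := by
  have hc : -2 * (e * (b ^ 2 - 4 * a * e)) ≠ 0 := mul_ne_zero (by norm_num) hΔ
  refine natDegree_eq_zero_of_pow_three_eq_comp (P := -(C a * X ^ 4 + C b * X ^ 2 + C e))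
    (U := 2 * (2 * C a * X ^ 2 + C b) ^ 2 - 8 * C a * C e)
    (V := -(X * (2 * C a * X ^ 2 + C b) * (C a * X ^ 2 + C b))) hc ?_ ?_ ?_
  · simp only [derivative_add, derivative_C_mul, derivative_X_pow, derivative_C,
      map_mul, map_neg, map_sub, map_pow, map_ofNat, map_natCast]
    push_cast
    ring
  · by_cases ha : a = 0
    · refine le_natDegree_of_ne_zero ?_
      simpa [coeff_C, coeff_X_pow, ha] using hab
    · refine (show 2 ≤ 4 by norm_num).trans (le_natDegree_of_ne_zero ?_)
      simpa [coeff_C, coeff_X_pow] using ha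
  · simp only [neg_comp, add_comp, mul_comp, pow_comp, X_comp, C_comp]
    linear_combination h

namespace Derivation.IsLocallyNilpotent

variable {A : Type*} [CommRing A] [Algebra ℂ A] [IsDomain A] {D : Derivation ℂ A A}

/-- The kernel of a locally nilpotent derivation of a domain is factorially closed. -/
theorem apply_eq_zero_of_dvd (hD : D.IsLocallyNilpotent) {a b : A} (hab : a ∣ b) (hb : b ≠ 0)
    (h : D b = 0) : D a = 0 := by
  obtain ⟨c, rfl⟩ := hab
  obtain ⟨E, hC, hE, h0⟩ := hD.exists_exp_natDegree
  refine hE _ ?_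
  have hdeg : (E (a * c)).natDegree = 0 := by rw [hC _ h, Polynomial.natDegree_C]
  have hinj : ∀ r, r ≠ 0 → E r ≠ 0 := fun r hr hEr => hr (by rw [← h0 r, hEr, Polynomial.coeff_zero])
  rw [map_mul, Polynomial.natDegree_mul (hinj _ (left_ne_zero_of_mul hb))
    (hinj _ (right_ne_zero_of_mul hb))] at hdeg
  omega

variable {x y z : A}

theorem apply_eq_zero_of_apply_x (hD : D.IsLocallyNilpotent) (hrel : x ^ 4 + y ^ 3 + z ^ 2 = 0)
    (hx : x ≠ 0) (h : D x = 0) : D y = 0 ∧ D z = 0 := by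
  have : CharZero A := charZero_of_injective_algebraMap (algebraMap ℂ A).injective
  obtain ⟨E, hC, hE, -⟩ := hD.exists_exp_natDegree
  have hE' := congrArg E hrel
  simp only [map_add, map_pow, map_zero, hC x h] at hE'
  obtain ⟨hz, hy⟩ := Polynomial.natDegree_eq_zero_of_biquadratic (a := (0 : A)) (b := 1)
    (e := x ^ 4) (x := E z) (y := E y) (Or.inr one_ne_zero) (by simpa using hx) (by
      simp only [map_zero, map_one, map_pow]
      linear_combination hE')
  exact ⟨hE _ hy, hE _ hz⟩

theorem apply_eq_zero_of_apply_y (hD : D.IsLocallyNilpotent) (hrel : x ^ 4 + y ^ 3 + z ^ 2 = 0)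
    (hx : x ≠ 0) (hy : y ≠ 0) (h : D y = 0) : D x = 0 ∧ D z = 0 := by
  obtain ⟨i, hi⟩ : ∃ i : A, i ^ 2 = -1 :=
    ⟨algebraMap ℂ A Complex.I, by rw [← map_pow, Complex.I_sq, map_neg, map_one]⟩
  have : CharZero A := charZero_of_injective_algebraMap (algebraMap ℂ A).injective
  have hy3 : D (y ^ 3) = 0 := by rw [Derivation.leibniz_pow, h, smul_zero, smul_zero]
  have hp : D (x ^ 2 + i * z) = 0 := hD.apply_eq_zero_of_dvd
    ⟨-(x ^ 2 - i * z), by linear_combination hrel - z ^ 2 * hi⟩ (pow_ne_zero 3 hy) hy3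
  have hq : D (x ^ 2 - i * z) = 0 := hD.apply_eq_zero_of_dvd
    ⟨-(x ^ 2 + i * z), by linear_combination hrel - z ^ 2 * hi⟩ (pow_ne_zero 3 hy) hy3
  have hxx : D (2 * x ^ 2) = 0 := by
    rw [show 2 * x ^ 2 = (x ^ 2 + i * z) + (x ^ 2 - i * z) by ring, map_add, hp, hq, add_zero]
  have hDx := hD.apply_eq_zero_of_dvd ⟨2 * x, by ring⟩
    (mul_ne_zero two_ne_zero (pow_ne_zero 2 hx)) hxx
  exact ⟨hDx, (hD.apply_eq_zero_of_apply_x hrel hx hDx).2⟩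

theorem apply_eq_zero_of_apply_sub (hD : D.IsLocallyNilpotent)
    (hrel : x ^ 4 + y ^ 3 + z ^ 2 = 0) {r : ℂ} (hl : z - algebraMap ℂ A r * x ^ 2 ≠ 0)
    (h : D (z - algebraMap ℂ A r * x ^ 2) = 0) : D x = 0 ∧ D y = 0 ∧ D z = 0 := by
  have : CharZero A := charZero_of_injective_algebraMap (algebraMap ℂ A).injective
  obtain ⟨E, hC, hE, -⟩ := hD.exists_exp_natDegree
  obtain ⟨l, hl'⟩ : ∃ l, z - algebraMap ℂ A r * x ^ 2 = l := ⟨_, rfl⟩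
  obtain ⟨s, hs⟩ : ∃ s, algebraMap ℂ A r = s := ⟨_, rfl⟩
  rw [hl'] at hl h
  rw [hs] at hl'
  have hs0 : D s = 0 := by rw [← hs, Derivation.map_algebraMap]
  have hz : z = l + s * x ^ 2 := by rw [← hl']; ring
  have hE' : E x ^ 4 + E y ^ 3 + (.C l + .C s * E x ^ 2) ^ 2 = 0 := by
    have := congrArg E hrel
    simpa only [hz, map_add, map_pow, map_zero, map_mul, hC _ hs0, hC _ h] using this
  obtain ⟨hx, hy⟩ := Polynomial.natDegree_eq_zero_of_biquadratic (a := 1 + s ^ 2)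
    (b := 2 * s * l) (e := l ^ 2) (x := E x) (y := E y)
    (by
      by_contra! hab
      rcases mul_eq_zero.1 hab.2 with hsl | hsl
      · rw [(mul_eq_zero.1 hsl).resolve_left two_ne_zero] at hab
        simp at hab
      · exact hl hsl)
    (by
      rw [show l ^ 2 * ((2 * s * l) ^ 2 - 4 * (1 + s ^ 2) * l ^ 2) = -4 * l ^ 4 by ring]
      exact mul_ne_zero (by norm_num) (pow_ne_zero 4 hl))
    (by
      simp only [map_add, map_mul, map_pow, map_one, map_ofNat]
      linear_combination hE')
  have hDx := hE _ hx
  refine ⟨hDx, hE _ hy, ?_⟩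
  rw [hz, map_add, h, Derivation.leibniz, Derivation.leibniz_pow, hs0, hDx]
  simp

end Derivation.IsLocallyNilpotent

namespace Ae6

/-- A locally nilpotent derivation vanishing on a nonzero homogeneous element of positive degree
is zero. -/
theorem eq_zero_of_homogeneous_mem_ker {D : Derivation ℂ Ae6 Ae6} (hD : D.IsLocallyNilpotent)
    {h : Ae6} {n : ℕ} (hn : n ≠ 0) (hh : grading h = Polynomial.monomial n h) (h0 : h ≠ 0)
    (hDh : D h = 0) : D = 0 := by
  have of_x : D (gen 0) = 0 → D = 0 := fun hx =>
    have hyz := hD.apply_eq_zero_of_apply_x relation gen_zero_ne_zero hx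
    derivation_ext hx hyz.1 hyz.2
  have of_y : D (gen 1) = 0 → D = 0 := fun hy =>
    have hxz := hD.apply_eq_zero_of_apply_y relation gen_zero_ne_zero gen_one_ne_zero hy
    derivation_ext hxz.1 hy hxz.2
  have hcoeff : (grading h).coeff n = h := by rw [hh, Polynomial.coeff_monomial_same]
  obtain ⟨i, j, k, hijk⟩ : ∃ i j k : ℕ, 3 * i + 4 * j + 6 * k = n := by
    by_contra! hne
    exact h0 (hcoeff.symm.trans (coeff_grading_eq_zero h hne))
  obtain ⟨F, hF, hFh⟩ := coeff_grading_eq_mul_aeval h (a := i % 2) (b := j % 3)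
    (m := i / 2 + 2 * (j / 3) + k) (n := n) (by omega) (by omega) (by omega)
  rw [hcoeff] at hFh
  by_cases ha : i % 2 = 0
  · by_cases hb : j % 3 = 0
    · obtain ⟨m, hm⟩ := Nat.exists_eq_succ_of_ne_zero (n := i / 2 + 2 * (j / 3) + k) (by omega)
      rw [hm] at hF
      obtain ⟨α, β, hαβ, hdvd⟩ := hF.exists_linear_dvd
      have hl : (algebraMap ℂ Ae6 α * gen 0 ^ 2 + algebraMap ℂ Ae6 β * gen 2) ∣ h := by
        rw [hFh]
        refine Dvd.dvd.mul_left ?_ _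
        simpa using map_dvd (aeval ![gen 0 ^ 2, gen 2]) hdvd
      by_cases hβ : β = 0
      · refine of_x (hD.apply_eq_zero_of_dvd (dvd_trans ?_ hl) h0 hDh)
        rw [hβ, map_zero, zero_mul, add_zero]
        exact Dvd.dvd.mul_left (dvd_pow_self _ two_ne_zero) _
      · have hl' : (gen 2 - algebraMap ℂ Ae6 (-α / β) * gen 0 ^ 2) ∣ h := by
          refine dvd_trans ⟨algebraMap ℂ Ae6 β, ?_⟩ hl
          have : algebraMap ℂ Ae6 (-α / β) * algebraMap ℂ Ae6 β = -algebraMap ℂ Ae6 α := by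
            rw [← map_mul, div_mul_cancel₀ _ hβ, map_neg]
          linear_combination gen 0 ^ 2 * this
        obtain ⟨hx, hy, hz⟩ := hD.apply_eq_zero_of_apply_sub relation (ne_zero_of_dvd_ne_zero h0 hl')
          (hD.apply_eq_zero_of_dvd hl' h0 hDh)
        exact derivation_ext hx hy hz
    · refine of_y (hD.apply_eq_zero_of_dvd ?_ h0 hDh)
      rw [hFh]
      exact ((dvd_pow_self _ hb).mul_left _).mul_right _
  · refine of_x (hD.apply_eq_zero_of_dvd ?_ h0 hDh)
    rw [hFh]
    exact ((dvd_pow_self _ ha).mul_right _).mul_right _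

/-- The components of positive degree of a conjugate of the Euler derivation vanish. -/
theorem component_conjEuler_eq_zero (φ : Ae6 ≃ₐ[ℂ] Ae6) {d : ℕ} (hd : 0 < d) :
    isGradingMap.component (isGradingMap.conjEuler φ) d = 0 := by
  obtain ⟨δ, hδ⟩ : ∃ δ, isGradingMap.conjEuler φ = δ := ⟨_, rfl⟩
  have hbdd : ∀ a, ∃ N, ∀ j, (grading (δ^[j] a)).natDegree ≤ N :=
    hδ ▸ isGradingMap.natDegree_iterate_conjEuler_le φ
  rw [hδ]
  have top : ∀ e, 0 < e → (∀ e', e < e' → isGradingMap.component δ e' = 0) →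
      isGradingMap.component δ e = 0 := by
    intro e he he'
    have hnil := isGradingMap.isLocallyNilpotent_component he' he hbdd
    by_contra hne
    obtain ⟨N, hN⟩ : ∃ N, (isGradingMap.component δ e)^[N] (gen 0) ≠ 0 ∧
        (isGradingMap.component δ e)^[N + 1] (gen 0) = 0 := by
      classical
      have hex := hnil (gen 0)
      have hpos : Nat.find hex ≠ 0 := fun h =>
        gen_zero_ne_zero (by simpa [h] using Nat.find_spec hex)
      refine ⟨Nat.find hex - 1, Nat.find_min hex (by omega), ?_⟩
      rw [Nat.sub_add_cancel (Nat.one_le_iff_ne_zero.2 hpos)]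
      exact Nat.find_spec hex
    rw [Function.iterate_succ_apply'] at hN
    exact hne (eq_zero_of_homogeneous_mem_ker hnil (by omega)
      (isGradingMap.iterate_component_homogeneous δ e grading_gen_zero N) hN.1 hN.2)
  obtain ⟨M, hM⟩ : ∃ M, ∀ e, M < e → isGradingMap.component δ e = 0 := by
    refine ⟨(grading (δ (gen 0))).natDegree + (grading (δ (gen 1))).natDegree +
      (grading (δ (gen 2))).natDegree, fun e he => derivation_ext ?_ ?_ ?_⟩
    · rw [isGradingMap.component_of_homogeneous δ e grading_gen_zero]
      exact Polynomial.coeff_eq_zero_of_natDegree_lt (by omega)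
    · rw [isGradingMap.component_of_homogeneous δ e grading_gen_one]
      exact Polynomial.coeff_eq_zero_of_natDegree_lt (by omega)
    · rw [isGradingMap.component_of_homogeneous δ e grading_gen_two]
      exact Polynomial.coeff_eq_zero_of_natDegree_lt (by omega)
  induction M with
  | zero => exact hM d hd
  | succ M ih =>
    refine ih fun e he => ?_
    rcases Nat.lt_or_ge (M + 1) e with h | h
    · exact hM e h
    · obtain rfl : e = M + 1 := by omega
      exact top _ (by omega) hM

theorem sum_coeff_conjEuler (φ : Ae6 ≃ₐ[ℂ] Ae6) {f : Ae6} {n : ℕ}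
    (hf : grading f = Polynomial.monomial n f) :
    ∑ i ∈ Finset.range (n + 1), (grading (isGradingMap.conjEuler φ f)).coeff i =
      isGradingMap.conjEuler φ f := by
  refine isGradingMap.sum_coeff_range (Polynomial.natDegree_le_iff_coeff_eq_zero.2 fun m hm => ?_)
  obtain ⟨d, rfl⟩ := Nat.exists_eq_add_of_lt hm
  rw [add_assoc, ← isGradingMap.component_of_homogeneous _ _ hf,
    component_conjEuler_eq_zero φ d.succ_pos, Derivation.zero_apply]

/-- A conjugate of the Euler derivation is a multiple of it on the generators. -/
theorem exists_conjEuler_gen (φ : Ae6 ≃ₐ[ℂ] Ae6) :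
    ∃ c : ℂ, isGradingMap.conjEuler φ (gen 0) = (c * 3) • gen 0 ∧
      isGradingMap.conjEuler φ (gen 1) = (c * 4) • gen 1 ∧
      isGradingMap.conjEuler φ (gen 2) = (c * 6) • gen 2 := by
  have hx := sum_coeff_conjEuler φ grading_gen_zero
  have hy := sum_coeff_conjEuler φ grading_gen_one
  have hz := sum_coeff_conjEuler φ grading_gen_two
  have hrel := derivation_relation (isGradingMap.conjEuler φ)
  generalize isGradingMap.conjEuler φ = δ at hx hy hz hrel ⊢
  have h1 : ∀ g, (grading g).coeff 1 = 0 := fun g => coeff_grading_eq_zero g (by omega)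
  have h2 : ∀ g, (grading g).coeff 2 = 0 := fun g => coeff_grading_eq_zero g (by omega)
  have h5 : ∀ g, (grading g).coeff 5 = 0 := fun g => coeff_grading_eq_zero g (by omega)
  obtain ⟨α₀, hα₀⟩ := exists_coeff_grading_zero (δ (gen 0))
  obtain ⟨α, hα⟩ := exists_coeff_grading_three (δ (gen 0))
  obtain ⟨β₀, hβ₀⟩ := exists_coeff_grading_zero (δ (gen 1))
  obtain ⟨β₁, hβ₁⟩ := exists_coeff_grading_three (δ (gen 1))
  obtain ⟨β, hβ⟩ := exists_coeff_grading_four (δ (gen 1))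
  obtain ⟨γ₀, hγ₀⟩ := exists_coeff_grading_zero (δ (gen 2))
  obtain ⟨γ₁, hγ₁⟩ := exists_coeff_grading_three (δ (gen 2))
  obtain ⟨γ₂, hγ₂⟩ := exists_coeff_grading_four (δ (gen 2))
  obtain ⟨γ, γ₃, hγ⟩ := exists_coeff_grading_six (δ (gen 2))
  simp only [Finset.sum_range_succ, Finset.sum_range_zero, h1, h2, h5, hα₀, hα, hβ₀, hβ₁, hβ, hγ₀,
    hγ₁, hγ₂, hγ, zero_add, add_zero] at hx hy hz
  have key : ∀ p q r : ℂ, p ^ 4 + q ^ 3 + r ^ 2 = 0 →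
      4 * p ^ 3 * (α₀ + α * p) + 3 * q ^ 2 * (β₀ + β₁ * p + β * q) +
        2 * r * (γ₀ + γ₁ * p + γ₂ * q + (γ * r + γ₃ * p ^ 2)) = 0 := by
    intro p q r h
    obtain ⟨f, hf0, hf1, hf2⟩ := exists_eval h
    have := congrArg f hrel
    rw [← hx, ← hy, ← hz] at this
    simpa only [map_add, map_mul, map_pow, map_ofNat, map_zero, map_smul, map_one, smul_eq_mul,
      mul_one, hf0, hf1, hf2] using this
  have even : ∀ p q : ℂ, 4 * p ^ 3 * (α₀ + α * p) + 3 * q ^ 2 * (β₀ + β₁ * p + β * q) -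
      2 * γ * (p ^ 4 + q ^ 3) = 0 := by
    intro p q
    obtain ⟨r, hr⟩ := IsAlgClosed.exists_pow_nat_eq (-(p ^ 4 + q ^ 3)) (n := 2) (by norm_num)
    linear_combination (key p q r (by rw [hr]; ring) + key p q (-r) (by rw [neg_sq, hr]; ring)) / 2
      - 2 * γ * hr
  have odd : ∀ p q : ℂ, p ^ 4 + q ^ 3 ≠ 0 → γ₀ + γ₁ * p + γ₂ * q + γ₃ * p ^ 2 = 0 := by
    intro p q hpq
    obtain ⟨r, hr⟩ := IsAlgClosed.exists_pow_nat_eq (-(p ^ 4 + q ^ 3)) (n := 2) (by norm_num)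
    have hr0 : r ≠ 0 := by
      rintro rfl
      exact hpq (by linear_combination hr)
    refine (mul_eq_zero.1 ?_).resolve_left hr0
    linear_combination (key p q r (by rw [hr]; ring) - key p q (-r) (by rw [neg_sq, hr]; ring)) / 4
  have e1 := even 1 0
  have e2 := even (-1) 0
  have e3 := even 0 1
  have e4 := even 0 (-1)
  have e5 := even 1 (-1)
  have o1 := odd 1 0 (by norm_num)
  have o2 := odd (-1) 0 (by norm_num)
  have o3 := odd 0 1 (by norm_num)
  have o4 := odd 0 (-1) (by norm_num)
  have hα₀ : α₀ = 0 := by linear_combination (e1 - e2) / 8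
  have hα : α = γ / 6 * 3 := by linear_combination (e1 + e2) / 8
  have hβ₀ : β₀ = 0 := by linear_combination (e3 + e4) / 6
  have hβ : β = γ / 6 * 4 := by linear_combination (e3 - e4) / 6
  have hβ₁ : β₁ = 0 := by linear_combination (e5 - e1 - e4) / 3
  have hγ₀ : γ₀ = 0 := by linear_combination (o3 + o4) / 2
  have hγ₂ : γ₂ = 0 := by linear_combination (o3 - o4) / 2
  have hγ₁ : γ₁ = 0 := by linear_combination (o1 - o2) / 2
  have hγ₃ : γ₃ = 0 := by linear_combination (o1 + o2) / 2 - (o3 + o4) / 2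
  have hγ : γ = γ / 6 * 6 := by ring
  refine ⟨γ / 6, ?_, ?_, ?_⟩
  · rw [← hx, hα₀, ← hα, zero_smul, zero_add]
  · rw [← hy, hβ₀, hβ₁, ← hβ, zero_smul, zero_smul, zero_add, zero_add]
  · rw [← hz, hγ₀, hγ₁, hγ₂, hγ₃, ← hγ]
    simp only [zero_smul, zero_add, add_zero]

/-- Every automorphism preserves the Euler derivation. -/
theorem euler_apply_comm (φ : Ae6 ≃ₐ[ℂ] Ae6) (a : Ae6) :
    isGradingMap.euler (φ a) = φ (isGradingMap.euler a) := by
  obtain ⟨c, hx, hy, hz⟩ := exists_conjEuler_gen φ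
  have heuler : isGradingMap.euler (gen 0) = (3 : ℂ) • gen 0 ∧
      isGradingMap.euler (gen 1) = (4 : ℂ) • gen 1 ∧
        isGradingMap.euler (gen 2) = (6 : ℂ) • gen 2 :=
    ⟨mod_cast isGradingMap.euler_of_homogeneous grading_gen_zero,
      mod_cast isGradingMap.euler_of_homogeneous grading_gen_one,
      mod_cast isGradingMap.euler_of_homogeneous grading_gen_two⟩
  obtain ⟨hex, hey, hez⟩ := heuler
  have hconj : isGradingMap.conjEuler φ = c • isGradingMap.euler := by
    refine derivation_ext ?_ ?_ ?_
    · rw [hx, Derivation.smul_apply, hex, mul_smul]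
    · rw [hy, Derivation.smul_apply, hey, mul_smul]
    · rw [hz, Derivation.smul_apply, hez, mul_smul]
  have hcomm : ∀ b, c • isGradingMap.euler (φ b) = φ (isGradingMap.euler b) := by
    intro b
    rw [← Derivation.smul_apply, ← hconj, isGradingMap.conjEuler_apply, φ.symm_apply_apply]
  have hx0 : φ (gen 0) ≠ 0 := (map_ne_zero_iff φ φ.injective).2 gen_zero_ne_zero
  have hc : c ≠ 0 := by
    rintro rfl
    have := hcomm (gen 0)
    rw [zero_smul, hex, map_smul] at this
    exact hx0 ((smul_eq_zero.1 this.symm).resolve_left (by norm_num))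
  have forward : ∀ {g : Ae6} {k : ℂ}, g ≠ 0 → isGradingMap.euler g = k • g →
      ∃ n : ℕ, n = c⁻¹ * k := by
    intro g k hg0 hg
    obtain ⟨n, hn, -⟩ := isGradingMap.homogeneous_of_euler_eq_smul (a := φ g) (c := c⁻¹ * k)
      ((map_ne_zero_iff φ φ.injective).2 hg0)
      (by rw [mul_smul, ← map_smul, ← hg, ← hcomm, smul_smul, inv_mul_cancel₀ hc, one_smul])
    exact ⟨n, hn⟩
  have backward : ∀ {g : Ae6} {k : ℂ}, g ≠ 0 → isGradingMap.euler g = k • g →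
      ∃ n : ℕ, n = c * k := by
    intro g k hg0 hg
    obtain ⟨n, hn, -⟩ := isGradingMap.homogeneous_of_euler_eq_smul (a := φ.symm g) (c := c * k)
      ((map_ne_zero_iff φ.symm φ.symm.injective).2 hg0)
      (φ.injective (by
        rw [← hcomm, φ.apply_symm_apply, hg, map_smul, φ.apply_symm_apply, mul_smul]))
    exact ⟨n, hn⟩
  obtain ⟨m₃, hm₃⟩ := forward gen_zero_ne_zero hex
  obtain ⟨m₄, hm₄⟩ := forward gen_one_ne_zero hey
  obtain ⟨n₃, hn₃⟩ := backward gen_zero_ne_zero hex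
  obtain ⟨n₄, hn₄⟩ := backward gen_one_ne_zero hey
  have hcn : c = ((n₄ - n₃ : ℤ) : ℂ) := by
    push_cast
    linear_combination hn₃ - hn₄
  have hcm : c⁻¹ = ((m₄ - m₃ : ℤ) : ℂ) := by
    push_cast
    linear_combination hm₃ - hm₄
  have hmul : ((n₄ - n₃ : ℤ)) * (m₄ - m₃ : ℤ) = 1 := by
    have := mul_inv_cancel₀ hc
    rw [hcm, hcn] at this
    exact_mod_cast this
  have hn : (n₃ : ℤ) = (n₄ - n₃) * 3 := by
    rw [hcn] at hn₃
    exact_mod_cast hn₃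
  have hc1 : c = 1 := by
    rcases Int.eq_one_or_neg_one_of_mul_eq_one hmul with h | h
    · rw [hcn, h, Int.cast_one]
    · omega
  rw [← hcomm, hc1, one_smul]

theorem coeff_grading_apply (φ : Ae6 ≃ₐ[ℂ] Ae6) {f : Ae6} {n : ℕ} (hf0 : f ≠ 0)
    (hf : grading f = Polynomial.monomial n f) : (grading (φ f)).coeff n = φ f := by
  obtain ⟨m, hm, h⟩ := isGradingMap.homogeneous_of_euler_eq_smul (c := n)
    ((map_ne_zero_iff φ φ.injective).2 hf0)
    (by rw [euler_apply_comm, isGradingMap.euler_of_homogeneous hf, map_smul])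
  obtain rfl : m = n := mod_cast hm
  rw [h, Polynomial.coeff_monomial_same]

/-- Every automorphism is diagonal. -/
theorem exists_apply_gen_eq_smul (φ : Ae6 ≃ₐ[ℂ] Ae6) :
    ∃ (t : ℂˣ) (r : ℂ), r ^ 2 = 1 ∧ φ (gen 0) = ((t : ℂ) ^ 3) • gen 0 ∧
      φ (gen 1) = ((t : ℂ) ^ 4) • gen 1 ∧ φ (gen 2) = (r * (t : ℂ) ^ 6) • gen 2 := by
  obtain ⟨a, ha⟩ := exists_coeff_grading_three (φ (gen 0))
  obtain ⟨b, hb⟩ := exists_coeff_grading_four (φ (gen 1))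
  obtain ⟨c, d, hcd⟩ := exists_coeff_grading_six (φ (gen 2))
  rw [coeff_grading_apply φ gen_zero_ne_zero grading_gen_zero] at ha
  rw [coeff_grading_apply φ gen_one_ne_zero grading_gen_one] at hb
  rw [coeff_grading_apply φ gen_two_ne_zero grading_gen_two] at hcd
  have hne : ∀ {g : Ae6} {k : ℂ}, g ≠ 0 → φ g = k • g → k ≠ 0 := by
    rintro g k hg h rfl
    rw [zero_smul, map_eq_zero_iff φ φ.injective] at h
    exact hg h
  have ha0 : a ≠ 0 := hne gen_zero_ne_zero ha
  have hb0 : b ≠ 0 := hne gen_one_ne_zero hb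
  have key : ∀ p q r : ℂ, p ^ 4 + q ^ 3 + r ^ 2 = 0 →
      (a * p) ^ 4 + (b * q) ^ 3 + (c * r + d * p ^ 2) ^ 2 = 0 := by
    intro p q r h
    obtain ⟨f, hf0, hf1, hf2⟩ := exists_eval h
    have := congrArg (fun g => f (φ g)) relation
    simpa only [map_add, map_pow, map_zero, ha, hb, hcd, map_smul, smul_eq_mul, hf0, hf1,
      hf2] using this
  have k1 := key 1 0 Complex.I (by simp)
  have k2 := key 1 0 (-Complex.I) (by simp)
  have k3 := key 0 (-1) 1 (by norm_num)
  have hbc : c ^ 2 = b ^ 3 := by linear_combination k3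
  have hc0 : c ≠ 0 := by
    rintro rfl
    exact pow_ne_zero 3 hb0 (by linear_combination -hbc)
  have hd0 : d = 0 := by
    refine (mul_eq_zero.1 ?_).resolve_left hc0
    refine (mul_eq_zero.1 ?_).resolve_left Complex.I_ne_zero
    linear_combination (k1 - k2) / 4
  subst hd0
  have hab : a ^ 4 = b ^ 3 := by linear_combination k1 + hbc - c ^ 2 * Complex.I_sq
  have ht3 : (b / a) ^ 3 = a := by
    field_simp
    linear_combination -hab
  have ht4 : (b / a) ^ 4 = b := by
    field_simp
    linear_combination -hab
  have ht12 : ((b / a) ^ 6) ^ 2 = c ^ 2 := by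
    rw [← pow_mul, show 6 * 2 = 3 * 4 by norm_num, pow_mul, ht3, hab, hbc]
  have hba : b / a ≠ 0 := div_ne_zero hb0 ha0
  refine ⟨Units.mk0 (b / a) hba, c / (b / a) ^ 6, ?_, ?_, ?_, ?_⟩
  · rw [div_pow, ht12, div_self (pow_ne_zero 2 hc0)]
  · rw [Units.val_mk0, ht3, ha]
  · rw [Units.val_mk0, ht4, hb]
  · rw [Units.val_mk0, div_mul_cancel₀ _ (pow_ne_zero 6 hba), hcd, zero_smul, add_zero]

/-- The sign character of `ℤ/2ℤ`. -/
def sign : Multiplicative (ZMod 2) →* ℂ where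
  toFun s := (-1) ^ s.toAdd.val
  map_one' := by simp
  map_mul' s s' := by
    rw [toAdd_mul, ← pow_add, neg_one_pow_eq_pow_mod_two (n := s.toAdd.val + s'.toAdd.val),
      ZMod.val_add]

theorem sign_apply (s : Multiplicative (ZMod 2)) : sign s = (-1) ^ s.toAdd.val := rfl

theorem sign_sq (s : Multiplicative (ZMod 2)) : sign s ^ 2 = 1 := by
  rw [sign_apply, ← pow_mul, mul_comm, pow_mul, neg_one_sq, one_pow]

theorem sign_injective : Function.Injective sign := by
  have h : ∀ a b : ZMod 2, ((-1 : ℂ)) ^ a.val = (-1) ^ b.val → a = b := by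
    intro a b
    fin_cases a <;> fin_cases b <;>
      first | exact fun _ => rfl | exact fun h => absurd h (by norm_num [ZMod.val])
  exact fun s s' hs => Multiplicative.toAdd.injective (h _ _ hs)

theorem diagonal_relation (p : ℂˣ × Multiplicative (ZMod 2)) :
    (((p.1 : ℂ) ^ 3) • gen 0) ^ 4 + (((p.1 : ℂ) ^ 4) • gen 1) ^ 3 +
      ((sign p.2 * (p.1 : ℂ) ^ 6) • gen 2) ^ 2 = 0 := by
  rw [smul_pow, smul_pow, smul_pow, mul_pow, sign_sq, one_mul, ← pow_mul, ← pow_mul, ← pow_mul,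
    ← smul_add, ← smul_add, relation, smul_zero]

/-- The diagonal endomorphisms. -/
def diagonal : ℂˣ × Multiplicative (ZMod 2) →* (Ae6 →ₐ[ℂ] Ae6) where
  toFun p := lift _ _ _ (diagonal_relation p)
  map_one' := by
    refine algHom_ext ?_ ?_ ?_ <;> simp
  map_mul' p q := by
    refine algHom_ext ?_ ?_ ?_ <;>
    simp only [AlgHom.mul_apply, lift_gen_zero, lift_gen_one, lift_gen_two, map_smul, smul_smul,
        Prod.fst_mul, Prod.snd_mul, Units.val_mul, map_mul] <;>
    ring_nf

theorem diagonal_gen_zero (p : ℂˣ × Multiplicative (ZMod 2)) :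
    diagonal p (gen 0) = ((p.1 : ℂ) ^ 3) • gen 0 :=
  lift_gen_zero (diagonal_relation p)

theorem diagonal_gen_one (p : ℂˣ × Multiplicative (ZMod 2)) :
    diagonal p (gen 1) = ((p.1 : ℂ) ^ 4) • gen 1 :=
  lift_gen_one (diagonal_relation p)

theorem diagonal_gen_two (p : ℂˣ × Multiplicative (ZMod 2)) :
    diagonal p (gen 2) = (sign p.2 * (p.1 : ℂ) ^ 6) • gen 2 :=
  lift_gen_two (diagonal_relation p)

theorem diagonal_injective : Function.Injective diagonal := by
  rintro ⟨t, s⟩ ⟨t', s'⟩ h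
  have h0 := DFunLike.congr_fun h (gen 0)
  have h1 := DFunLike.congr_fun h (gen 1)
  have h2 := DFunLike.congr_fun h (gen 2)
  rw [diagonal_gen_zero, diagonal_gen_zero] at h0
  rw [diagonal_gen_one, diagonal_gen_one] at h1
  rw [diagonal_gen_two, diagonal_gen_two] at h2
  have h0 := smul_left_injective ℂ gen_zero_ne_zero h0
  have h1 := smul_left_injective ℂ gen_one_ne_zero h1
  have h2 := smul_left_injective ℂ gen_two_ne_zero h2
  have ht : t = t' := by
    refine Units.ext (mul_left_cancel₀ (pow_ne_zero 3 t.ne_zero) ?_)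
    rw [← pow_succ, h1, h0, ← pow_succ]
  subst ht
  exact congrArg (Prod.mk t) (sign_injective (mul_right_cancel₀ (pow_ne_zero 6 t.ne_zero) h2))

/-- The diagonal automorphisms. -/
def diagonalEquiv : ℂˣ × Multiplicative (ZMod 2) →* (Ae6 ≃ₐ[ℂ] Ae6) :=
  (AlgEquiv.algHomUnitsEquiv ℂ Ae6).toMonoidHom.comp diagonal.toHomUnits

theorem diagonalEquiv_apply (p : ℂˣ × Multiplicative (ZMod 2)) (a : Ae6) :
    diagonalEquiv p a = diagonal p a := rfl

theorem diagonalEquiv_bijective : Function.Bijective diagonalEquiv := by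
  refine ⟨fun p q h => diagonal_injective (AlgHom.ext fun a => ?_), fun φ => ?_⟩
  · rw [← diagonalEquiv_apply, h, diagonalEquiv_apply]
  · obtain ⟨t, r, hr, hx, hy, hz⟩ := exists_apply_gen_eq_smul φ
    obtain ⟨s, rfl⟩ : ∃ s, sign s = r := by
      rcases eq_or_eq_neg_of_sq_eq_sq r 1 (by rw [hr, one_pow]) with rfl | rfl
      · exact ⟨1, map_one _⟩
      · exact ⟨Multiplicative.ofAdd 1, by simp [sign_apply, ZMod.val_one]⟩
    refine ⟨(t, s), AlgEquiv.ext fun a => ?_⟩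
    have : diagonal (t, s) = φ.toAlgHom := algHom_ext ((diagonal_gen_zero _).trans hx.symm)
      ((diagonal_gen_one _).trans hy.symm) ((diagonal_gen_two _).trans hz.symm)
    exact DFunLike.congr_fun this a

end Ae6

/-- Aut(A) ≅ ℂ* × ℤ/2ℤ, via (t, ε) ↦ (x ↦ t³x, y ↦ t⁴y, z ↦ εt⁶z). -/
theorem e6_aut_group :
    ∃ e : (ℂˣ × Multiplicative (ZMod 2)) ≃* (Ae6 ≃ₐ[ℂ] Ae6),
      ∀ (t : ℂˣ) (s : Multiplicative (ZMod 2)),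
        e (t, s) (Ideal.Quotient.mk Ie6 (X 0)) =
          ((t : ℂ) ^ 3) • Ideal.Quotient.mk Ie6 (X 0) ∧
        e (t, s) (Ideal.Quotient.mk Ie6 (X 1)) =
          ((t : ℂ) ^ 4) • Ideal.Quotient.mk Ie6 (X 1) ∧
        e (t, s) (Ideal.Quotient.mk Ie6 (X 2)) =
          (((-1 : ℂ) ^ (s.toAdd.val)) * (t : ℂ) ^ 6) • Ideal.Quotient.mk Ie6 (X 2) := by
  exact ⟨MulEquiv.ofBijective Ae6.diagonalEquiv Ae6.diagonalEquiv_bijective, fun t s =>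
    ⟨Ae6.diagonal_gen_zero (t, s), Ae6.diagonal_gen_one (t, s), Ae6.diagonal_gen_two (t, s)⟩⟩

end
end
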